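/- arXiv:1011.5862 — 2 statements merged into one kernel-verified Lean document; each statement's English description precedes it below -/
import Mathlib

section
/- Let G = ⟨a_1,…,a_k | R⟩ be a presentation satisfying the C'(λ)-small cancellation condition with λ ≤ 1/6. If w ∈ F(a_1,…,a_k) is a nontrivial freely reduced word representing the identity element of G, then w contains a subword u such that u is also a subword of some r ∈ R with |u| > (1 − 3λ)|r|. -/
/-!
STATEMENT 3 (Greendlinger's lemma): if ⟨a₁,…,a_k | R⟩ is a C'(λ)-presentation
with λ ≤ 1/6 and w is a nontrivial freely reduced word representing 1 ∈ G,
then w contains a subword u of some r ∈ R with |u| > (1-3λ)|r|.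
-/

/-- The formal inverse of a word: reverse the word and invert each letter. -/
def wordInv {α : Type} (l : List (α × Bool)) : List (α × Bool) :=
  (l.map fun p => (p.1, !p.2)).reverse

/-- `u` is a (contiguous) subword of `w`. -/
def Subword {α : Type} (u w : List (α × Bool)) : Prop :=
  ∃ s t : List (α × Bool), w = s ++ u ++ t

/-- `g` is cyclically reduced: in its reduced word the first letter is not
the inverse of the last letter. -/
def CyclicallyReduced {α : Type} [DecidableEq α] (g : FreeGroup α) : Prop :=
  ∀ x y : α × Bool, g.toWord.head? = some x → g.toWord.getLast? = some y →
    x ≠ (y.1, !y.2)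

/-- `R` is a symmetrized set of cyclically reduced words: it is closed under
inversion and under all cyclic permutations. -/
def Symmetrized {α : Type} [DecidableEq α] (R : Set (FreeGroup α)) : Prop :=
  (∀ r ∈ R, CyclicallyReduced r) ∧
  (∀ r ∈ R, ∀ n : ℕ, FreeGroup.mk (r.toWord.rotate n) ∈ R) ∧
  (∀ r ∈ R, r⁻¹ ∈ R)

/-- `v` is a piece with respect to `R`: an initial segment of two distinct
elements of `R`. -/
def IsPiece {α : Type} [DecidableEq α] (R : Set (FreeGroup α)) (v : List (α × Bool)) : Prop :=
  ∃ r₁ ∈ R, ∃ r₂ ∈ R, r₁ ≠ r₂ ∧ v <+: r₁.toWord ∧ v <+: r₂.toWord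

/-- `R` is a symmetrized `C'(λ)` small cancellation set: whenever a piece `v`
with respect to `R` is a subword of some `r ∈ R`, then `|v| < λ|r|`. -/
def CPrime {α : Type} [DecidableEq α] (lam : ℝ) (R : Set (FreeGroup α)) : Prop :=
  Symmetrized R ∧
    ∀ v, IsPiece R v → ∀ r ∈ R, Subword v r.toWord →
      (v.length : ℝ) < lam * (r.toWord.length : ℝ)


namespace Gr

/-- inverse letter -/
def iv {α : Type} (x : α × Bool) : α × Bool := (x.1, !x.2)

theorem iv_iv {α : Type} (x : α × Bool) : iv (iv x) = x := by
  simp [iv]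

theorem iv_ne {α : Type} (x : α × Bool) : iv x ≠ x := by
  intro h
  have := congrArg Prod.snd h
  simp [iv] at this

theorem invRev_cons' {α : Type} (x : α × Bool) (l : List (α × Bool)) :
    FreeGroup.invRev (x :: l) = FreeGroup.invRev l ++ [iv x] := by
  simp [FreeGroup.invRev, iv]

theorem invRev_nil' {α : Type} :
    FreeGroup.invRev ([] : List (α × Bool)) = [] := rfl

theorem invRev_append' {α : Type} (l m : List (α × Bool)) :
    FreeGroup.invRev (l ++ m) = FreeGroup.invRev m ++ FreeGroup.invRev l := by
  simp [FreeGroup.invRev]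

/-- abstract properties of the set of relator words -/
structure RelSet {α : Type} (S : Set (List (α × Bool))) : Prop where
  ne : ∀ l ∈ S, l ≠ []
  rot : ∀ l m, l ++ m ∈ S → m ++ l ∈ S
  inv : ∀ l ∈ S, FreeGroup.invRev l ∈ S
  red : ∀ x y A, x :: y :: A ∈ S → y ≠ iv x

/-- `P S n W`: the word `W` bounds a diagram with `n` faces. -/
inductive P {α : Type} (S : Set (List (α × Bool))) : ℕ → List (α × Bool) → Prop
  | nil : P S 0 []
  | bridge (m n : ℕ) (x : α × Bool) (A C : List (α × Bool)) :
      P S m A → P S n C → P S (m + n) (x :: (A ++ iv x :: C))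
  | face (n : ℕ) (x : α × Bool) (s C : List (α × Bool)) :
      s ++ [iv x] ∈ S → P S n (s ++ C) → P S (n + 1) (x :: C)

theorem P.cast {α : Type} {S : Set (List (α × Bool))} {m n : ℕ} {W W' : List (α × Bool)}
    (h : P S m W) (h1 : m = n) (h2 : W = W') : P S n W' := by
  subst h1; subst h2; exact h

theorem P.append {α : Type} {S : Set (List (α × Bool))} {m n : ℕ} {A B : List (α × Bool)}
    (h : P S m A) (hB : P S n B) : P S (m + n) (A ++ B) := by
  induction h with
  | nil => simpa using hB
  | bridge m' n' x A C hA hC ihA ihC =>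
    exact (P.bridge _ _ x A _ hA ihC).cast (by omega) (by simp)
  | face n' x s C hs hC ih =>
    exact (P.face _ x s (C ++ B) hs (ih.cast rfl (by simp))).cast (by omega) (by simp)

theorem P.insert {α : Type} {S : Set (List (α × Bool))} {m n : ℕ} {A W : List (α × Bool)}
    (hA : P S m A) (h : P S n W) : ∀ B C, W = B ++ C → P S (m + n) (B ++ (A ++ C)) := by
  induction h with
  | nil =>
    intro B C h
    obtain ⟨rfl, rfl⟩ : B = [] ∧ C = [] := by simpa using h.symm
    simpa using hA
  | bridge m' n' x A' C' hA' hC' ihA ihC =>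
    intro B C h
    cases B with
    | nil =>
      simp only [List.nil_append] at h ⊢
      subst h
      exact hA.append (P.bridge _ _ _ _ _ hA' hC')
    | cons b B =>
      simp only [List.cons_append, List.cons.injEq] at h
      obtain ⟨rfl, h⟩ := h
      rcases List.append_eq_append_iff.1 h with ⟨D, h1, h2⟩ | ⟨D, h1, h2⟩
      · cases D with
        | nil =>
          simp only [List.nil_append, List.append_nil] at h1 h2
          subst h1; subst h2
          exact (P.bridge _ _ x _ _ (ihA B [] (by simp)) hC').cast (by omega) (by simp)
        | cons d D =>
          simp only [List.cons_append, List.cons.injEq] at h2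
          obtain ⟨rfl, rfl⟩ := h2
          subst h1
          exact (P.bridge _ _ x _ _ hA' (ihC D C rfl)).cast (by omega) (by simp)
      · subst h1; subst h2
        exact (P.bridge _ _ x _ _ (ihA B D rfl) hC').cast (by omega) (by simp)
  | face n' x s C' hs hC ih =>
    intro B C h
    cases B with
    | nil =>
      simp only [List.nil_append] at h ⊢
      subst h
      exact hA.append (P.face _ _ _ _ hs hC)
    | cons b B =>
      simp only [List.cons_append, List.cons.injEq] at h
      obtain ⟨rfl, rfl⟩ := h
      exact (P.face _ x s (B ++ (A ++ C)) hs ((ih (s ++ B) C (by simp)).cast rfl (by simp))).cast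
        (by omega) (by simp)

theorem rotl_of {α : Type} {S : Set (List (α × Bool))} {n : ℕ}
    (h : ∀ x C, P S n (x :: C) → P S n (C ++ [x])) (A : List (α × Bool)) :
    ∀ B, P S n (A ++ B) → P S n (B ++ A) := by
  induction A with
  | nil => intro B hB; simpa using hB
  | cons a A ih =>
    intro B hB
    have := h a (A ++ B) hB
    have := ih (B ++ [a]) (this.cast rfl (by simp))
    exact this.cast rfl (by simp)

theorem split3 {β : Type} {B s C A D : List β} {y : β}
    (h : B ++ (s ++ C) = A ++ y :: D) :
    (∃ B', B = A ++ y :: B' ∧ D = B' ++ (s ++ C)) ∨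
    (∃ p q, s = p ++ y :: q ∧ A = B ++ p ∧ D = q ++ C) ∨
    (∃ C', C = C' ++ y :: D ∧ A = B ++ (s ++ C')) := by
  rcases List.append_eq_append_iff.1 h with ⟨E, h1, h2⟩ | ⟨E, h1, h2⟩
  · subst h1
    rcases List.append_eq_append_iff.1 h2 with ⟨F, h3, h4⟩ | ⟨F, h3, h4⟩
    · exact Or.inr (Or.inr ⟨F, h4, by rw [h3]⟩)
    · cases F with
      | nil =>
        simp only [List.append_nil, List.nil_append] at h3 h4
        subst h3; subst h4
        exact Or.inr (Or.inr ⟨[], rfl, by simp⟩)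
      | cons f F =>
        simp only [List.cons_append, List.cons.injEq] at h4
        obtain ⟨rfl, rfl⟩ := h4
        exact Or.inr (Or.inl ⟨E, F, h3, rfl, rfl⟩)
  · cases E with
    | nil =>
      simp only [List.append_nil, List.nil_append] at h1 h2
      subst h1
      cases s with
      | nil => exact Or.inr (Or.inr ⟨[], by simpa using h2.symm, by simp⟩)
      | cons a s =>
        simp only [List.cons_append, List.cons.injEq] at h2
        exact Or.inr (Or.inl ⟨[], s, by simp [h2.1], by simp, h2.2⟩)
    | cons e E =>
      simp only [List.cons_append, List.cons.injEq] at h2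
      obtain ⟨rfl, rfl⟩ := h2
      exact Or.inl ⟨E, h1, rfl⟩

theorem posface_of {α : Type} {S : Set (List (α × Bool))} (hS : RelSet S) (N : ℕ)
    (hrot : ∀ m ≤ N, ∀ x C, P S m (x :: C) → P S m (C ++ [x]))
    {n : ℕ} {W : List (α × Bool)} (h : P S n W) :
    n ≤ N → ∀ B s x C, W = B ++ (s ++ C) → s ++ [iv x] ∈ S → P S (n + 1) (B ++ x :: C) := by
  induction h with
  | nil =>
    intro _ B s x C h hs
    obtain ⟨rfl, rfl, rfl⟩ : B = [] ∧ s = [] ∧ C = [] := by simpa using h.symm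
    exact P.face 0 x [] [] hs P.nil
  | bridge m n b A C0 hA hC ihA ihC =>
    intro hn B s x C h hs
    cases B with
    | nil => exact P.face _ x s C hs ((P.bridge _ _ _ _ _ hA hC).cast rfl h)
    | cons b' B =>
      simp only [List.cons_append, List.cons.injEq] at h
      obtain ⟨rfl, h⟩ := h
      rcases split3 h.symm with ⟨B', h1, h2⟩ | ⟨p, q, h1, h2, h3⟩ | ⟨C', h1, h2⟩
      · have := ihC (by omega) B' s x C h2 hs
        exact (P.bridge _ _ b _ _ hA this).cast (by omega) (by simp [h1])
      · subst h1; subst h2; subst h3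
        have h4 : P S m (p ++ B) := rotl_of (hrot m (by omega)) B p hA
        have h5 := P.bridge _ _ (iv x) _ _ h4 P.nil
        have h6 := h5.insert hC q C rfl
        have h7 := P.face (m + n) b (q ++ iv x :: p) (B ++ x :: C) (by
          have := hS.rot (p ++ [iv b]) (q ++ [iv x]) (by simpa using hs)
          simpa using this) (h6.cast (by omega) (by simp [iv_iv]))
        exact h7.cast rfl (by simp)
      · have := ihA (by omega) B s x C' h2 hs
        exact (P.bridge _ _ b _ _ this hC).cast (by omega) (by simp [h1])
  | face n b s' C0 hs' hC ih =>
    intro hn B s x C h hs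
    cases B with
    | nil => exact P.face _ x s C hs ((P.face _ _ _ _ hs' hC).cast rfl h)
    | cons b' B =>
      simp only [List.cons_append, List.cons.injEq] at h
      obtain ⟨rfl, h⟩ := h
      have := ih (by omega) (s' ++ B) s x C (by simp [h]) hs
      exact (P.face _ b s' _ hs' (this.cast rfl (List.append_assoc ..))).cast rfl (by simp)

theorem P.rot1 {α : Type} {S : Set (List (α × Bool))} (hS : RelSet S) (n : ℕ) :
    ∀ x C, P S n (x :: C) → P S n (C ++ [x]) := by
  induction n using Nat.strong_induction_on with
  | _ n IH =>
    intro x C h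
    generalize hW : x :: C = W at h
    cases h with
    | nil => simp at hW
    | bridge m n y A C0 hA hC =>
      simp only [List.cons.injEq] at hW
      obtain ⟨rfl, rfl⟩ := hW
      have := hA.append (P.bridge _ _ (iv x) _ _ hC P.nil)
      exact this.cast (by omega) (by simp [iv_iv])
    | face n y s C0 hs hC =>
      simp only [List.cons.injEq] at hW
      obtain ⟨rfl, rfl⟩ := hW
      have h1 : P S n (C ++ s) := rotl_of (IH n (by omega)) s C hC
      exact posface_of hS n (fun m hm => IH m (by omega)) h1 le_rfl C s x [] (by simp) hs

theorem P.rot {α : Type} {S : Set (List (α × Bool))} (hS : RelSet S) {n : ℕ}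
    {A B : List (α × Bool)} (h : P S n (A ++ B)) : P S n (B ++ A) :=
  rotl_of (P.rot1 hS n) A B h

theorem P.posface {α : Type} {S : Set (List (α × Bool))} (hS : RelSet S) {n : ℕ}
    {B s C : List (α × Bool)} {x : α × Bool} (h : P S n (B ++ (s ++ C)))
    (hs : s ++ [iv x] ∈ S) : P S (n + 1) (B ++ x :: C) :=
  posface_of hS n (fun m _ => P.rot1 hS m) h le_rfl B s x C rfl hs

theorem P.remove {α : Type} {S : Set (List (α × Bool))} (hS : RelSet S) {n : ℕ}
    {W : List (α × Bool)} (h : P S n W) :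
    ∀ C ρ, W = C ++ ρ → ρ ∈ S → ∃ m ≤ n + 1, P S m C := by
  induction h with
  | nil =>
    intro C ρ h _
    obtain ⟨rfl, rfl⟩ : C = [] ∧ ρ = [] := by simpa using h.symm
    exact ⟨0, by omega, P.nil⟩
  | bridge m n z A C0 hA hC ihA ihC =>
    intro C ρ h hρ
    cases C with
    | nil => exact ⟨0, by omega, P.nil⟩
    | cons z' C =>
      simp only [List.cons_append, List.cons.injEq] at h
      obtain ⟨rfl, h⟩ := h
      rcases split3 (C := []) (by simpa using h.symm) with
        ⟨B', h1, h2⟩ | ⟨p, q, h1, h2, h3⟩ | ⟨C', h1, h2⟩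
      · obtain ⟨k, hk, h3⟩ := ihC B' ρ (by simpa using h2) hρ
        exact ⟨m + k, by omega, (P.bridge _ _ z _ _ hA h3).cast rfl (by simp [h1])⟩
      · subst h1; subst h2
        have h4 : P S m (p ++ C) := hA.rot hS
        have h5 := hC.append h4
        rw [h3] at h5
        have h6 := hS.rot (p ++ [iv z]) q (by simpa using hρ)
        exact ⟨n + m + 1, by omega, P.face _ z (q ++ p) C (by simpa using h6)
          (h5.cast rfl (by simp))⟩
      · simp at h1
  | face n z s C0 hs hC ih =>
    intro C ρ h hρ
    cases C with
    | nil => exact ⟨0, by omega, P.nil⟩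
    | cons z' C =>
      simp only [List.cons_append, List.cons.injEq] at h
      obtain ⟨rfl, h⟩ := h
      obtain ⟨k, hk, h3⟩ := ih (s ++ C) ρ (by simp [h]) hρ
      exact ⟨k + 1, by omega, P.face _ z s C hs h3⟩

theorem P.del {α : Type} {S : Set (List (α × Bool))} (hS : RelSet S) {n : ℕ}
    {B C : List (α × Bool)} {y : α × Bool} (h : P S n (B ++ y :: iv y :: C)) :
    ∃ m ≤ n, P S m (B ++ C) := by
  have h1 := h.rot hS
  suffices hh : ∃ m ≤ n, P S m (C ++ B) by
    obtain ⟨m, hm, h2⟩ := hh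
    exact ⟨m, hm, h2.rot hS⟩
  generalize hD : C ++ B = D
  have h2 : P S n (y :: iv y :: D) := h1.cast rfl (by simp [← hD])
  clear h1 h hD
  generalize hW : y :: iv y :: D = W at h2
  cases h2 with
  | nil => simp at hW
  | bridge m n z A C0 hA hC =>
    simp only [List.cons.injEq] at hW
    obtain ⟨rfl, hW⟩ := hW
    cases A with
    | nil =>
      simp only [List.nil_append, List.cons.injEq, true_and] at hW
      exact ⟨n, by omega, hC.cast rfl hW.symm⟩
    | cons a A =>
      simp only [List.cons_append, List.cons.injEq] at hW
      obtain ⟨rfl, rfl⟩ := hW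
      exact ⟨m + n, le_rfl, ((P.rot1 hS _ _ _ hA).append hC).cast rfl (by simp)⟩
  | face n z s C0 hs hC =>
    simp only [List.cons.injEq] at hW
    obtain ⟨rfl, rfl⟩ := hW
    have h3 : P S n (D ++ (s ++ [iv y])) := P.rot hS (hC.cast rfl (by simp))
    exact h3.remove hS D _ rfl hs

theorem P.pair {α : Type} {S : Set (List (α × Bool))} (y : α × Bool) : P S 0 [y, iv y] :=
  P.bridge 0 0 y [] [] P.nil P.nil

theorem P.step {α : Type} {S : Set (List (α × Bool))} (hS : RelSet S) {n : ℕ}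
    {W W' : List (α × Bool)} (hst : FreeGroup.Red.Step W W') :
    (∃ m ≤ n, P S m W) ↔ (∃ m ≤ n, P S m W') := by
  obtain ⟨⟩ := hst
  rename_i L1 L2 x b
  constructor
  · rintro ⟨m, hm, h⟩
    obtain ⟨k, hk, h'⟩ := P.del (y := (x, b)) hS h
    exact ⟨k, by omega, h'⟩
  · rintro ⟨m, hm, h⟩
    refine ⟨m, hm, ?_⟩
    exact ((P.pair (x, b)).insert h L1 L2 rfl).cast (by omega) (by simp [iv])

theorem P.congr {α : Type} {S : Set (List (α × Bool))} (hS : RelSet S) {n : ℕ}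
    {W W' : List (α × Bool)} (hm : FreeGroup.mk W = FreeGroup.mk W')
    (h : P S n W) : ∃ m ≤ n, P S m W' := by
  have key : ∀ {W W' : List (α × Bool)}, FreeGroup.Red W W' →
      ((∃ m ≤ n, P S m W) ↔ (∃ m ≤ n, P S m W')) := by
    intro W W' h
    induction h with
    | refl => rfl
    | tail _ hs ih => exact ih.trans (P.step hS hs)
  obtain ⟨V, h1, h2⟩ := FreeGroup.Red.exact.1 hm
  exact (key h2).2 ((key h1).1 ⟨n, le_rfl, h⟩)

theorem P.invRev {α : Type} {S : Set (List (α × Bool))} (hS : RelSet S) {n : ℕ}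
    {W : List (α × Bool)} (h : P S n W) : P S n (FreeGroup.invRev W) := by
  induction h with
  | nil => exact P.nil
  | bridge m n x A C hA hC ihA ihC =>
    have := ihC.append (P.bridge _ _ x _ _ ihA P.nil)
    exact this.cast (by omega) (by simp [invRev_cons', invRev_append', iv_iv])
  | face n x s C hs hC ih =>
    have h1 : FreeGroup.invRev s ++ [iv (iv x)] ∈ S := by
      have := hS.inv _ hs
      rw [invRev_append'] at this
      exact hS.rot _ _ (by simpa [invRev_cons', invRev_nil'] using this)
    have h2 := P.posface hS (B := FreeGroup.invRev C) (C := []) (x := iv x)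
      (ih.cast rfl (by simp [invRev_append'])) h1
    exact h2.cast rfl (by simp [invRev_cons'])

theorem P.relator {α : Type} {S : Set (List (α × Bool))} (hS : RelSet S)
    {r : List (α × Bool)} (h : r ∈ S) : P S 1 r := by
  cases r with
  | nil => exact absurd rfl (hS.ne _ h)
  | cons x C =>
    have h1 := hS.inv _ h
    rw [invRev_cons'] at h1
    have h2 : P S 0 (FreeGroup.invRev C ++ C) := by
      clear h1 h
      induction C with
      | nil => exact P.nil
      | cons c C ih =>
        have := (P.pair (S := S) (iv c)).insert ih _ _ rfl
        exact this.cast rfl (by simp [invRev_cons', iv_iv])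
    exact P.face 0 x _ _ h1 h2

theorem P.exists_of {α : Type} [DecidableEq α] {S : Set (List (α × Bool))} (hS : RelSet S)
    {R : Set (FreeGroup α)} (hR : ∀ r ∈ R, r.toWord ∈ S) {g : FreeGroup α}
    (hg : g ∈ Subgroup.normalClosure R) : ∃ n, P S n g.toWord := by
  let N : Subgroup (FreeGroup α) :=
    { carrier := {g | ∃ n W, FreeGroup.mk W = g ∧ P S n W}
      one_mem' := ⟨0, [], rfl, P.nil⟩
      mul_mem' := by
        rintro a b ⟨m, A, rfl, hA⟩ ⟨n, B, rfl, hB⟩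
        exact ⟨m + n, A ++ B, by simp, hA.append hB⟩
      inv_mem' := by
        rintro a ⟨m, A, rfl, hA⟩
        exact ⟨m, FreeGroup.invRev A, by simp [FreeGroup.inv_mk], hA.invRev hS⟩ }
  have hN : N.Normal := by
    constructor
    rintro _ ⟨n, W, rfl, h⟩ g
    induction g using FreeGroup.induction_on generalizing n W with
    | C1 => exact ⟨n, W, by simp, h⟩
    | of x =>
      refine ⟨n, (x, true) :: (W ++ iv (x, true) :: []), ?_, P.bridge n 0 _ _ _ h P.nil⟩
      simp [FreeGroup.of, FreeGroup.inv_mk, FreeGroup.invRev, iv]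
    | inv_of x _ =>
      refine ⟨n, (x, false) :: (W ++ iv (x, false) :: []), ?_, P.bridge n 0 _ _ _ h P.nil⟩
      simp [FreeGroup.of, FreeGroup.inv_mk, FreeGroup.invRev, iv]
    | mul a b iha ihb =>
      obtain ⟨n', W', h1, h2⟩ := ihb n W h
      obtain ⟨n2, W2, h3, h4⟩ := iha n' W' h2
      exact ⟨n2, W2, by rw [h3, h1]; group, h4⟩
  have : g ∈ N := by
    refine Subgroup.normalClosure_le_normal (N := N) ?_ hg
    intro r hr
    exact ⟨1, r.toWord, FreeGroup.mk_toWord, P.relator hS (hR r hr)⟩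
  obtain ⟨n, W, h1, h2⟩ := this
  obtain ⟨m, _, h3⟩ := h2.congr hS (W' := g.toWord) (by rw [h1, FreeGroup.mk_toWord])
  exact ⟨m, h3⟩

end Gr


namespace Gr

/-- A face of the diagram: an identifier, its boundary word, and the position of its base point. -/
structure Face (α G : Type) where
  id : ℕ
  word : List (α × Bool)
  pos : G

/-- A dart is a face with an index of a letter on its boundary. -/
abbrev Dart (α G : Type) := Face α G × ℕ

/-- evaluation of a word -/
def ps {α G : Type} [Group G] (φ : FreeGroup α →* G) (l : List (α × Bool)) : G :=
  φ (FreeGroup.mk l)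

theorem ps_append {α G : Type} [Group G] (φ : FreeGroup α →* G) (l m : List (α × Bool)) :
    ps φ (l ++ m) = ps φ l * ps φ m := by
  simp [ps, ← FreeGroup.mul_mk]

theorem ps_cons {α G : Type} [Group G] (φ : FreeGroup α →* G) (x : α × Bool)
    (m : List (α × Bool)) : ps φ (x :: m) = ps φ [x] * ps φ m := by
  rw [← ps_append]; rfl

theorem ps_nil {α G : Type} [Group G] (φ : FreeGroup α →* G) :
    ps φ ([] : List (α × Bool)) = 1 := by
  simp [ps, ← FreeGroup.one_eq_mk]

theorem ps_invRev {α G : Type} [Group G] (φ : FreeGroup α →* G) (l : List (α × Bool)) :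
    ps φ (FreeGroup.invRev l) = (ps φ l)⁻¹ := by
  simp [ps, ← FreeGroup.inv_mk]

theorem ps_iv {α G : Type} [Group G] (φ : FreeGroup α →* G) (x : α × Bool) :
    ps φ [iv x] = (ps φ [x])⁻¹ := by
  rw [← ps_invRev]; rfl

theorem P.sound {α G : Type} [Group G] (φ : FreeGroup α →* G) {S : Set (List (α × Bool))}
    (hφ : ∀ l ∈ S, ps φ l = 1) {n : ℕ} {W : List (α × Bool)} (h : P S n W) : ps φ W = 1 := by
  induction h with
  | nil => exact ps_nil φ
  | bridge m n x A C hA hC ihA ihC =>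
    rw [ps_cons, ps_append, ps_cons φ (iv x), ihA, ihC, ps_iv]; simp
  | face n x s C hs hC ih =>
    have h1 := hφ _ hs
    rw [ps_append, ps_iv, mul_inv_eq_one] at h1
    rw [ps_append] at ih
    rw [ps_cons, ← h1, ih]

section
variable {α G : Type} [Inhabited α] [Group G]

/-- label of a dart -/
def lab (d : Dart α G) : α × Bool := d.1.word.getD d.2 default

/-- next dart on the boundary of the face -/
def next (d : Dart α G) : Dart α G := (d.1, if d.2 + 1 = d.1.word.length then 0 else d.2 + 1)

/-- the rest of the boundary word of the face, read after the dart -/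
def tl (d : Dart α G) : List (α × Bool) := d.1.word.drop (d.2 + 1) ++ d.1.word.take d.2

/-- position of the start of a dart -/
def dpos (φ : FreeGroup α →* G) (d : Dart α G) : G := d.1.pos * ps φ (d.1.word.take d.2)

/-- a run of darts -/
def seg (f : Face α G) (i n : ℕ) : List (Dart α G) := (List.range' i n).map (fun j => (f, j))

/-- all darts of a face -/
def fd (f : Face α G) : List (Dart α G) := seg f 0 f.word.length

/-- letters of a boundary state -/
def letters (Z : List (Dart α G × Bool)) : List (Dart α G) := (Z.filter (fun p => p.2)).map Prod.fst

/-- boundary walks -/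
def Walk (Rel : Dart α G → Dart α G → Prop) :
    Dart α G → List (Dart α G × Bool) → Dart α G → Prop
  | t, [], u => t = u
  | t, (c, b) :: l, u => (if b then t = c else Rel t c) ∧ Walk Rel (next c) l u

/-- walks around a vertex -/
def VWalk (Rel : Dart α G → Dart α G → Prop) : Dart α G → List (Dart α G) → Dart α G → Prop
  | t, [], u => t = u
  | t, c :: l, u => Rel t c ∧ VWalk Rel (next c) l u

/-- consistency of positions -/
def PosOK (φ : FreeGroup α →* G) : G → List (Dart α G) → Prop
  | _, [] => True
  | g, d :: D => dpos φ d = g ∧ PosOK φ (g * ps φ [lab d]) D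

theorem Walk_append (Rel : Dart α G → Dart α G → Prop) (l m : List (Dart α G × Bool)) :
    ∀ t u, Walk Rel t (l ++ m) u ↔ ∃ s, Walk Rel t l s ∧ Walk Rel s m u := by
  induction l with
  | nil => intro t u; simp [Walk]
  | cons a l ih =>
    intro t u
    obtain ⟨c, b⟩ := a
    simp only [List.cons_append, Walk, ih]
    constructor
    · rintro ⟨h1, s, h2, h3⟩; exact ⟨s, ⟨h1, h2⟩, h3⟩
    · rintro ⟨s, ⟨h1, h2⟩, h3⟩; exact ⟨h1, s, h2, h3⟩

theorem Walk_mono {Rel Rel' : Dart α G → Dart α G → Prop} (h : ∀ a b, Rel a b → Rel' a b)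
    (l : List (Dart α G × Bool)) : ∀ t u, Walk Rel t l u → Walk Rel' t l u := by
  induction l with
  | nil => intro t u; simp [Walk]
  | cons a l ih =>
    intro t u
    obtain ⟨c, b⟩ := a
    rintro ⟨h1, h2⟩
    refine ⟨?_, ih _ _ h2⟩
    cases b
    · simpa using h _ _ (by simpa using h1)
    · simpa using h1

theorem VWalk_mono {Rel Rel' : Dart α G → Dart α G → Prop} (h : ∀ a b, Rel a b → Rel' a b)
    (l : List (Dart α G)) : ∀ t u, VWalk Rel t l u → VWalk Rel' t l u := by
  induction l with
  | nil => intro t u; simp [VWalk]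
  | cons c l ih =>
    intro t u
    rintro ⟨h1, h2⟩
    exact ⟨h _ _ h1, ih _ _ h2⟩

theorem VWalk_of_Walk {Rel : Dart α G → Dart α G → Prop}
    (l : List (Dart α G × Bool)) (hl : letters l = []) :
    ∀ t u, Walk Rel t l u → VWalk Rel t (l.map Prod.fst) u := by
  induction l with
  | nil => intro t u; simp [Walk, VWalk]
  | cons a l ih =>
    intro t u
    obtain ⟨c, b⟩ := a
    cases b
    · rintro ⟨h1, h2⟩
      exact ⟨by simpa using h1, ih (by simpa [letters] using hl) _ _ h2⟩
    · simp [letters] at hl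

theorem PosOK_append (φ : FreeGroup α →* G) (l m : List (Dart α G)) :
    ∀ g, PosOK φ g (l ++ m) ↔ PosOK φ g l ∧ PosOK φ (g * ps φ (l.map lab)) m := by
  induction l with
  | nil => intro g; simp [PosOK, ps_nil]
  | cons d l ih =>
    intro g
    simp only [List.cons_append, PosOK, ih, List.map_cons]
    rw [ps_cons φ _ (l.map lab), and_assoc, mul_assoc]

theorem letters_append (l m : List (Dart α G × Bool)) :
    letters (l ++ m) = letters l ++ letters m := by simp [letters]

theorem letters_split (Z : List (Dart α G × Bool)) :
    ∀ A d D, letters Z = A ++ d :: D →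
      ∃ Z1 Z2, Z = Z1 ++ (d, true) :: Z2 ∧ letters Z1 = A ∧ letters Z2 = D := by
  induction Z with
  | nil => intro A d D h; simp [letters] at h
  | cons a Z ih =>
    intro A d D h
    obtain ⟨c, b⟩ := a
    cases b
    · obtain ⟨Z1, Z2, h1, h2, h3⟩ := ih A d D (by simpa [letters] using h)
      exact ⟨(c, false) :: Z1, Z2, by simp [h1], by simpa [letters] using h2, h3⟩
    · cases A with
      | nil =>
        have h' : c = d ∧ letters Z = D := by simpa [letters] using h
        exact ⟨[], Z, by simp [h'.1], by simp [letters], h'.2⟩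
      | cons a A =>
        have h' : c = a ∧ letters Z = A ++ d :: D := by simpa [letters] using h
        obtain ⟨Z1, Z2, h1, h2, h3⟩ := ih A d D h'.2
        refine ⟨(c, true) :: Z1, Z2, by simp [h1], ?_, h3⟩
        rw [← h2, ← h'.1]; simp [letters]

theorem seg_getElem? {f : Face α G} {n : ℕ} {B C : List (Dart α G)} {d : Dart α G}
    (h : seg f 0 n = B ++ d :: C) : d = (f, B.length) := by
  have h1 := congrArg (fun l => l[B.length]?) h
  have h2 : B.length < n := by
    have := congrArg List.length h
    simp [seg] at this; omega
  simp [seg, h2] at h1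
  exact h1.symm

theorem seg_map_lab (f : Face α G) (n : ℕ) : ∀ i, i + n ≤ f.word.length →
    (seg f i n).map lab = (f.word.drop i).take n := by
  induction n with
  | zero => intro i _; simp [seg]
  | succ n ih =>
    intro i hi
    have h1 := ih (i + 1) (by omega)
    have h2 : f.word.drop i = f.word[i] :: f.word.drop (i + 1) := List.drop_eq_getElem_cons _
    rw [h2, List.take_succ_cons, ← h1]
    simp only [seg, List.range'_succ, List.map_cons]
    simp [lab, List.getD_eq_getElem?_getD, List.getElem?_eq_getElem (show i < f.word.length by omega)]

theorem dpos_succ (φ : FreeGroup α →* G) (f : Face α G) (i : ℕ) (hi : i < f.word.length) :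
    dpos φ (f, i + 1) = dpos φ (f, i) * ps φ [lab (f, i)] := by
  simp only [dpos, lab]
  rw [List.take_add_one, ps_append, mul_assoc]
  simp [List.getD_eq_getElem?_getD, List.getElem?_eq_getElem hi]

theorem seg_PosOK (φ : FreeGroup α →* G) (f : Face α G) (n : ℕ) : ∀ i, i + n ≤ f.word.length →
    PosOK φ (dpos φ (f, i)) (seg f i n) := by
  induction n with
  | zero => intro i _; simp [seg, PosOK]
  | succ n ih =>
    intro i hi
    have h1 := ih (i + 1) (by omega)
    simp only [seg, List.range'_succ, List.map_cons, PosOK, true_and] at h1 ⊢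
    rw [← dpos_succ φ f i (by omega)]
    exact h1

theorem self_inv_red {v : List (α × Bool)} (h : FreeGroup.invRev v = v) (hv : v ≠ []) :
    ∃ A y B, v = A ++ y :: iv y :: B := by
  generalize hn : v.length = n
  induction n using Nat.strong_induction_on generalizing v with
  | _ n IH =>
    cases v with
    | nil => exact absurd rfl hv
    | cons y l =>
      rcases List.eq_nil_or_concat l with rfl | ⟨m, z, rfl⟩
      · rw [invRev_cons'] at h
        simp [invRev_nil'] at h
        exact absurd h (iv_ne y)
      · rw [List.concat_eq_append, invRev_cons', invRev_append', invRev_cons', invRev_nil'] at h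
        simp only [List.nil_append, List.cons_append, List.cons.injEq] at h
        obtain ⟨h1, h2⟩ := h
        have h3 := List.append_inj' h2 rfl
        have h4 : iv y = z := by simpa using h3.2
        by_cases hm : m = []
        · subst hm; exact ⟨[], y, [], by simp [h4]⟩
        · obtain ⟨A, x, B, hB⟩ := IH m.length (by simp at hn; omega) h3.1 hm rfl
          exact ⟨y :: A, x, B ++ [z], by simp [hB]⟩

theorem not_rot_inv {S : Set (List (α × Bool))} (hS : RelSet S) {u v : List (α × Bool)}
    (h : u ++ v ∈ S) (hi : FreeGroup.invRev (u ++ v) = v ++ u) : False := by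
  rw [invRev_append'] at hi
  obtain ⟨h1, h2⟩ := List.append_inj hi (by simp)
  by_cases hv : v = []
  · by_cases hu : u = []
    · exact hS.ne _ h (by simp [hu, hv])
    · obtain ⟨A, y, B, rfl⟩ := self_inv_red h2 hu
      exact hS.red y (iv y) (B ++ v ++ A) (by
        have := hS.rot A (y :: iv y :: B ++ v) (by simpa using h)
        simpa using this) rfl
  · obtain ⟨A, y, B, rfl⟩ := self_inv_red h1 hv
    exact hS.red y (iv y) (B ++ u ++ A) (by
        have := hS.rot (u ++ A) (y :: iv y :: B) (by simpa using h)
        simpa using this) rfl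

/-- invariants of boundary state -/
structure Inv (S : Set (List (α × Bool))) (n : ℕ) (D : List (Dart α G)) : Prop where
  mn : ∀ m, P S m (D.map lab) → n ≤ m
  i1 : ∀ B d C, D = B ++ d :: C → d.1.id ≠ 0 → ∀ m,
    P S m (B.map lab ++ (FreeGroup.invRev (tl d) ++ C.map lab)) → n ≤ m
  i2 : ∀ B d A e C, D = B ++ d :: (A ++ e :: C) → d.1.id ≠ 0 → e.1.id ≠ 0 → lab e = iv (lab d) →
    ∀ a b, P S a (A.map lab) → P S b (B.map lab ++ C.map lab) → a + b ≤ n →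
      tl e ≠ FreeGroup.invRev (tl d)

theorem Inv.bridgeA {S : Set (List (α × Bool))} {m n : ℕ} {x z : Dart α G}
    {A C : List (Dart α G)} (hz : lab z = iv (lab x))
    (h : Inv S (m + n) (x :: (A ++ z :: C))) (hC : P S n (C.map lab)) : Inv S m A := by
  refine ⟨?_, ?_, ?_⟩
  · intro m' h'
    have := h.mn _ ((P.bridge _ _ (lab x) _ _ h' hC).cast rfl (by simp [hz]))
    omega
  · intro B d C1 hA hd m' h'
    subst hA
    have := h.i1 (x :: B) d (C1 ++ z :: C) (by simp) hd _
      ((P.bridge _ _ (lab x) _ _ h' hC).cast rfl (by simp [hz]))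
    omega
  · intro B d A1 e C1 hA hd he hl a b ha hb hab
    subst hA
    exact h.i2 (x :: B) d A1 e (C1 ++ z :: C) (by simp) hd he hl _ _ ha
      ((P.bridge _ _ (lab x) _ _ hb hC).cast rfl (by simp [hz])) (by omega)

theorem Inv.bridgeC {S : Set (List (α × Bool))} {m n : ℕ} {x z : Dart α G}
    {A C : List (Dart α G)} (hz : lab z = iv (lab x))
    (h : Inv S (m + n) (x :: (A ++ z :: C))) (hA : P S m (A.map lab)) : Inv S n C := by
  refine ⟨?_, ?_, ?_⟩
  · intro m' h'
    have := h.mn _ ((P.bridge _ _ (lab x) _ _ hA h').cast rfl (by simp [hz]))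
    omega
  · intro B d C1 hC hd m' h'
    subst hC
    have := h.i1 (x :: A ++ z :: B) d C1 (by simp) hd _
      ((P.bridge _ _ (lab x) _ _ hA h').cast rfl (by simp [hz]))
    omega
  · intro B d A1 e C1 hC hd he hl a b ha hb hab
    subst hC
    exact h.i2 (x :: A ++ z :: B) d A1 e C1 (by simp) hd he hl _ _ ha
      ((P.bridge _ _ (lab x) _ _ hA hb).cast rfl (by simp [hz])) (by omega)

theorem Inv.face {S : Set (List (α × Bool))} (hS : RelSet S) {n : ℕ} {x : Dart α G}
    {C : List (Dart α G)} {s : List (α × Bool)} {f : Face α G}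
    (hf : f.word = s ++ [iv (lab x)]) (hs : s ++ [iv (lab x)] ∈ S)
    (h : Inv S (n + 1) (x :: C)) : Inv S n (seg f 0 s.length ++ C) := by
  have hlab : (seg f 0 s.length).map lab = s := by
    rw [seg_map_lab _ _ _ (by simp [hf])]; simp [hf]
  -- splitting of a new dart
  have hnew : ∀ {B d E}, seg f 0 s.length = B ++ d :: E →
      s = B.map lab ++ lab d :: E.map lab ∧ tl d = E.map lab ++ iv (lab x) :: B.map lab := by
    intro B d E hB
    have h1 : s = B.map lab ++ lab d :: E.map lab := by
      rw [← hlab, hB]; simp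
    refine ⟨h1, ?_⟩
    have h2 := seg_getElem? hB
    have h3 : tl d = f.word.drop (B.length + 1) ++ f.word.take B.length := by
      conv_lhs => rw [h2]
      rfl
    rw [h3, hf]
    have h4 : s ++ [iv (lab x)] =
        (B.map lab ++ [lab d]) ++ (E.map lab ++ [iv (lab x)]) := by rw [h1]; simp
    have h5 : s ++ [iv (lab x)] =
        (B.map lab) ++ (lab d :: E.map lab ++ [iv (lab x)]) := by rw [h1]; simp
    have e1 : List.drop (B.length + 1) (s ++ [iv (lab x)]) = E.map lab ++ [iv (lab x)] := by
      rw [h4]; exact List.drop_left' (by simp)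
    have e2 : List.take B.length (s ++ [iv (lab x)]) = B.map lab := by
      rw [h5]; exact List.take_left' (by simp)
    rw [e1, e2]; simp
  refine ⟨?_, ?_, ?_⟩
  · intro m' h'
    rw [List.map_append, hlab] at h'
    have := h.mn _ (P.face _ (lab x) s (C.map lab) hs h')
    omega
  · intro B d C1 hD hd m' h'
    rcases split3 (s := C) (C := []) (by simpa using hD) with
        ⟨B', h1, h2⟩ | ⟨p, q, h1, h2, h3⟩ | ⟨C', h1, h2⟩
    · obtain ⟨e1, e2⟩ := hnew h1
      simp only [List.append_nil] at h2
      subst h2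
      obtain ⟨m2, hm2, h4⟩ := h'.congr hS (W' := lab x :: C.map lab) (by
        rw [e2]
        simp only [← FreeGroup.mul_mk, List.map_append, invRev_append', invRev_cons',
          ← FreeGroup.inv_mk, iv_iv]
        rw [show lab x :: C.map lab = [lab x] ++ C.map lab from rfl, ← FreeGroup.mul_mk]
        group)
      have := h.mn _ h4
      omega
    · subst h1; subst h2
      simp only [List.append_nil] at h3
      subst h3
      have := h.i1 (x :: p) d C1 (by simp) hd _
        (P.face _ (lab x) s _ hs (h'.cast rfl (by simp [hlab])))
      omega
    · simp at h1
  · intro B d A e C2 hD hd he hl a b ha hb hab htl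
    rcases split3 (s := C) (C := []) (by simpa using hD) with
        ⟨B', h1, h2⟩ | ⟨p, q, h1, h2, h3⟩ | ⟨C', h1, h2⟩
    · obtain ⟨e1, e2⟩ := hnew h1
      rcases split3 (s := C) (C := []) h2.symm with
        ⟨B'', h3, h4⟩ | ⟨p, q, h3, h4, h5⟩ | ⟨C', h3, h4⟩
      · -- both new
        subst h3
        obtain ⟨e3, e4⟩ := hnew (B := B ++ d :: A) (d := e) (E := B'') (by rw [h1]; simp)
        rw [e4, e2] at htl
        have k1 : (B.map lab ++ lab d :: A.map lab) ++
            (lab e :: B''.map lab ++ [iv (lab x)]) ∈ S := by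
          have := hs
          rw [e1] at this
          simpa using this
        have k2 : lab e :: (B''.map lab ++ iv (lab x) :: (B.map lab ++ lab d :: A.map lab)) =
          FreeGroup.invRev ((A.map lab ++ lab e :: B''.map lab ++ iv (lab x) :: B.map lab) ++
            [lab d]) := by
          rw [invRev_append', invRev_cons', invRev_nil', ← hl]
          simpa using htl
        have k3 := hS.rot _ _ k1
        have k4 : (lab d :: A.map lab) ++
            (lab e :: B''.map lab ++ iv (lab x) :: B.map lab) ∈ S := by
          have := hS.rot (lab e :: B''.map lab ++ iv (lab x) :: B.map lab) (lab d :: A.map lab)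
            (by simpa using k3)
          simpa using this
        have k5 := hS.rot [lab d] (A.map lab ++ lab e :: B''.map lab ++ iv (lab x) :: B.map lab)
          (by simpa using k4)
        refine not_rot_inv hS (u := A.map lab)
          (v := lab e :: B''.map lab ++ iv (lab x) :: B.map lab ++ [lab d]) (by simpa using k5) ?_
        have := k2.symm
        simpa using this
      · simp only [List.append_nil] at h5
        subst h5; subst h4
        rw [h3] at h
        have := h.i1 (x :: p) e C2 (by simp) he (a + b) (by
          rw [htl, FreeGroup.invRev_invRev, e2]
          have h6 : P S a (p.map lab ++ B'.map lab) := P.rot hS (ha.cast rfl (by simp))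
          exact (P.bridge _ _ (lab x) _ _ h6 hb).cast rfl (by simp))
        omega
      · simp at h3
    · subst h1; subst h2
      simp only [List.append_nil] at h3
      subst h3
      exact h.i2 (x :: p) d A e C2 (by simp) hd he hl a (b + 1) ha
        (P.face _ (lab x) s _ hs (hb.cast rfl (by simp [hlab]))) (by omega) htl
    · simp at h1
end

end Gr


namespace Gr

section
variable {α G : Type} [Inhabited α] [Group G]

/-- the combinatorial planar map obtained from a derivation -/
structure Res (S : Set (List (α × Bool))) (φ : FreeGroup α →* G) (k n : ℕ)
    (D Zf : List (Dart α G)) (Rel : Dart α G → Dart α G → Prop)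
    (F : List (Face α G)) (ln : List (Dart α G × Dart α G)) (vs : List (List (Dart α G))) :
    Prop where
  ids : ∀ f ∈ F, k ≤ f.id ∧ f.id < k + n
  nd : (F.map Face.id).Nodup
  wS : ∀ f ∈ F, f.word ∈ S
  lperm : (ln.map Prod.fst).Perm (D ++ F.flatMap fd)
  symm : ∀ d e, (d, e) ∈ ln → (e, d) ∈ ln
  linv : ∀ d e, (d, e) ∈ ln → lab e = iv (lab d)
  lpos : ∀ d e, (d, e) ∈ ln → dpos φ e = dpos φ d * ps φ [lab d]
  nm : ∀ d e, (d, e) ∈ ln → d.1.id ≠ 0 → e.1.id ≠ 0 → tl e ≠ FreeGroup.invRev (tl d)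
  vperm : vs.flatten.Perm (Zf ++ F.flatMap fd)
  vne : ∀ v ∈ vs, v ≠ []
  vw : ∀ v ∈ vs, ∃ t, VWalk (fun a b => Rel a b ∨ (a, b) ∈ ln) t v t
  cnt : 2 * vs.length + 2 * F.length = ln.length + 2

theorem Walk_seg (Rel : Dart α G → Dart α G → Prop) (f : Face α G) (n : ℕ) :
    ∀ i, i + n < f.word.length →
    Walk Rel (f, i) ((seg f i n).map (fun d => (d, true))) (f, i + n) := by
  induction n with
  | zero => intro i _; simp [seg, Walk]
  | succ n ih =>
    intro i hi
    have h1 := ih (i + 1) (by omega)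
    simp only [seg, List.range'_succ, List.map_cons, Walk, if_true, true_and] at h1 ⊢
    have h2 : next (f, i) = (f, i + 1) := by
      simp only [next]
      rw [if_neg (by omega)]
    rw [h2, show i + (n + 1) = i + 1 + n by omega]
    exact h1

theorem letters_seg (D : List (Dart α G)) : letters (D.map (fun d => (d, true))) = D := by
  induction D with
  | nil => rfl
  | cons d D ih => simp only [letters] at ih ⊢; simp [ih]

theorem build {S : Set (List (α × Bool))} (hS : RelSet S) (φ : FreeGroup α →* G)
    (hφ : ∀ l ∈ S, ps φ l = 1) {n : ℕ} {W : List (α × Bool)} (h : P S n W) :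
    ∀ (Z : List (Dart α G × Bool)) (t : Dart α G) (g : G) (k : ℕ)
      (Rel : Dart α G → Dart α G → Prop),
      W = (letters Z).map lab → Z ≠ [] → Inv S n (letters Z) → Walk Rel t Z t →
      PosOK φ g (letters Z) → 1 ≤ k →
      ∃ F ln vs, Res S φ k n (letters Z) (Z.map Prod.fst) Rel F ln vs := by
  induction h with
  | nil =>
    intro Z t g k Rel hW hZ hI hwalk hpos hk
    have hl : letters Z = [] := by simpa using hW.symm
    refine ⟨[], [], [Z.map Prod.fst], ?_⟩
    constructor <;> simp [hl, hZ]
    exact ⟨t.1, t.2, VWalk_of_Walk Z hl t t hwalk⟩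
  | bridge m n x A C hA hC ihA ihC =>
    intro Z t g k Rel hW hZ hI hwalk hpos hk
    obtain ⟨dx, D1, hD1, hx, hD2⟩ := List.map_eq_cons_iff.1 hW.symm
    obtain ⟨DA, D2, rfl, hDA, hD3⟩ := List.map_eq_append_iff.1 hD2
    obtain ⟨dz, DC, rfl, hz, hDC⟩ := List.map_eq_cons_iff.1 hD3
    obtain ⟨Lc, Z1, rfl, hLc, hZ1⟩ := letters_split Z [] dx _ hD1
    obtain ⟨ZA, ZC, rfl, hZA, hZC⟩ := letters_split Z1 DA dz _ hZ1
    rw [hD1] at hI hpos ⊢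
    have hlz : lab dz = iv (lab dx) := by rw [hz, hx]
    rw [← hx] at hW hD2
    subst hDA; subst hDC
    obtain ⟨t1, hw1, hw2⟩ := (Walk_append _ _ _ _ _).1 hwalk
    simp only [Walk, if_true] at hw2
    obtain ⟨rfl, hw2⟩ := hw2
    obtain ⟨t2, hw3, hw4⟩ := (Walk_append _ _ _ _ _).1 hw2
    simp only [Walk, if_true] at hw4
    obtain ⟨rfl, hw4⟩ := hw4
    rw [PosOK, PosOK_append, PosOK] at hpos
    obtain ⟨hp1, hp2, hp3, hp4⟩ := hpos
    have hsA := hA.sound φ hφ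
    have hIA := hI.bridgeA hlz hC
    have hIC := hI.bridgeC hlz hA
    have hnm := hI.i2 [] t1 DA t2 DC rfl
    rw [hsA, mul_one] at hp3 hp4
    rw [hlz, ps_iv, mul_inv_cancel_right] at hp4
    let Rel' : Dart α G → Dart α G → Prop :=
      fun a b => Rel a b ∨ (a, b) = (t1, t2) ∨ (a, b) = (t2, t1)
    have hmono : ∀ a b, Rel a b → Rel' a b := fun a b h => Or.inl h
    have lA : letters ((t1, false) :: ZA) = DA := by rw [← hZA]; simp [letters]
    have lC : letters (Lc ++ (t2, false) :: ZC) = DC := by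
      rw [letters_append, hLc, ← hZC]; simp [letters]
    obtain ⟨FA, lnA, vsA, hRA⟩ := ihA ((t1, false) :: ZA) t2 (g * ps φ [lab t1]) k Rel'
      (by rw [lA]) (by simp) (by rw [lA]; exact hIA)
      ⟨by simp [Rel'], Walk_mono hmono _ _ _ hw3⟩ (by rw [lA]; exact hp2) hk
    obtain ⟨FC, lnC, vsC, hRC⟩ := ihC (Lc ++ (t2, false) :: ZC) t g (k + m) Rel'
      (by rw [lC]) (by simp) (by rw [lC]; exact hIC)
      ((Walk_append _ _ _ _ _).2 ⟨t1, Walk_mono hmono _ _ _ hw1, by simp [Rel'],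
        Walk_mono hmono _ _ _ hw4⟩) (by rw [lC]; exact hp4) (by omega)
    rw [lA] at hRA
    rw [lC] at hRC
    refine ⟨FA ++ FC, (t1, t2) :: (t2, t1) :: (lnA ++ lnC), vsA ++ vsC, ?_⟩
    refine ⟨?_, ?_, ?_, ?_, ?_, ?_, ?_, ?_, ?_, ?_, ?_, ?_⟩
    · intro f hf
      rcases List.mem_append.1 hf with hf | hf
      · have := hRA.ids f hf; omega
      · have := hRC.ids f hf; omega
    · rw [List.map_append, List.nodup_append]
      refine ⟨hRA.nd, hRC.nd, ?_⟩
      intro a ha b hb hab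
      obtain ⟨f, hf, rfl⟩ := List.mem_map.1 ha
      obtain ⟨f', hf', rfl⟩ := List.mem_map.1 hb
      have := hRA.ids f hf
      have := hRC.ids f' hf'
      omega
    · intro f hf
      rcases List.mem_append.1 hf with hf | hf
      · exact hRA.wS f hf
      · exact hRC.wS f hf
    · classical
      have h1 := List.perm_iff_count.1 hRA.lperm
      have h2 := List.perm_iff_count.1 hRC.lperm
      rw [List.perm_iff_count]
      intro a
      have h1 := h1 a
      have h2 := h2 a
      simp only [List.map_append, List.map_cons, List.cons_append, List.nil_append,
        List.flatMap_append, List.count_cons, List.count_append] at h1 h2 ⊢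
      omega
    · intro d e hde
      simp only [List.mem_cons, List.mem_append, Prod.mk.injEq] at hde ⊢
      rcases hde with ⟨rfl, rfl⟩ | ⟨rfl, rfl⟩ | hde | hde
      · simp
      · simp
      · simp [hRA.symm _ _ hde]
      · simp [hRC.symm _ _ hde]
    · intro d e hde
      simp only [List.mem_cons, List.mem_append, Prod.mk.injEq] at hde
      rcases hde with ⟨rfl, rfl⟩ | ⟨rfl, rfl⟩ | hde | hde
      · exact hlz
      · rw [hlz, iv_iv]
      · exact hRA.linv _ _ hde
      · exact hRC.linv _ _ hde
    · intro d e hde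
      simp only [List.mem_cons, List.mem_append, Prod.mk.injEq] at hde
      rcases hde with ⟨rfl, rfl⟩ | ⟨rfl, rfl⟩ | hde | hde
      · rw [hp3, hp1]
      · rw [hp3, hp1, hlz, ps_iv, mul_inv_cancel_right]
      · exact hRA.lpos _ _ hde
      · exact hRC.lpos _ _ hde
    · intro d e hde
      simp only [List.mem_cons, List.mem_append, Prod.mk.injEq] at hde
      rcases hde with ⟨rfl, rfl⟩ | ⟨rfl, rfl⟩ | hde | hde
      · intro hd he
        exact hnm hd he hlz m n hA (by simpa using hC) le_rfl
      · intro hd he hh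
        refine hnm he hd hlz m n hA (by simpa using hC) le_rfl ?_
        rw [hh, FreeGroup.invRev_invRev]
      · exact hRA.nm _ _ hde
      · exact hRC.nm _ _ hde
    · classical
      have h1 := List.perm_iff_count.1 hRA.vperm
      have h2 := List.perm_iff_count.1 hRC.vperm
      rw [List.perm_iff_count]
      intro a
      have h1 := h1 a
      have h2 := h2 a
      simp only [List.map_append, List.map_cons, List.cons_append, List.flatten_append,
        List.flatMap_append, List.count_cons, List.count_append] at h1 h2 ⊢
      omega
    · intro v hv
      rcases List.mem_append.1 hv with hv | hv
      · exact hRA.vne v hv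
      · exact hRC.vne v hv
    · intro v hv
      rcases List.mem_append.1 hv with hv | hv
      · obtain ⟨u, hu⟩ := hRA.vw v hv
        refine ⟨u, VWalk_mono ?_ _ _ _ hu⟩
        rintro a b ((h | h | h) | h) <;> simp [h]
      · obtain ⟨u, hu⟩ := hRC.vw v hv
        refine ⟨u, VWalk_mono ?_ _ _ _ hu⟩
        rintro a b ((h | h | h) | h) <;> simp [h]
    · have h1 := hRA.cnt
      have h2 := hRC.cnt
      simp only [List.length_append, List.length_cons]
      omega
  | face n x s C hs hC ih =>
    intro Z t g k Rel hW hZ hI hwalk hpos hk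
    obtain ⟨dx, D1, hD1, rfl, hD2⟩ := List.map_eq_cons_iff.1 hW.symm
    obtain ⟨Lc, Z1, rfl, hLc, hZ1⟩ := letters_split Z [] dx _ hD1
    rw [hD1] at hI hpos ⊢
    subst hD2
    obtain ⟨t1, hw1, hw2⟩ := (Walk_append _ _ _ _ _).1 hwalk
    simp only [Walk, if_true] at hw2
    obtain ⟨rfl, hw2⟩ := hw2
    rw [PosOK] at hpos
    obtain ⟨hp1, hp2⟩ := hpos
    obtain ⟨f, hf⟩ : ∃ f : Face α G, f = ⟨k, s ++ [iv (lab t1)], g⟩ := ⟨_, rfl⟩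
    have hfw : f.word = s ++ [iv (lab t1)] := by rw [hf]
    have hfp : f.pos = g := by rw [hf]
    have hfi : f.id = k := by rw [hf]
    clear hf
    have hI' := Inv.face hS hfw hs hI
    have hsx : ps φ s = ps φ [lab t1] := by
      have h1 := hφ _ hs
      rwa [ps_append, ps_iv, mul_inv_eq_one] at h1
    have hlab : (seg f 0 s.length).map lab = s := by
      rw [seg_map_lab _ _ _ (by simp [hfw])]; simp [hfw]
    have hlabl : lab (f, s.length) = iv (lab t1) := by
      simp [lab, hfw]
    have hdl : dpos φ (f, s.length) = g * ps φ [lab t1] := by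
      simp [dpos, hfw, hfp, hsx]
    have htl : tl (f, s.length) = s := by simp [tl, hfw]
    let Rel' : Dart α G → Dart α G → Prop :=
      fun a b => Rel a b ∨ (a, b) = (t1, (f, s.length)) ∨ (a, b) = ((f, s.length), t1)
    have hmono : ∀ a b, Rel a b → Rel' a b := fun a b h => Or.inl h
    let Z' := Lc ++ ((f, s.length), false) ::
      ((seg f 0 s.length).map (fun d => (d, true)) ++ (t1, false) :: Z1)
    have lZ : letters Z' = seg f 0 s.length ++ D1 := by
      have h1 : letters ((t1, false) :: Z1) = D1 := by rw [← hZ1]; simp [letters]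
      have h2 : letters (((f, s.length), false) ::
          ((seg f 0 s.length).map (fun d => (d, true)) ++ (t1, false) :: Z1)) =
          letters ((seg f 0 s.length).map (fun d => (d, true)) ++ (t1, false) :: Z1) := by
        simp [letters]
      simp only [Z']
      rw [letters_append, hLc, h2, letters_append, letters_seg, h1]; rfl
    have hnext : next (f, s.length) = (f, 0) := by simp [next, hfw]
    have hd0 : dpos φ (f, 0) = g := by simp [dpos, hfp, ps_nil]
    obtain ⟨F, ln, vs, hR⟩ := ih Z' t g (k + 1) Rel'
      (by rw [lZ, List.map_append, hlab]) (by simp [Z']) (by rw [lZ]; exact hI')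
      (by
        refine (Walk_append _ _ _ _ _).2 ⟨t1, Walk_mono hmono _ _ _ hw1, by simp [Rel'], ?_⟩
        refine (Walk_append _ _ _ _ _).2 ⟨(f, s.length), ?_, by simp [Rel'],
          Walk_mono hmono _ _ _ hw2⟩
        rw [hnext]
        have := Walk_seg Rel' f s.length 0 (by simp [hfw])
        simpa using this)
      (by
        rw [lZ, PosOK_append, hlab, hsx]
        refine ⟨?_, hp2⟩
        have := seg_PosOK φ f s.length 0 (by simp [hfw])
        rwa [hd0] at this) (by omega)
    rw [lZ] at hR
    have hfd : fd f = seg f 0 s.length ++ [(f, s.length)] := by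
      simp [fd, hfw, seg, List.range'_concat]
    refine ⟨f :: F, (t1, (f, s.length)) :: ((f, s.length), t1) :: ln, vs, ?_⟩
    refine ⟨?_, ?_, ?_, ?_, ?_, ?_, ?_, ?_, ?_, hR.vne, ?_, ?_⟩
    · intro f' hf'
      rcases List.mem_cons.1 hf' with rfl | hf'
      · omega
      · have := hR.ids f' hf'; omega
    · rw [List.map_cons, List.nodup_cons]
      refine ⟨?_, hR.nd⟩
      intro ha
      obtain ⟨f', hf', h⟩ := List.mem_map.1 ha
      have := hR.ids f' hf'
      omega
    · intro f' hf'
      rcases List.mem_cons.1 hf' with rfl | hf'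
      · rw [hfw]; exact hs
      · exact hR.wS f' hf'
    · classical
      have h1 := List.perm_iff_count.1 hR.lperm
      rw [List.perm_iff_count]
      intro a
      have h1 := h1 a
      simp only [List.map_cons, List.cons_append, List.nil_append, List.flatMap_cons, hfd,
        List.count_cons, List.count_append, List.count_nil] at h1 ⊢
      omega
    · intro d e hde
      simp only [List.mem_cons, Prod.mk.injEq] at hde ⊢
      rcases hde with ⟨rfl, rfl⟩ | ⟨rfl, rfl⟩ | hde
      · simp
      · simp
      · simp [hR.symm _ _ hde]
    · intro d e hde
      simp only [List.mem_cons, Prod.mk.injEq] at hde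
      rcases hde with ⟨rfl, rfl⟩ | ⟨rfl, rfl⟩ | hde
      · exact hlabl
      · rw [hlabl, iv_iv]
      · exact hR.linv _ _ hde
    · intro d e hde
      simp only [List.mem_cons, Prod.mk.injEq] at hde
      rcases hde with ⟨rfl, rfl⟩ | ⟨rfl, rfl⟩ | hde
      · rw [hdl, hp1]
      · rw [hdl, hp1, hlabl, ps_iv, mul_inv_cancel_right]
      · exact hR.lpos _ _ hde
    · have key : t1.1.id ≠ 0 → s ≠ FreeGroup.invRev (tl t1) := by
        intro ht hh
        have := hI.i1 [] t1 D1 rfl ht n (by rw [← hh]; simpa using hC)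
        omega
      intro d e hde
      simp only [List.mem_cons, Prod.mk.injEq] at hde
      rcases hde with ⟨rfl, rfl⟩ | ⟨rfl, rfl⟩ | hde
      · intro hd _
        rw [htl]; exact key hd
      · intro _ he hh
        rw [htl] at hh
        exact key he (by rw [hh, FreeGroup.invRev_invRev])
      · exact hR.nm _ _ hde
    · classical
      have h1 := List.perm_iff_count.1 hR.vperm
      rw [List.perm_iff_count]
      intro a
      have h1 := h1 a
      have h2 : ((seg f 0 s.length).map (fun d => (d, true))).map Prod.fst = seg f 0 s.length := by
        rw [List.map_map]; exact List.map_id _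
      simp only [Z', List.map_append, List.map_cons, List.cons_append, List.flatMap_cons, hfd, h2,
        List.count_cons, List.count_append, List.count_nil] at h1 ⊢
      omega
    · intro v hv
      obtain ⟨u, hu⟩ := hR.vw v hv
      refine ⟨u, VWalk_mono ?_ _ _ _ hu⟩
      rintro a b ((h | h | h) | h) <;> simp [h]
    · have h1 := hR.cnt
      simp only [List.length_cons]
      omega
end

end Gr


namespace Gr

section
variable {α G : Type} [Inhabited α] [Group G]

/-- the outer face -/
def outer (w : List (α × Bool)) : Face α G := ⟨0, w, 1⟩

/-- valid darts -/
def Dm (w : List (α × Bool)) (F : List (Face α G)) (d : Dart α G) : Prop :=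
  (d.1 = outer w ∨ d.1 ∈ F) ∧ d.2 < d.1.word.length

/-- planar maps -/
structure PMap (S : Set (List (α × Bool))) (φ : FreeGroup α →* G) (w : List (α × Bool))
    (F : List (Face α G)) (T : Dart α G → Dart α G) (vs : List (List (Dart α G))) : Prop where
  hS : RelSet S
  hφ : ∀ l ∈ S, ps φ l = 1
  hw : ps φ w = 1
  fid : ∀ f ∈ F, f.id ≠ 0
  Fnd : F.Nodup
  wS : ∀ f ∈ F, f.word ∈ S
  Tm : ∀ d, Dm w F d → Dm w F (T d)
  TT : ∀ d, Dm w F d → T (T d) = d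
  Tl : ∀ d, Dm w F d → lab (T d) = iv (lab d)
  Tp : ∀ d, Dm w F d → dpos φ (T d) = dpos φ d * ps φ [lab d]
  Tn : ∀ d, Dm w F d → d.1 ∈ F → (T d).1 ∈ F → tl (T d) ≠ FreeGroup.invRev (tl d)
  vnd : vs.flatten.Nodup
  vm : ∀ d, d ∈ vs.flatten ↔ Dm w F d
  vne : ∀ v ∈ vs, v ≠ []
  vw : ∀ v ∈ vs, ∃ t, VWalk (fun a b => T a = b ∧ Dm w F a) t v t
  cnt : 2 * vs.length + 2 * F.length = vs.flatten.length + 2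
  perm : vs.flatten.Perm (fd (outer w) ++ F.flatMap fd)

theorem mem_fd {f : Face α G} {d : Dart α G} : d ∈ fd f ↔ d.1 = f ∧ d.2 < f.word.length := by
  obtain ⟨f', i⟩ := d
  simp only [fd, seg, List.mem_map, List.mem_range'_1, Prod.mk.injEq]
  constructor
  · rintro ⟨a, h, rfl, rfl⟩; exact ⟨rfl, by omega⟩
  · rintro ⟨rfl, h⟩; exact ⟨i, by omega, rfl, rfl⟩

theorem fd_nodup (f : Face α G) : (fd f).Nodup := by
  refine List.Nodup.map ?_ List.nodup_range'
  intro a b h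
  simpa using h

theorem exists_pmap {S : Set (List (α × Bool))} (hS : RelSet S) (φ : FreeGroup α →* G)
    (hφ : ∀ l ∈ S, ps φ l = 1) {n : ℕ} {w : List (α × Bool)} (hw : w ≠ [])
    (h : P S n w) (hmin : ∀ m, P S m w → n ≤ m) :
    ∃ F T vs, PMap S φ w F T vs := by
  classical
  obtain ⟨o, ho⟩ : ∃ o : Face α G, o = outer w := ⟨_, rfl⟩
  have how : o.word = w := by rw [ho]; rfl
  have hoi : o.id = 0 := by rw [ho]; rfl
  have hop : o.pos = 1 := by rw [ho]; rfl
  have hlab : (fd o).map lab = w := by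
    rw [fd, seg_map_lab _ _ _ (by simp)]; simp [how]
  have hlen : 0 < w.length := List.length_pos_iff.2 hw
  have hin : ∀ d ∈ fd o, ¬ d.1.id ≠ 0 := by
    intro d hd
    rw [(mem_fd.1 hd).1, hoi]; simp
  have hwalk : Walk (fun _ _ => False) (o, 0) ((fd o).map (fun d => (d, true))) (o, 0) := by
    obtain ⟨l, hl⟩ : ∃ l, o.word.length = l + 1 := ⟨o.word.length - 1, by rw [how]; omega⟩
    have h1 := Walk_seg (fun _ _ => False) o l 0 (by omega)
    have h2 : fd o = seg o 0 l ++ [(o, l)] := by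
      simp [fd, hl, seg, List.range'_concat]
    rw [h2, List.map_append, Walk_append]
    refine ⟨_, h1, ?_⟩
    simp [Walk, next, hl]
  have hpos : PosOK φ 1 (fd o) := by
    have h1 := seg_PosOK φ o o.word.length 0 (by simp)
    have h2 : dpos φ (o, 0) = 1 := by simp [dpos, hop, ps_nil]
    rwa [h2] at h1
  obtain ⟨F, ln, vs, hR⟩ := build hS φ hφ h ((fd o).map (fun d => (d, true))) (o, 0) 1 1
    (fun _ _ => False) (by rw [letters_seg, hlab])
    (by
      intro hh
      have := congrArg List.length hh
      simp [fd, seg, how] at this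
      exact hw this)
    (by
      rw [letters_seg]
      refine ⟨by rw [hlab]; exact hmin, ?_, ?_⟩
      · intro B d C hd hd0
        exact absurd hd0 (hin d (by rw [hd]; simp))
      · intro B d A e C hd hd0
        exact absurd hd0 (hin d (by rw [hd]; simp)))
    hwalk (by rw [letters_seg]; exact hpos) le_rfl
  rw [letters_seg] at hR
  have hmm : ((fd o).map (fun d => (d, true))).map Prod.fst = fd o := by
    rw [List.map_map]; exact List.map_id _
  rw [hmm] at hR
  have hFnd : F.Nodup := List.Nodup.of_map _ hR.nd
  have hfid : ∀ f ∈ F, f.id ≠ 0 := by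
    intro f hf
    have := hR.ids f hf
    omega
  have hmem : ∀ d, d ∈ fd o ++ F.flatMap fd ↔ Dm w F d := by
    intro d
    simp only [List.mem_append, List.mem_flatMap, mem_fd, Dm, ← ho]
    constructor
    · rintro (⟨h1, h2⟩ | ⟨f, hf, h1, h2⟩)
      · exact ⟨Or.inl h1, by rw [h1]; exact h2⟩
      · subst h1; exact ⟨Or.inr hf, h2⟩
    · rintro ⟨h1 | h1, h2⟩
      · exact Or.inl ⟨h1, by rw [← h1]; exact h2⟩
      · exact Or.inr ⟨d.1, h1, rfl, h2⟩
  have hnd : (fd o ++ F.flatMap fd).Nodup := by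
    rw [List.nodup_append]
    refine ⟨fd_nodup _, ?_, ?_⟩
    · rw [List.nodup_flatMap]
      refine ⟨fun f _ => fd_nodup f, ?_⟩
      refine List.Pairwise.imp ?_ hFnd
      intro f f' hne
      rw [Function.onFun, List.disjoint_left]
      intro d h1 h2
      exact hne ((mem_fd.1 h1).1.symm.trans (mem_fd.1 h2).1)
    · intro a ha b hb hab
      subst hab
      obtain ⟨f, hf, h1⟩ := List.mem_flatMap.1 hb
      refine hfid f hf ?_
      rw [← (mem_fd.1 h1).1, (mem_fd.1 ha).1, hoi]
  have hlnd : (ln.map Prod.fst).Nodup := hR.lperm.nodup_iff.2 hnd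
  have hex : ∀ d, Dm w F d → ∃ e, (d, e) ∈ ln := by
    intro d hd
    have := hR.lperm.mem_iff.2 ((hmem d).2 hd)
    obtain ⟨⟨a, b⟩, h1, rfl⟩ := List.mem_map.1 this
    exact ⟨b, h1⟩
  have hmemD : ∀ d e, (d, e) ∈ ln → Dm w F d := by
    intro d e hde
    rw [← hmem]
    exact hR.lperm.mem_iff.1 (List.mem_map.2 ⟨_, hde, rfl⟩)
  have huniq : ∀ d e e', (d, e) ∈ ln → (d, e') ∈ ln → e = e' := by
    intro d e e' h1 h2
    have := List.inj_on_of_nodup_map hlnd h1 h2 rfl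
    exact congrArg Prod.snd this
  let T : Dart α G → Dart α G := fun d => if h : ∃ e, (d, e) ∈ ln then h.choose else d
  have hT : ∀ d, Dm w F d → (d, T d) ∈ ln := by
    intro d hd
    have h1 := hex d hd
    simp only [T, dif_pos h1]
    exact h1.choose_spec
  refine ⟨F, T, vs, hS, hφ, h.sound φ hφ, hfid, hFnd, hR.wS, ?_, ?_, ?_, ?_, ?_, ?_, ?_, hR.vne,
    ?_, ?_, ?_⟩
  · intro d hd; exact hmemD _ _ (hR.symm _ _ (hT d hd))
  · intro d hd
    have h1 := hR.symm _ _ (hT d hd)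
    exact huniq _ _ _ (hT _ (hmemD _ _ h1)) h1
  · intro d hd; exact hR.linv _ _ (hT d hd)
  · intro d hd; exact hR.lpos _ _ (hT d hd)
  · intro d hd h1 h2; exact hR.nm _ _ (hT d hd) (hfid _ h1) (hfid _ h2)
  · exact hR.vperm.nodup_iff.2 hnd
  · intro d; rw [hR.vperm.mem_iff, hmem]
  · intro v hv
    obtain ⟨t, ht⟩ := hR.vw v hv
    refine ⟨t, VWalk_mono ?_ _ _ _ ht⟩
    rintro a b (h1 | h1)
    · exact h1.elim
    · have h2 := hmemD _ _ h1
      exact ⟨huniq _ _ _ (hT _ h2) h1, h2⟩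
  · rw [hR.cnt, hR.vperm.length_eq, ← hR.lperm.length_eq, List.length_map]
  · rw [← ho]; exact hR.vperm
end

end Gr


namespace Gr

section
variable {α G : Type} [Inhabited α] [Group G]

theorem next_fst (d : Dart α G) : (next d).1 = d.1 := rfl

theorem next_valid {d : Dart α G} (h : d.2 < d.1.word.length) :
    (next d).2 < d.1.word.length := by
  simp only [next]; split_ifs <;> omega

theorem next_Dm {w : List (α × Bool)} {F : List (Face α G)} {d : Dart α G} (h : Dm w F d) :
    Dm w F (next d) := ⟨h.1, next_valid h.2⟩

theorem next_inj {d e : Dart α G} (hd : d.2 < d.1.word.length) (he : e.2 < e.1.word.length)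
    (h : next d = next e) : d = e := by
  obtain ⟨f, i⟩ := d
  obtain ⟨f', j⟩ := e
  simp only [next, Prod.mk.injEq] at h
  obtain ⟨rfl, h⟩ := h
  simp only at hd he h
  congr 1
  split_ifs at h <;> omega

theorem next_iter (f : Face α G) (i : ℕ) (hi : i < f.word.length) (t : ℕ) :
    next^[t] (f, i) = (f, (i + t) % f.word.length) := by
  induction t with
  | zero => simp [Nat.mod_eq_of_lt hi]
  | succ t ih =>
    rw [Function.iterate_succ_apply', ih]
    have hm : 0 < f.word.length := by omega
    have h1 := Nat.mod_lt (i + t) hm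
    simp only [next, Prod.mk.injEq, true_and]
    rw [show i + (t + 1) = i + t + 1 by omega, Nat.add_mod (i + t) 1]
    by_cases h2 : (i + t) % f.word.length + 1 = f.word.length
    · rw [if_pos h2]
      have h3 : ((i + t) % f.word.length + 1) % f.word.length = 0 := by rw [h2]; simp
      rw [Nat.add_mod, Nat.mod_mod] at h3
      exact h3.symm
    · rw [if_neg h2]
      have h3 : ((i + t) % f.word.length + 1) % f.word.length = (i + t) % f.word.length + 1 :=
        Nat.mod_eq_of_lt (by omega)
      conv_lhs => rw [← h3]
      rw [Nat.add_mod, Nat.mod_mod]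

theorem dpos_next (φ : FreeGroup α →* G) {d : Dart α G} (h : d.2 < d.1.word.length)
    (hp : ps φ d.1.word = 1) : dpos φ (next d) = dpos φ d * ps φ [lab d] := by
  obtain ⟨f, i⟩ := d
  rw [← dpos_succ φ f i h]
  simp only [next]
  split_ifs with h1
  · simp only at hp
    simp [dpos, h1, ps_nil, hp]
  · rfl

/-- the boundary word read from a dart -/
def rotw (d : Dart α G) : List (α × Bool) := lab d :: tl d

theorem rotw_eq {d : Dart α G} (h : d.2 < d.1.word.length) :
    rotw d = d.1.word.drop d.2 ++ d.1.word.take d.2 := by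
  have h1 : lab d = d.1.word[d.2] := by simp [lab, h]
  rw [rotw, tl, h1, ← List.cons_append, ← List.drop_eq_getElem_cons h]

theorem rotw_length {d : Dart α G} (h : d.2 < d.1.word.length) :
    (rotw d).length = d.1.word.length := by
  rw [rotw_eq h]; simp; omega

theorem rotw_mem {S : Set (List (α × Bool))} (hS : RelSet S) {d : Dart α G}
    (h : d.2 < d.1.word.length) (hd : d.1.word ∈ S) : rotw d ∈ S := by
  rw [rotw_eq h]
  exact hS.rot _ _ (by rw [List.take_append_drop]; exact hd)

theorem rotw_next {d : Dart α G} (h : d.2 < d.1.word.length) :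
    rotw (next d) = tl d ++ [lab d] := by
  rw [rotw_eq (next_valid h)]
  simp only [next, tl]
  have h1 : lab d = d.1.word[d.2] := by simp [lab, h]
  split_ifs with h2
  · rw [h2]
    simp only [List.drop_length, List.take_zero, List.nil_append, List.drop_zero, List.append_nil]
    rw [h1, List.take_append_getElem h, List.take_of_length_le (by omega)]
  · rw [h1, List.append_assoc, List.take_append_getElem h]

/-- the inverse boundary word read from a dart -/
def irotw (d : Dart α G) : List (α × Bool) := iv (lab d) :: FreeGroup.invRev (tl d)

theorem irotw_length {d : Dart α G} (h : d.2 < d.1.word.length) :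
    (irotw d).length = d.1.word.length := by
  rw [← rotw_length h]
  simp [irotw, rotw, FreeGroup.invRev]

theorem irotw_mem {S : Set (List (α × Bool))} (hS : RelSet S) {d : Dart α G}
    (h : d.2 < d.1.word.length) (hd : d.1.word ∈ S) : irotw d ∈ S := by
  have := hS.inv _ (rotw_mem hS h hd)
  rw [rotw, invRev_cons'] at this
  exact hS.rot _ _ this

theorem irotw_prev {d : Dart α G} (h : d.2 < d.1.word.length) :
    irotw d = FreeGroup.invRev (tl (next d)) ++ [iv (lab (next d))] := by
  have := rotw_next h
  rw [← invRev_cons']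
  change _ = FreeGroup.invRev (rotw (next d))
  rw [this, invRev_append', invRev_cons', invRev_nil']; rfl

theorem VWalk_append (Rel : Dart α G → Dart α G → Prop) (l m : List (Dart α G)) :
    ∀ t u, VWalk Rel t (l ++ m) u ↔ ∃ s, VWalk Rel t l s ∧ VWalk Rel s m u := by
  induction l with
  | nil => intro t u; simp [VWalk]
  | cons a l ih =>
    intro t u
    simp only [List.cons_append, VWalk, ih]
    constructor
    · rintro ⟨h1, s, h2, h3⟩; exact ⟨s, ⟨h1, h2⟩, h3⟩
    · rintro ⟨s, ⟨h1, h2⟩, h3⟩; exact ⟨h1, s, h2, h3⟩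

theorem VWalk_rot {Rel : Dart α G → Dart α G → Prop} {t d : Dart α G} {p q : List (Dart α G)}
    (h : VWalk Rel t (p ++ d :: q) t) : VWalk Rel (next d) (q ++ (p ++ [d])) (next d) := by
  obtain ⟨s, h1, h2, h3⟩ := (VWalk_append _ _ _ _ _).1 h
  exact (VWalk_append _ _ _ _ _).2 ⟨t, h3, (VWalk_append _ _ _ _ _).2 ⟨s, h1, h2, rfl⟩⟩

/-- the last dart of the outer face -/
def lst (w : List (α × Bool)) : Dart α G := (outer w, w.length - 1)

/-- smooth corners -/
def sm (w : List (α × Bool)) (vs : List (List (Dart α G))) (d : Dart α G) : Prop :=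
  ∃ v ∈ vs, v.length = 2 ∧ lst w ∉ v ∧ d ∈ v

variable {S : Set (List (α × Bool))} {φ : FreeGroup α →* G} {w : List (α × Bool)}
  {F : List (Face α G)} {T : Dart α G → Dart α G} {vs : List (List (Dart α G))}

theorem PMap.word_one (M : PMap S φ w F T vs) {d : Dart α G} (h : Dm w F d) :
    ps φ d.1.word = 1 := by
  rcases h.1 with h1 | h1
  · rw [h1]; exact M.hw
  · exact M.hφ _ (M.wS _ h1)

theorem PMap.posn (M : PMap S φ w F T vs) {d : Dart α G} (h : Dm w F d) :
    dpos φ (next d) = dpos φ d * ps φ [lab d] := dpos_next φ h.2 (M.word_one h)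

theorem PMap.vDm (M : PMap S φ w F T vs) {d : Dart α G} {v : List (Dart α G)} (hv : v ∈ vs)
    (hd : d ∈ v) : Dm w F d := (M.vm d).1 (List.mem_flatten.2 ⟨v, hv, hd⟩)

theorem PMap.v1 (M : PMap S φ w F T vs) {c : Dart α G} (h : [c] ∈ vs) : T (next c) = c := by
  obtain ⟨t, ⟨h1, _⟩, h2⟩ := M.vw _ h
  simp only [VWalk] at h2
  rw [h2]; exact h1

theorem PMap.v2 (M : PMap S φ w F T vs) {c d : Dart α G} (h : [c, d] ∈ vs) :
    T (next c) = d ∧ T (next d) = c := by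
  obtain ⟨t, ⟨h1, _⟩, ⟨h2, _⟩, h3⟩ := M.vw _ h
  simp only [VWalk] at h3
  rw [h3]; exact ⟨h2, h1⟩

theorem PMap.sm_next (M : PMap S φ w F T vs) {d : Dart α G} (h : sm w vs d) :
    Dm w F d ∧ T (next d) ≠ lst w ∧ next (T (next d)) = T d ∧ sm w vs (T (next d)) := by
  obtain ⟨v, hv, hl, hlast, hd⟩ := h
  have hDm := M.vDm hv hd
  obtain ⟨a, b, rfl⟩ := List.length_eq_two.1 hl
  have hDa := M.vDm hv (show a ∈ [a, b] by simp)
  have hDb := M.vDm hv (show b ∈ [a, b] by simp)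
  obtain ⟨h1, h2⟩ := M.v2 hv
  simp only [List.mem_cons, List.not_mem_nil, or_false, not_or] at hd hlast
  have hlast' : lst w ∉ [a, b] := by simp [hlast]
  refine ⟨hDm, ?_⟩
  rcases hd with rfl | rfl
  · rw [h1]
    refine ⟨fun h => hlast.2 h.symm, ?_, ⟨_, hv, rfl, hlast', by simp⟩⟩
    rw [← h2, M.TT _ (next_Dm hDb)]
  · rw [h2]
    refine ⟨fun h => hlast.1 h.symm, ?_, ⟨_, hv, rfl, hlast', by simp⟩⟩
    rw [← h1, M.TT _ (next_Dm hDa)]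

theorem PMap.smooth_of (M : PMap S φ w F T vs) {d : Dart α G} (hd : Dm w F d)
    (h1 : T (next (T (next d))) = d) (h2 : T (next d) ≠ d) (h3 : d ≠ lst w)
    (h4 : T (next d) ≠ lst w) : sm w vs d := by
  obtain ⟨v, hv, hdv⟩ := List.mem_flatten.1 ((M.vm d).2 hd)
  obtain ⟨t, ht⟩ := M.vw v hv
  have hnd : v.Nodup := (List.nodup_flatten.1 M.vnd).1 v hv
  obtain ⟨p, q, rfl⟩ := List.append_of_mem hdv
  have hw := VWalk_rot ht
  have hnd' : d ∉ q ++ p := by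
    have : (d :: (q ++ p)).Nodup := by
      refine (List.Perm.nodup_iff ?_).1 hnd
      have e1 : (p ++ d :: q).Perm (d :: (p ++ q)) := List.perm_middle
      exact e1.trans ((List.perm_append_comm).cons d)
    exact (List.nodup_cons.1 this).1
  rw [← List.append_assoc] at hw
  have hlen : (p ++ d :: q).length = (q ++ p).length + 1 := by simp; omega
  have hmem : ∀ x, x ∈ p ++ d :: q ↔ x = d ∨ x ∈ q ++ p := by
    intro x; simp; tauto
  generalize q ++ p = r at hw hnd' hlen hmem
  cases r with
  | nil => exact absurd hw.1.1 h2
  | cons c r =>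
    obtain ⟨⟨hc, _⟩, hw⟩ := hw
    cases r with
    | nil =>
      refine ⟨_, hv, by simpa using hlen, ?_, hdv⟩
      rw [hmem]
      rintro (h | h)
      · exact h3 h.symm
      · simp only [List.mem_cons, List.not_mem_nil, or_false] at h
        exact h4 (hc.trans h.symm)
    | cons c' r =>
      obtain ⟨⟨hc', _⟩, hw⟩ := hw
      rw [← hc, h1] at hc'
      exact absurd (by rw [hc']; simp) hnd'

/-- hypotheses on the outer word -/
structure WH (φ : FreeGroup α →* G) (w : List (α × Bool)) : Prop where
  ne : w ≠ []
  mn : ∀ i j, i < j → j ≤ w.length → ps φ (w.take i) = ps φ (w.take j) → i = 0 ∧ j = w.length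
  red : ∀ i, i + 1 < w.length → lab ((outer w : Face α G), i + 1) ≠ iv (lab ((outer w : Face α G), i))

theorem dpos_outer (i : ℕ) : dpos φ (outer w, i) = ps φ (w.take i) := by
  simp [dpos, outer]

theorem PMap.not_outer (M : PMap S φ w F T vs) {f : Face α G} (hf : f ∈ F) : f ≠ outer w := by
  intro h
  exact M.fid f hf (by rw [h]; rfl)

theorem lst_Dm (H : WH φ w) : Dm w F (lst w) := by
  refine ⟨Or.inl rfl, ?_⟩
  have := List.length_pos_iff.2 H.ne
  simp only [lst, outer]; omega

theorem PMap.outer_inner (M : PMap S φ w F T vs) (H : WH φ w) {d : Dart α G}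
    (hd : Dm w F d) (ho : d.1 = outer w) : (T d).1 ∈ F := by
  have key : ∀ a c : ℕ, a < c → c < w.length → Dm w F (outer w, a) →
      T ((outer w : Face α G), a) = (outer w, c) → False := by
    intro a c hac hc hD hT
    have h1 := M.Tp _ hD
    have h2 := M.Tl _ hD
    rw [hT] at h1 h2
    rw [← dpos_succ φ _ a (by simp only [outer]; omega), dpos_outer, dpos_outer] at h1
    rcases Nat.lt_or_ge (a + 1) c with h3 | h3
    · have := H.mn (a + 1) c h3 hc.le h1.symm
      omega
    · have : c = a + 1 := by omega
      subst this
      exact H.red a hc h2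
  have hTD := M.Tm _ hd
  rcases hTD.1 with h | h
  · exfalso
    obtain ⟨f, a⟩ := d
    simp only at ho
    subst ho
    rcases hTd : T (outer w, a) with ⟨f', c⟩
    rw [hTd] at h hTD
    simp only at h
    subst h
    have ha : a < w.length := hd.2
    have hc : c < w.length := hTD.2
    rcases Nat.lt_trichotomy a c with h1 | h1 | h1
    · exact key a c h1 hc hd hTd
    · subst h1
      have := M.Tl _ hd
      rw [hTd] at this
      exact iv_ne _ this.symm
    · refine key c a h1 ha hTD ?_
      rw [← hTd, M.TT _ hd]
  · exact h

theorem PMap.v1_last (M : PMap S φ w F T vs) (H : WH φ w) {c : Dart α G} (h : [c] ∈ vs) :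
    c = lst w := by
  have hT := M.v1 h
  have hc : Dm w F c := M.vDm h (by simp)
  have h1 := M.Tl _ (next_Dm hc)
  rw [hT] at h1
  have h2 : lab (next c) = iv (lab c) := by rw [h1, iv_iv]
  rcases hc.1 with ho | hf
  · obtain ⟨f, i⟩ := c
    simp only at ho
    subst ho
    have hi : i < w.length := hc.2
    by_contra hne
    have hi2 : i + 1 ≠ w.length := by
      intro hh
      apply hne
      simp only [lst]
      congr 1
      omega
    have h3 : next ((outer w : Face α G), i) = (outer w, i + 1) := by
      simp [next, outer, hi2]
    rw [h3] at h2
    exact H.red i (by omega) h2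
  · exfalso
    have h3 := rotw_next hc.2
    have h4 := rotw_mem M.hS hc.2 (M.wS _ hf)
    simp only [rotw] at h3 h4
    cases h5 : tl c with
    | nil =>
      rw [h5] at h3
      simp only [List.nil_append, List.cons.injEq] at h3
      rw [h3.1] at h2
      exact iv_ne _ h2.symm
    | cons y A =>
      rw [h5] at h3 h4
      simp only [List.cons_append, List.cons.injEq] at h3
      refine M.hS.red _ _ _ h4 ?_
      rw [← h3.1, h2]

theorem PMap.corner_outer (M : PMap S φ w F T vs) (H : WH φ w) {d : Dart α G}
    (hd : Dm w F d) (hf : d.1 ∈ F) (hns : ¬ sm w vs d) (h1 : (T d).1 = outer w)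
    (h2 : (T (next d)).1 = outer w) : T (next d) = lst w := by
  by_contra hne
  apply hns
  have hnd := next_Dm hd
  have p1 := M.Tp _ hd
  rw [← M.posn hd] at p1
  have hT2 := M.Tm _ hnd
  have p2 := M.posn hT2
  have p3 := M.Tp _ hT2
  rw [M.TT _ hnd] at p3
  have p4 : dpos φ (T d) = dpos φ (T (next d)) * ps φ [lab (T (next d))] := by rw [p1, p3]
  have hT1 := M.Tm _ hd
  rcases e1 : T d with ⟨f1, a⟩
  rcases e2 : T (next d) with ⟨f2, c⟩
  rw [e1] at h1 hT1 p4
  rw [e2] at h2 hT2 p4 hne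
  simp only at h1 h2
  subst h1; subst h2
  have ha : a < w.length := hT1.2
  have hc : c < w.length := hT2.2
  have hc2 : c + 1 < w.length := by
    rcases Nat.lt_or_ge (c + 1) w.length with h | h
    · exact h
    · exfalso; apply hne; simp only [lst]; congr 1; omega
  rw [← dpos_succ φ _ c hc, dpos_outer, dpos_outer] at p4
  have hac : a = c + 1 := by
    rcases Nat.lt_trichotomy a (c + 1) with h | h | h
    · have := H.mn _ _ h (by omega) p4; omega
    · exact h
    · have := H.mn _ _ h (by omega) p4.symm; omega
  have h3 : next ((outer w : Face α G), c) = (outer w, a) := by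
    rw [hac]; simp only [next]; rw [if_neg]; simp only [outer]; omega
  refine M.smooth_of hd ?_ ?_ ?_ ?_
  · rw [e2, h3, ← e1, M.TT _ hd]
  · rw [e2]
    intro h
    exact M.not_outer hf (by rw [← h])
  · intro h
    exact M.not_outer hf (by rw [h]; rfl)
  · rw [e2]; exact hne

theorem PMap.corner_T (M : PMap S φ w F T vs) {d : Dart α G} (hd : Dm w F d)
    (hns : ¬ sm w vs d) : ¬ sm w vs (T (next d)) := by
  intro h
  obtain ⟨h1, h2, h3, h4⟩ := M.sm_next h
  rw [M.TT _ (next_Dm hd)] at h3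
  have := next_inj (M.Tm _ (next_Dm h1)).2 hd.2 h3
  rw [this] at h4
  exact hns h4

/-- run of smooth corners, inner case -/
theorem PMap.run_take (M : PMap S φ w F T vs) (k : ℕ) : ∀ d, Dm w F d →
    (∀ s, s + 1 < k → sm w vs (next^[s] d)) → k ≤ d.1.word.length → k ≤ (T d).1.word.length →
    (rotw d).take k = (irotw (T d)).take k := by
  induction k with
  | zero => intro d _ _ _ _; simp
  | succ k ih =>
    intro d hd hs h1 h2
    have hl : iv (lab (T d)) = lab d := by rw [M.Tl _ hd, iv_iv]
    simp only [rotw, irotw, List.take_succ_cons, hl, List.cons.injEq, true_and]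
    rcases Nat.eq_zero_or_pos k with rfl | hk
    · simp
    have hsm : sm w vs d := hs 0 (by omega)
    obtain ⟨_, _, h3, _⟩ := M.sm_next hsm
    have hnd := next_Dm hd
    have hTn := M.Tm _ hnd
    have hface : (T (next d)).1 = (T d).1 := by rw [← h3]; rfl
    have h4 := ih (next d) hnd (by
      intro s hs'
      have := hs (s + 1) (by omega)
      rwa [Function.iterate_succ_apply] at this) (by rw [next_fst]; omega)
      (by rw [hface]; omega)
    have e1 := rotw_next hd.2
    have e2 := irotw_prev hTn.2
    rw [h3] at e2
    rw [e1, e2] at h4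
    have l1 := rotw_length hd.2
    have l2 := irotw_length (M.Tm _ hd).2
    simp only [rotw, irotw, List.length_cons] at l1 l2
    rwa [List.take_append_of_le_length (by omega), List.take_append_of_le_length (by omega)] at h4

theorem PMap.run_inner (M : PMap S φ w F T vs) {lam : ℝ} (hlam : lam ≤ 1 / 6)
    (hpiece : ∀ l1 ∈ S, ∀ l2 ∈ S, l1 ≠ l2 → ∀ v, v <+: l1 → v <+: l2 →
      (v.length : ℝ) < lam * l1.length)
    {d : Dart α G} (hd : Dm w F d) (hf : d.1 ∈ F) (hT : (T d).1 ∈ F) (k : ℕ)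
    (hk : k ≤ d.1.word.length) (hs : ∀ s, s + 1 < k → sm w vs (next^[s] d)) :
    (k : ℝ) < lam * d.1.word.length := by
  have hTD := M.Tm _ hd
  have m1 := rotw_mem M.hS hd.2 (M.wS _ hf)
  have m2 := irotw_mem M.hS hTD.2 (M.wS _ hT)
  have hne : rotw d ≠ irotw (T d) := by
    intro h
    simp only [rotw, irotw, List.cons.injEq] at h
    refine M.Tn _ hd hf hT ?_
    rw [h.2, FreeGroup.invRev_invRev]
  rcases Nat.lt_or_ge k (T d).1.word.length with h | h
  · have h1 := M.run_take k d hd hs hk h.le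
    have h2 := hpiece _ m1 _ m2 hne ((rotw d).take k) (List.take_prefix _ _)
      (by rw [h1]; exact List.take_prefix _ _)
    rw [List.length_take, rotw_length hd.2, min_eq_left hk] at h2
    exact h2
  · exfalso
    have h1 := M.run_take (T d).1.word.length d hd (fun s hs' => hs s (by omega)) (by omega) le_rfl
    have h2 := hpiece _ m2 _ m1 hne.symm ((irotw (T d)).take (T d).1.word.length)
      (List.take_prefix _ _) (by rw [← h1]; exact List.take_prefix _ _)
    rw [List.length_take, irotw_length hTD.2, min_self] at h2
    have h3 : (0 : ℝ) ≤ ((T d).1.word.length : ℝ) := Nat.cast_nonneg _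
    nlinarith

theorem PMap.run_outer (M : PMap S φ w F T vs) (k : ℕ) : ∀ (d : Dart α G) (a : ℕ), Dm w F d →
    T d = (outer w, a) → (∀ s, s < k → sm w vs (next^[s] d)) → k + 1 ≤ d.1.word.length →
    ∃ p q, w = p ++ FreeGroup.invRev ((rotw d).take (k + 1)) ++ q ∧ p.length + k = a := by
  have hla : ∀ {a : ℕ}, a < w.length →
      w.drop a = lab ((outer w : Face α G), a) :: w.drop (a + 1) := by
    intro a ha
    rw [List.drop_eq_getElem_cons ha]
    simp [lab, outer, ha]
  induction k with
  | zero =>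
    intro d a hd hT _ _
    have ha : a < w.length := by have := (M.Tm _ hd).2; rw [hT] at this; exact this
    have hl := M.Tl _ hd
    rw [hT] at hl
    refine ⟨w.take a, w.drop (a + 1), ?_, by simp; omega⟩
    simp only [rotw, List.take_succ_cons, List.take_zero, invRev_cons', invRev_nil',
      List.nil_append, ← hl]
    rw [List.append_assoc, List.singleton_append, ← hla ha, List.take_append_drop]
  | succ k ih =>
    intro d a hd hT hs hk
    have ha : a < w.length := by have := (M.Tm _ hd).2; rw [hT] at this; exact this
    have hl := M.Tl _ hd
    rw [hT] at hl
    obtain ⟨_, hnl, h3, _⟩ := M.sm_next (hs 0 (by omega))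
    simp only [Function.iterate_zero, id_eq] at hnl h3
    rw [hT] at h3
    have hnd := next_Dm hd
    have hTn := M.Tm _ hnd
    rcases e1 : T (next d) with ⟨f, c⟩
    rw [e1] at h3 hnl hTn
    have hff : f = outer w := congrArg Prod.fst h3
    subst hff
    have hc : c < w.length := hTn.2
    have hc2 : c + 1 ≠ w.length := by
      intro hh
      apply hnl
      simp only [lst]; congr 1; omega
    have hca : c + 1 = a := by
      have := congrArg Prod.snd h3
      simp only [next] at this
      rwa [if_neg (by simpa [outer] using hc2)] at this
    obtain ⟨p, q, h4, h5⟩ := ih (next d) c hnd e1 (by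
      intro s hs'
      have := hs (s + 1) (by omega)
      rwa [Function.iterate_succ_apply] at this) (by rw [next_fst]; omega)
    have e2 := rotw_next hd.2
    have l1 := rotw_length hd.2
    simp only [rotw, List.length_cons] at l1
    rw [e2, List.take_append_of_le_length (by omega)] at h4
    have hlen : ((tl d).take (k + 1)).length = k + 1 := by
      rw [List.length_take]; omega
    have hq : q = w.drop a := by
      conv_rhs => rw [h4]
      rw [List.drop_left']
      simp [hlen]; omega
    refine ⟨p, w.drop (a + 1), ?_, by omega⟩
    simp only [rotw]
    rw [List.take_succ_cons, invRev_cons', ← hl]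
    conv_lhs => rw [h4, hq, hla ha]
    simp

end

end Gr


namespace Gr

section
variable {α G : Type} [Inhabited α] [Group G]
variable {S : Set (List (α × Bool))} {φ : FreeGroup α →* G} {w : List (α × Bool)}
  {F : List (Face α G)} {T : Dart α G → Dart α G} {vs : List (List (Dart α G))}

open Classical in
/-- nonsmooth, as a Boolean -/
noncomputable def nsb (w : List (α × Bool)) (vs : List (List (Dart α G))) (d : Dart α G) : Bool :=
  decide (¬ sm w vs d)

open Classical in
/-- linked to a nonsmooth outer dart, as a Boolean -/
noncomputable def eb (w : List (α × Bool)) (T : Dart α G → Dart α G)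
    (vs : List (List (Dart α G))) (d : Dart α G) : Bool :=
  decide ((T d).1 = outer w ∧ ¬ sm w vs (T d))

theorem sumv [DecidableEq (Dart α G)] (p : Dart α G → Bool) (x : Dart α G)
    (l : List (List (Dart α G)))
    (h : ∀ v ∈ l, 6 + v.countP p ≤ 3 * v.length + 4 * v.count x) :
    6 * l.length + l.flatten.countP p ≤ 3 * l.flatten.length + 4 * l.flatten.count x := by
  induction l with
  | nil => simp
  | cons v l ih =>
    have h1 := h v (by simp)
    have h2 := ih (fun u hu => h u (by simp [hu]))
    simp only [List.length_cons, List.flatten_cons, List.countP_append, List.length_append,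
      List.count_append]
    omega

theorem PMap.count_v [DecidableEq (Dart α G)] (M : PMap S φ w F T vs) (H : WH φ w)
    {v : List (Dart α G)} (hv : v ∈ vs) :
    6 + v.countP (nsb w vs) ≤ 3 * v.length + 4 * v.count (lst w) := by
  have h0 : v.countP (nsb w vs) ≤ v.length := List.countP_le_length
  by_cases hl : lst w ∈ v
  · have h1 := List.count_pos_iff.2 hl
    have h2 := List.length_pos_of_mem hl
    omega
  · have hne := List.length_pos_iff.2 (M.vne v hv)
    have h1 : v.length ≠ 1 := by
      intro h
      obtain ⟨c, rfl⟩ := List.length_eq_one_iff.1 h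
      rw [M.v1_last H hv] at hl
      simp at hl
    by_cases h2 : v.length = 2
    · have h3 : v.countP (nsb w vs) = 0 := by
        rw [List.countP_eq_zero]
        intro d hd
        simp only [nsb, decide_eq_true_eq, not_not]
        exact ⟨v, hv, h2, hl, hd⟩
      omega
    · omega

theorem PMap.exists_face (M : PMap S φ w F T vs) (H : WH φ w) [DecidableEq (Face α G)] :
    ∃ f ∈ F, (fd f).countP (nsb w vs) + (fd f).countP (eb w T vs) +
      (if f = (T (lst w)).1 then 1 else 0) ≤ 5 := by
  classical
  have h1 := @sumv α G _ _ (fun a b => Classical.propDecidable _) (nsb w vs) (lst w) vs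
    (fun v hv => by convert M.count_v H hv)
  have h2 : ∀ I : DecidableEq (Dart α G),
      @List.count _ (@instBEqOfDecidableEq _ I) (lst w) vs.flatten ≤ 1 := by
    intro I
    exact (@List.nodup_iff_count_le_one _ (@instBEqOfDecidableEq _ I) inferInstance _).1 M.vnd _
  have h2 := h2 (fun a b => Classical.propDecidable _)
  have h3 := M.cnt
  have h4 : vs.flatten.countP (nsb w vs) = (fd (outer w)).countP (nsb w vs) +
      (F.map (fun f => (fd f).countP (nsb w vs))).sum := by
    rw [M.perm.countP_eq, List.countP_append, List.countP_flatMap]; rfl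
  have hmemo : ∀ d ∈ fd (outer w : Face α G), Dm w F d := fun d hd =>
    (M.vm d).1 (M.perm.mem_iff.2 (List.mem_append_left _ hd))
  have hnd : (F.flatMap fd).Nodup := ((M.perm.nodup_iff.1 M.vnd).of_append_right)
  have hmemF : ∀ d ∈ F.flatMap fd, Dm w F d := fun d hd =>
    (M.vm d).1 (M.perm.mem_iff.2 (List.mem_append_right _ hd))
  have h5 : (F.map (fun f => (fd f).countP (eb w T vs))).sum ≤
      (fd (outer w)).countP (nsb w vs) := by
    have e1 : (F.map (fun f => (fd f).countP (eb w T vs))).sum =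
        ((F.flatMap fd).filter (eb w T vs)).length := by
      rw [← List.countP_eq_length_filter, List.countP_flatMap]; rfl
    rw [e1, List.countP_eq_length_filter, ← List.length_map (f := T)]
    refine (List.Nodup.subperm ?_ ?_).length_le
    · refine List.Nodup.map_on ?_ (hnd.filter _)
      intro a ha b hb hab
      have ha1 := hmemF a (List.mem_filter.1 ha).1
      have hb1 := hmemF b (List.mem_filter.1 hb).1
      rw [← M.TT a ha1, hab, M.TT b hb1]
    · intro x hx
      obtain ⟨d, hd, rfl⟩ := List.mem_map.1 hx
      obtain ⟨hd1, hd2⟩ := List.mem_filter.1 hd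
      have hD := hmemF d hd1
      simp only [eb, decide_eq_true_eq] at hd2
      refine List.mem_filter.2 ⟨mem_fd.2 ⟨hd2.1, ?_⟩, ?_⟩
      · have := (M.Tm _ hD).2
        rwa [hd2.1] at this
      · simp only [nsb, decide_eq_true_eq]
        exact hd2.2
  by_contra hcon
  push Not at hcon
  have key : ∀ (L : List (Face α G)) (x : Face α G) (a b : Face α G → ℕ),
      (∀ f ∈ L, 5 < a f + b f + (if f = x then 1 else 0)) →
      6 * L.length ≤ (L.map a).sum + (L.map b).sum + L.count x := by
    intro L x a b
    induction L with
    | nil => simp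
    | cons f L ih =>
      intro h
      have h1 := h f (by simp)
      have h2 := ih (fun g hg => h g (by simp [hg]))
      simp only [List.length_cons, List.map_cons, List.sum_cons, List.count_cons, beq_iff_eq]
      omega
  have h6 := key F _ _ _ hcon
  have h7 : F.count (T (lst w)).1 ≤ 1 := List.nodup_iff_count_le_one.1 M.Fnd _
  omega

/-- conclusion of Greendlinger's lemma -/
def Good (S : Set (List (α × Bool))) (lam : ℝ) (w : List (α × Bool)) : Prop :=
  ∃ u p q, w = p ++ u ++ q ∧ ∃ l ∈ S, ∃ p' q', l = p' ++ u ++ q' ∧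
    (1 - 3 * lam) * (l.length : ℝ) < (u.length : ℝ)

theorem PMap.run_type (M : PMap S φ w F T vs) (d : Dart α G) (k : ℕ) :
    (∀ s, s < k → sm w vs (next^[s] d)) → (T (next^[k] d)).1 = (T d).1 := by
  induction k with
  | zero => intro _; rfl
  | succ k ih =>
    intro h
    rw [← ih (fun s hs => h s (by omega)), Function.iterate_succ_apply']
    obtain ⟨_, _, h3, _⟩ := M.sm_next (h k (by omega))
    rw [← h3]; rfl

theorem PMap.run (M : PMap S φ w F T vs) {lam : ℝ} (hlam : lam ≤ 1 / 6)
    (hpiece : ∀ l1 ∈ S, ∀ l2 ∈ S, l1 ≠ l2 → ∀ v, v <+: l1 → v <+: l2 →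
      (v.length : ℝ) < lam * l1.length) (hgood : ¬ Good S lam w)
    {d : Dart α G} (hd : Dm w F d) (hf : d.1 ∈ F) (k : ℕ)
    (hk : k < d.1.word.length) (hs : ∀ s, s < k → sm w vs (next^[s] d)) :
    ((T (next^[k] d)).1 = outer w → ((k + 1 : ℕ) : ℝ) ≤ (1 - 3 * lam) * d.1.word.length) ∧
    ((T (next^[k] d)).1 ≠ outer w → ((k + 1 : ℕ) : ℝ) < lam * d.1.word.length) := by
  rw [M.run_type d k hs]
  constructor
  · intro ho
    by_contra hlt
    push Not at hlt
    apply hgood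
    obtain ⟨p, q, h1, h2⟩ := M.run_outer k d (T d).2 hd (by rw [← ho]) hs hk
    refine ⟨_, p, q, h1, _, M.hS.inv _ (rotw_mem M.hS hd.2 (M.wS _ hf)),
      FreeGroup.invRev ((rotw d).drop (k + 1)), [], ?_, ?_⟩
    · rw [List.append_nil, ← invRev_append', List.take_append_drop]
    · rw [FreeGroup.invRev_length, FreeGroup.invRev_length, List.length_take, rotw_length hd.2,
        min_eq_left hk]
      exact hlt
  · intro ho
    have hT : (T d).1 ∈ F := by
      rcases (M.Tm _ hd).1 with h | h
      · exact absurd h ho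
      · exact h
    exact M.run_inner hlam hpiece hd hf hT (k + 1) hk (fun s hs' => hs s (by omega))

theorem PMap.final (M : PMap S φ w F T vs) (H : WH φ w) {lam : ℝ} (hlam0 : 0 < lam)
    (hlam : lam ≤ 1 / 6)
    (hpiece : ∀ l1 ∈ S, ∀ l2 ∈ S, l1 ≠ l2 → ∀ v, v <+: l1 → v <+: l2 →
      (v.length : ℝ) < lam * l1.length) : Good S lam w := by
  classical
  by_contra hgood
  obtain ⟨f, hf, hcount⟩ := M.exists_face H
  obtain ⟨X, hX⟩ : ∃ X : Finset (Dart α G), X = (fd f).toFinset := ⟨_, rfl⟩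
  have hXm : ∀ d, d ∈ X ↔ d.1 = f ∧ d.2 < f.word.length := by
    intro d; rw [hX, List.mem_toFinset, mem_fd]
  have hXD : ∀ d ∈ X, Dm w F d := by
    intro d hd
    obtain ⟨rfl, h2⟩ := (hXm d).1 hd
    exact ⟨Or.inr hf, h2⟩
  have hXn : ∀ d ∈ X, next d ∈ X := by
    intro d hd
    have h1 := (hXm d).1 hd
    refine (hXm _).2 ⟨h1.1, ?_⟩
    have := next_valid (hXD d hd).2
    rwa [h1.1] at this
  have hXit : ∀ t, ∀ d ∈ X, next^[t] d ∈ X := by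
    intro t
    induction t with
    | zero => intro d hd; exact hd
    | succ t ih => intro d hd; rw [Function.iterate_succ_apply']; exact hXn _ (ih d hd)
  have hninj : ∀ d ∈ X, ∀ e ∈ X, next d = next e → d = e := fun d hd e he h =>
    next_inj (hXD d hd).2 (hXD e he).2 h
  have hitinj : ∀ t, ∀ d ∈ X, ∀ e ∈ X, next^[t] d = next^[t] e → d = e := by
    intro t
    induction t with
    | zero => intro d _ e _ h; exact h
    | succ t ih =>
      intro d hd e he h
      rw [Function.iterate_succ_apply', Function.iterate_succ_apply'] at h
      exact ih d hd e he (hninj _ (hXit t d hd) _ (hXit t e he) h)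
  have hXcard : X.card = f.word.length := by
    rw [hX, List.toFinset_card_of_nodup (fd_nodup f)]; simp [fd, seg]
  have hcp : ∀ p : Dart α G → Bool, (X.filter (fun d => p d = true)).card = (fd f).countP p := by
    intro p
    rw [hX, ← List.toFinset_filter, List.toFinset_card_of_nodup ((fd_nodup f).filter _),
      List.countP_eq_length_filter]
  have hm : 0 < f.word.length := List.length_pos_iff.2 (M.hS.ne _ (M.wS f hf))
  obtain ⟨N, hN⟩ : ∃ N : Finset (Dart α G), N = X.filter (fun d => ¬ sm w vs d) := ⟨_, rfl⟩
  have hNm : ∀ d, d ∈ N ↔ d ∈ X ∧ ¬ sm w vs d := by intro d; rw [hN, Finset.mem_filter]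
  have hNc : N.card = (fd f).countP (nsb w vs) := by
    rw [← hcp, hN]; congr 1; ext d; simp [nsb]
  let out : Dart α G → Prop := fun d => (T d).1 = outer w
  have himg : X.image next = X := by
    refine Finset.eq_of_subset_of_card_le ?_ ?_
    · intro d hd
      obtain ⟨e, he, rfl⟩ := Finset.mem_image.1 hd
      exact hXn e he
    · rw [Finset.card_image_of_injOn (fun d hd e he h => hninj d hd e he h)]
  -- number of outer segments
  have hE : (N.filter out).card = (N.filter (fun d => out (next d))).card := by
    have e1 : (X.filter out).card = (X.filter (fun d => out (next d))).card := by
      conv_lhs => rw [← himg, Finset.filter_image]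
      rw [Finset.card_image_of_injOn]
      intro d hd e he h
      exact hninj d (Finset.mem_filter.1 hd).1 e (Finset.mem_filter.1 he).1 h
    have e2 : ∀ p : Dart α G → Prop, (X.filter p).card =
        (N.filter p).card + ((X.filter (fun d => sm w vs d)).filter p).card := by
      intro p
      rw [hN, Finset.filter_filter, Finset.filter_filter,
        ← Finset.card_filter_add_card_filter_not (s := X.filter p) (fun d => sm w vs d),
        Finset.filter_filter, Finset.filter_filter, add_comm]
      congr 2
      · ext d; simp; tauto
      · ext d; simp; tauto
    have e3 : (X.filter (fun d => sm w vs d)).filter out =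
        (X.filter (fun d => sm w vs d)).filter (fun d => out (next d)) := by
      refine Finset.filter_congr ?_
      intro d hd
      obtain ⟨_, _, h3, _⟩ := M.sm_next (Finset.mem_filter.1 hd).2
      simp only [out]
      rw [← h3, next_fst]
    have e4 := e2 out
    have e5 := e2 (fun d => out (next d))
    rw [e3] at e4
    omega
  have hE2 : (N.filter (fun d => out (next d))).card ≤ (fd f).countP (eb w T vs) := by
    rw [← hcp, ← Finset.card_image_of_injOn (s := N.filter (fun d => out (next d))) (f := next)]
    · refine Finset.card_le_card ?_
      intro x hx
      obtain ⟨d, hd, rfl⟩ := Finset.mem_image.1 hx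
      obtain ⟨hd1, hd2⟩ := Finset.mem_filter.1 hd
      obtain ⟨hd3, hd4⟩ := (hNm d).1 hd1
      refine Finset.mem_filter.2 ⟨hXn d hd3, ?_⟩
      simp only [eb, decide_eq_true_eq]
      exact ⟨hd2, M.corner_T (hXD d hd3) hd4⟩
    · intro d hd e he h
      exact hninj d ((hNm d).1 (Finset.mem_filter.1 hd).1).1 e
        ((hNm e).1 (Finset.mem_filter.1 he).1).1 h
  have hI : (N.filter out ∩ N.filter (fun d => out (next d))).card ≤
      (if f = (T (lst w)).1 then 1 else 0) := by
    have hc : ∀ d ∈ N.filter out ∩ N.filter (fun d => out (next d)), d ∈ X ∧ next d = T (lst w) := by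
      intro d hd
      obtain ⟨h1, h2⟩ := Finset.mem_inter.1 hd
      obtain ⟨h3, h4⟩ := Finset.mem_filter.1 h1
      obtain ⟨_, h5⟩ := Finset.mem_filter.1 h2
      obtain ⟨h6, h7⟩ := (hNm d).1 h3
      refine ⟨h6, ?_⟩
      have hD := hXD d h6
      have := M.corner_outer H hD (by rw [((hXm d).1 h6).1]; exact hf) h7 h4 h5
      rw [← this, M.TT _ (next_Dm hD)]
    split_ifs with hff
    · rw [Finset.card_le_one]
      intro a ha b hb
      obtain ⟨h1, h2⟩ := hc a ha
      obtain ⟨h3, h4⟩ := hc b hb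
      exact hninj a h1 b h3 (h2.trans h4.symm)
    · rw [Nat.le_zero, Finset.card_eq_zero, Finset.eq_empty_iff_forall_notMem]
      intro d hd
      obtain ⟨h1, h2⟩ := hc d hd
      apply hff
      rw [← h2, next_fst, ((hXm d).1 h1).1]
  have hU : (N.filter out ∪ N.filter (fun d => out (next d))).card ≤ N.card :=
    Finset.card_le_card (Finset.union_subset (Finset.filter_subset _ _) (Finset.filter_subset _ _))
  have hUI := Finset.card_union_add_card_inter (N.filter out) (N.filter (fun d => out (next d)))
  have hE1 : (N.filter out).card ≤ 1 := by omega
  have hbE : N.card + (N.filter out).card ≤ 5 := by omega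
  have hmR : (0 : ℝ) < f.word.length := by exact_mod_cast hm
  -- there is a nonsmooth corner
  have hNne : N.Nonempty := by
    by_contra hemp
    have hall : ∀ d ∈ X, sm w vs d := by
      intro d hd
      by_contra hh
      exact hemp ⟨d, (hNm d).2 ⟨hd, hh⟩⟩
    have hd0 : ((f, 0) : Dart α G) ∈ X := (hXm _).2 ⟨rfl, hm⟩
    by_cases ho : (T (f, 0)).1 = outer w
    · obtain ⟨d, hd, hdmin⟩ := Finset.exists_min_image (X.filter out) (fun d => (T d).2)
        ⟨_, Finset.mem_filter.2 ⟨hd0, ho⟩⟩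
      obtain ⟨hd1, hd2⟩ := Finset.mem_filter.1 hd
      obtain ⟨_, h2, h3, _⟩ := M.sm_next (hall d hd1)
      have h4 : (T (next d)).1 = outer w := by
        have : (T (next d)).1 = (T d).1 := by rw [← h3]; rfl
        rw [this]; exact hd2
      have h5 := hdmin (next d) (Finset.mem_filter.2 ⟨hXn d hd1, h4⟩)
      have h6 := (M.Tm _ (next_Dm (hXD d hd1))).2
      rcases h7 : T (next d) with ⟨f', c⟩
      rw [h7] at h2 h3 h4 h5 h6
      simp only at h4
      subst h4
      simp only at h5
      have h8 : c + 1 ≠ w.length := by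
        intro hh
        apply h2
        simp only [lst]; congr 1; omega
      rw [← h3] at h5
      simp only [next] at h5
      rw [if_neg (by simpa [outer] using h8)] at h5
      omega
    · have := (M.run hlam hpiece hgood (hXD _ hd0) hf (f.word.length - 1)
        (by simp only; omega) (fun s _ => hall _ (hXit s _ hd0)))
      have h2 := this.2 (by
        rw [M.run_type _ _ (fun s _ => hall _ (hXit s _ hd0))]; exact ho)
      rw [Nat.sub_add_cancel hm] at h2
      simp only at h2
      nlinarith
  -- first nonsmooth corner after a dart
  have hex : ∀ d ∈ X, ∃ t, t < f.word.length ∧ ¬ sm w vs (next^[t] d) := by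
    intro d hd
    obtain ⟨y, hy⟩ := hNne
    obtain ⟨hy1, hy2⟩ := (hNm y).1 hy
    obtain ⟨f1, i⟩ := d
    obtain ⟨f2, j⟩ := y
    obtain ⟨rfl, hi⟩ := (hXm _).1 hd
    obtain ⟨h1, hj⟩ := (hXm _).1 hy1
    simp only at h1 hi hj
    subst h1
    refine ⟨(j + f2.word.length - i) % f2.word.length, Nat.mod_lt _ hm, ?_⟩
    rw [next_iter _ _ hi, Nat.add_mod_mod, show i + (j + f2.word.length - i) = j + f2.word.length by omega,
      Nat.add_mod_right, Nat.mod_eq_of_lt hj]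
    exact hy2
  have hex' : ∀ d ∈ X, ∃ t, ¬ sm w vs (next^[t] d) := fun d hd =>
    let ⟨t, _, h⟩ := hex d hd; ⟨t, h⟩
  let e : Dart α G → ℕ := fun d => if h : ∃ t, ¬ sm w vs (next^[t] d) then Nat.find h else 0
  have he1 : ∀ d ∈ X, ¬ sm w vs (next^[e d] d) := by
    intro d hd
    simp only [e, dif_pos (hex' d hd)]
    exact Nat.find_spec (hex' d hd)
  have he2 : ∀ d ∈ X, ∀ s, s < e d → sm w vs (next^[s] d) := by
    intro d hd s hs
    simp only [e, dif_pos (hex' d hd)] at hs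
    exact not_not.1 (Nat.find_min (hex' d hd) hs)
  have he3 : ∀ d ∈ X, e d < f.word.length := by
    intro d hd
    obtain ⟨t, ht, h⟩ := hex d hd
    by_contra hh
    exact h (he2 d hd t (by omega))
  let en : Dart α G → Dart α G := fun d => next^[e d] d
  have hen : Set.MapsTo en (X : Set (Dart α G)) (N : Set (Dart α G)) := by
    intro d hd
    exact (hNm _).2 ⟨hXit _ d hd, he1 d hd⟩
  have hsum := Finset.card_eq_sum_card_fiberwise hen
  have hfib : ∀ y ∈ N, ((out y → (((X.filter (fun d => en d = y)).card : ℕ) : ℝ) ≤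
      (1 - 3 * lam) * f.word.length) ∧ (¬ out y → (((X.filter (fun d => en d = y)).card : ℕ) : ℝ) <
      lam * f.word.length)) := by
    intro y hy
    rcases (X.filter (fun d => en d = y)).eq_empty_or_nonempty with h0 | h0
    · rw [h0]
      simp only [Finset.card_empty, Nat.cast_zero]
      exact ⟨fun _ => by nlinarith, fun _ => by positivity⟩
    · obtain ⟨d, hd, hmax⟩ := Finset.exists_max_image _ e h0
      obtain ⟨hd1, hd2⟩ := Finset.mem_filter.1 hd
      have hdf := ((hXm d).1 hd1).1
      have hle : (X.filter (fun d => en d = y)).card ≤ e d + 1 := by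
        have := Finset.card_le_card_of_injOn (s := X.filter (fun d => en d = y))
          (t := Finset.range (e d + 1)) e (by
            intro x hx
            have := hmax x hx
            simp only [Finset.coe_range, Set.mem_Iio]
            omega) (by
            intro a ha b hb hab
            obtain ⟨ha1, ha2⟩ := Finset.mem_filter.1 ha
            obtain ⟨hb1, hb2⟩ := Finset.mem_filter.1 hb
            refine hitinj (e a) a ha1 b hb1 ?_
            have : en a = en b := ha2.trans hb2.symm
            simp only [en] at this
            rw [this, hab])
        simpa using this
      have hle' : (((X.filter (fun d => en d = y)).card : ℕ) : ℝ) ≤ ((e d + 1 : ℕ) : ℝ) := by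
        exact_mod_cast hle
      have hrun := M.run hlam hpiece hgood (hXD d hd1) (by rw [hdf]; exact hf) (e d)
        (by rw [hdf]; exact he3 d hd1) (he2 d hd1)
      rw [show next^[e d] d = y from hd2, hdf] at hrun
      exact ⟨fun h => hle'.trans (hrun.1 h), fun h => hle'.trans_lt (hrun.2 h)⟩
  -- final estimate
  have hsumR : (f.word.length : ℝ) =
      ∑ y ∈ N, (((X.filter (fun d => en d = y)).card : ℕ) : ℝ) := by
    rw [← hXcard, hsum]; push_cast; rfl
  let B : Dart α G → ℝ := fun y => if out y then (1 - 3 * lam) * f.word.length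
    else lam * f.word.length
  have hB : ∑ y ∈ N, B y = (N.filter out).card * ((1 - 3 * lam) * f.word.length) +
      ((N.filter (fun y => ¬ out y)).card) * (lam * f.word.length) := by
    simp only [B]
    rw [Finset.sum_ite, Finset.sum_const, Finset.sum_const, nsmul_eq_mul, nsmul_eq_mul]
  have hle : ∀ y ∈ N, (((X.filter (fun d => en d = y)).card : ℕ) : ℝ) ≤ B y := by
    intro y hy
    simp only [B]
    split_ifs with h
    · exact (hfib y hy).1 h
    · exact ((hfib y hy).2 h).le
  have hsplit := Finset.card_filter_add_card_filter_not (s := N) out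
  rcases (N.filter (fun y => ¬ out y)).eq_empty_or_nonempty with h0 | ⟨y, hy⟩
  · have h1 := Finset.sum_le_sum hle
    rw [← hsumR, hB, h0] at h1
    have h2 : ((N.filter out).card : ℝ) ≤ 1 := by exact_mod_cast hE1
    simp only [Finset.card_empty, Nat.cast_zero, zero_mul, add_zero] at h1
    have h3 : 0 < (1 - 3 * lam) * (f.word.length : ℝ) := by
      apply mul_pos _ hmR; linarith
    have h4 := mul_le_mul_of_nonneg_right h2 h3.le
    have h5 : 0 < lam * (f.word.length : ℝ) := mul_pos hlam0 hmR
    nlinarith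
  · obtain ⟨hy1, hy2⟩ := Finset.mem_filter.1 hy
    have h1 := Finset.sum_lt_sum hle ⟨y, hy1, by
      simp only [B]; rw [if_neg hy2]; exact (hfib y hy1).2 hy2⟩
    rw [← hsumR, hB] at h1
    have h5 : 0 < lam * (f.word.length : ℝ) := mul_pos hlam0 hmR
    have h6 : lam * (f.word.length : ℝ) ≤ 1 / 6 * f.word.length :=
      mul_le_mul_of_nonneg_right hlam hmR.le
    rcases Nat.le_one_iff_eq_zero_or_eq_one.1 hE1 with h2 | h2
    · have h3 : (N.filter (fun y => ¬ out y)).card ≤ 5 := by omega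
      have h4 : ((N.filter (fun y => ¬ out y)).card : ℝ) ≤ 5 := by exact_mod_cast h3
      have h7 := mul_le_mul_of_nonneg_right h4 h5.le
      rw [h2] at h1
      simp only [Nat.cast_zero, zero_mul, zero_add] at h1
      linarith
    · have h3 : (N.filter (fun y => ¬ out y)).card ≤ 3 := by omega
      have h4 : ((N.filter (fun y => ¬ out y)).card : ℝ) ≤ 3 := by exact_mod_cast h3
      have h7 := mul_le_mul_of_nonneg_right h4 h5.le
      rw [h2] at h1
      simp only [Nat.cast_one, one_mul] at h1
      linarith

end

end Gr

namespace Gr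

theorem Good.mono {α : Type} {S : Set (List (α × Bool))} {lam : ℝ} {u w p q : List (α × Bool)}
    (hw : w = p ++ u ++ q) (h : Good S lam u) : Good S lam w := by
  obtain ⟨v, p1, q1, h1, h2⟩ := h
  exact ⟨v, p ++ p1, q1 ++ q, by subst h1; simp [hw], h2⟩

theorem red_of {α : Type} {l : List (α × Bool)} (h : FreeGroup.IsReduced l) {i : ℕ}
    (hi : i + 1 < l.length) : l[i + 1] ≠ iv l[i] := by
  have := (List.isChain_iff_getElem.1 h) i hi
  intro hh
  rw [hh] at this
  simp [iv] at this

theorem main_ind {α G : Type} [DecidableEq α] [Inhabited α] [Group G]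
    {S : Set (List (α × Bool))} (hS : RelSet S) {R : Set (FreeGroup α)}
    (hR : ∀ r ∈ R, r.toWord ∈ S) (φ : FreeGroup α →* G) (hφ : ∀ l ∈ S, ps φ l = 1)
    (hker : ∀ g, φ g = 1 → g ∈ Subgroup.normalClosure R)
    {lam : ℝ} (hlam0 : 0 < lam) (hlam : lam ≤ 1 / 6)
    (hpiece : ∀ l1 ∈ S, ∀ l2 ∈ S, l1 ≠ l2 → ∀ v, v <+: l1 → v <+: l2 →
      (v.length : ℝ) < lam * l1.length) :
    ∀ (N : ℕ) (w : List (α × Bool)), w.length ≤ N → w ≠ [] → FreeGroup.IsReduced w →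
      ps φ w = 1 → Good S lam w := by
  classical
  intro N
  induction N with
  | zero =>
    intro w h1 h2
    exact absurd (List.length_eq_zero_iff.1 (Nat.le_zero.1 h1)) h2
  | succ N ih =>
    intro w hN hne hred hw
    by_cases hmn : ∀ i j, i < j → j ≤ w.length → ps φ (w.take i) = ps φ (w.take j) →
        i = 0 ∧ j = w.length
    · have hex : ∃ n, P S n w := by
        obtain ⟨n, hn⟩ := P.exists_of hS hR (hker (FreeGroup.mk w) hw)
        rw [FreeGroup.toWord_mk, hred.reduce_eq] at hn
        exact ⟨n, hn⟩
      obtain ⟨F, T, vs, M⟩ := exists_pmap hS φ hφ hne (Nat.find_spec hex)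
        (fun m hm => Nat.find_min' hex hm)
      refine M.final ⟨hne, hmn, ?_⟩ hlam0 hlam hpiece
      intro i hi
      have := red_of hred hi
      simp only [lab, outer]
      rw [List.getD_eq_getElem _ _ hi, List.getD_eq_getElem _ _ (Nat.lt_of_succ_lt hi)]
      exact this
    · push Not at hmn
      obtain ⟨i, j, hij, hj, he, hn⟩ := hmn
      have e1 : w.take j = w.take i ++ (w.take j).drop i := by
        conv_lhs => rw [← List.take_append_drop i (w.take j)]
        rw [List.take_take, min_eq_left hij.le]
      have e2 : w = w.take i ++ (w.take j).drop i ++ w.drop j := by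
        rw [← e1, List.take_append_drop]
      have hlen : ((w.take j).drop i).length = j - i := by simp; omega
      refine Good.mono e2 (ih _ ?_ ?_ ?_ ?_)
      · rw [hlen]
        by_cases h0 : i = 0
        · have := hn h0
          omega
        · omega
      · intro h0
        rw [h0] at hlen
        simp at hlen
        omega
      · exact List.IsChain.infix hred ⟨_, _, e2.symm⟩
      · rw [e1, ps_append] at he
        simpa using he.symm
end Gr

theorem Gr.relSet_of {k : ℕ} {lam : ℝ} {R : Set (FreeGroup (Fin k))}
    (hR : CPrime lam R) (r0 : FreeGroup (Fin k)) (hr0 : r0 ∈ R) (hr1 : r0 ≠ 1) :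
    Gr.RelSet (Set.image FreeGroup.toWord R) := by
  obtain ⟨⟨hc, hrot, hinv⟩, hp⟩ := hR
  refine ⟨?_, ?_, ?_, ?_⟩
  · rintro l ⟨r, hr, rfl⟩ h
    have h1 : r = 1 := FreeGroup.toWord_eq_nil_iff.1 h
    subst h1
    have := hp [] ⟨r0, hr0, 1, hr, hr1, List.nil_prefix, List.nil_prefix⟩ 1 hr ⟨[], [], by simp⟩
    simp at this
  · rintro l m ⟨r, hr, hlm⟩
    have h1 := hrot r hr l.length
    rw [hlm, List.rotate_append_length_eq] at h1
    refine ⟨_, h1, ?_⟩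
    rw [FreeGroup.toWord_mk]
    apply FreeGroup.IsReduced.reduce_eq
    have hred : FreeGroup.IsReduced (l ++ m) := hlm ▸ FreeGroup.isReduced_toWord
    have hcr := hc r hr
    rw [CyclicallyReduced, hlm] at hcr
    rw [FreeGroup.IsReduced, List.isChain_append] at hred ⊢
    refine ⟨hred.2.1, hred.1, ?_⟩
    intro x hx y hy hxy
    by_contra hne
    refine hcr y x ?_ ?_ ?_
    · rw [List.head?_append, Option.mem_def.1 hy]; rfl
    · rw [List.getLast?_append, Option.mem_def.1 hx]; rfl
    · obtain ⟨x1, x2⟩ := x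
      obtain ⟨y1, y2⟩ := y
      simp only at hxy hne ⊢
      subst hxy
      cases x2 <;> cases y2 <;> simp_all
  · rintro l ⟨r, hr, rfl⟩
    exact ⟨r⁻¹, hinv r hr, FreeGroup.toWord_inv r⟩
  · rintro x y A ⟨r, hr, h⟩ hxy
    have hred : FreeGroup.IsReduced (x :: y :: A) := h ▸ FreeGroup.isReduced_toWord
    have := Gr.red_of hred (i := 0) (by simp)
    exact this hxy

theorem statement3 (k : ℕ) (lam : ℝ) (hlam0 : 0 < lam) (hlam : lam ≤ 1 / 6)
    (R : Set (FreeGroup (Fin k))) (hR : CPrime lam R)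
    (w : FreeGroup (Fin k)) (hw : w ≠ 1)
    (hwG : PresentedGroup.mk R w = 1) :
    ∃ u : List (Fin k × Bool), Subword u w.toWord ∧
      ∃ r ∈ R, Subword u r.toWord ∧
        (1 - 3 * lam) * (r.toWord.length : ℝ) < (u.length : ℝ) := by
  have hker : ∀ g, PresentedGroup.mk R g = 1 → g ∈ Subgroup.normalClosure R := by
    intro g hg
    exact (QuotientGroup.eq_one_iff g).1 hg
  have hne : w.toWord ≠ [] := fun h => hw (FreeGroup.toWord_eq_nil_iff.1 h)
  have hex : ∃ r ∈ R, r ≠ 1 := by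
    by_contra hcon
    push Not at hcon
    have h1 : Subgroup.normalClosure R ≤ ⊥ :=
      Subgroup.normalClosure_le_normal (fun r hr => by simpa using hcon r hr)
    exact hw (by simpa using h1 (hker w hwG))
  obtain ⟨r0, hr0, hr1⟩ := hex
  have hS := Gr.relSet_of hR r0 hr0 hr1
  obtain ⟨x, hx⟩ := List.exists_mem_of_ne_nil _ hne
  have : Inhabited (Fin k) := ⟨x.1⟩
  have hgood := Gr.main_ind hS (R := R) (fun r hr => ⟨r, hr, rfl⟩) (PresentedGroup.mk R)
    (by
      rintro l ⟨r, hr, rfl⟩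
      rw [Gr.ps, FreeGroup.mk_toWord]
      exact (QuotientGroup.eq_one_iff r).2 (Subgroup.subset_normalClosure hr))
    hker hlam0 hlam
    (by
      rintro l1 ⟨r1, h1, rfl⟩ l2 ⟨r2, h2, rfl⟩ h12 v hv1 hv2
      refine hR.2 v ⟨r1, h1, r2, h2, fun h => h12 (by rw [h]), hv1, hv2⟩ r1 h1 ?_
      obtain ⟨t, ht⟩ := hv1
      exact ⟨[], t, by simp [ht]⟩)
    w.toWord.length w.toWord le_rfl hne FreeGroup.isReduced_toWord
    (by rw [Gr.ps, FreeGroup.mk_toWord]; exact hwG)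
  obtain ⟨u, p, q, h1, l, ⟨r, hr, rfl⟩, p', q', h2, h3⟩ := hgood
  exact ⟨u, ⟨p, q, h1⟩, r, hr, ⟨p', q', h2⟩, h3⟩
end

section
/- Let G = ⟨a_1,…,a_k | R⟩ be a C'(λ)-presentation with λ ≤ 1/100 and suppose every r ∈ R has |r| ≥ 2/λ + 1. Then for all i ≠ j, no element of {a_i, a_i^{-1}} is conjugate in G to an element of {a_j, a_j^{-1}}, and a_i is not conjugate to a_i^{-1} in G. -/
structure ProjSys (F ι : Type) [Group F] where
  act : F → ι → ι
  el : ι → F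
  len : ι → ℤ
  pr : ι → F → ℤ
  gens : Set F
  el_act : ∀ h A, el (act h A) = h * el A * h⁻¹
  len_act : ∀ h A, len (act h A) = len A
  pr_act : ∀ h A x, pr (act h A) (h * x) = pr A x
  pr_el : ∀ A x, pr A (el A * x) = pr A x + len A
  len_gt : ∀ A, 200 < len A
  pr_gen : ∀ A x s, s ∈ gens → |pr A x - pr A (x * s)| ≤ 1
  gens_top : ∀ x, x ∈ Submonoid.closure gens
  behr : ∀ A B, Subgroup.zpowers (el A) ≠ Subgroup.zpowers (el B) → ∃ I J : Set ℤ,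
    (∀ i ∈ I, ∀ i' ∈ I, 100 * |i - i'| < len A) ∧
    (∀ i ∈ J, ∀ i' ∈ J, 100 * |i - i'| < len B) ∧
    ∀ y, pr A y ∈ I ∨ pr B y ∈ J

namespace ProjSys

variable {F ι : Type} [Group F] (P : ProjSys F ι)

/-- distance of projections -/
def d (A : ι) (x y : F) : ℤ := |P.pr A x - P.pr A y|

def same (A B : ι) : Prop := Subgroup.zpowers (P.el A) = Subgroup.zpowers (P.el B)

theorem d_act (h : F) (A : ι) (x y : F) : P.d (P.act h A) (h * x) (h * y) = P.d A x y := by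
  simp [d, P.pr_act]

theorem d_tri (A : ι) (x y z : F) : P.d A x z ≤ P.d A x y + P.d A y z := by
  unfold d; exact abs_sub_le _ _ _

theorem d_comm (A : ι) (x y : F) : P.d A x y = P.d A y x := by
  unfold d; exact abs_sub_comm _ _

theorem d_self (A : ι) (x : F) : P.d A x x = 0 := by simp [d]

theorem pr_zpow (A : ι) (n : ℤ) (x : F) : P.pr A (P.el A ^ n * x) = P.pr A x + n * P.len A := by
  induction n using Int.induction_on with
  | zero => simp
  | succ n ih =>
    rw [add_comm (n : ℤ) 1, zpow_add, zpow_one, mul_assoc, P.pr_el, ih]; ring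
  | pred n ih =>
    have := P.pr_el A (P.el A ^ (-(n : ℤ) - 1) * x)
    rw [← mul_assoc, ← zpow_one_add] at this
    rw [show (1 : ℤ) + (-(n : ℤ) - 1) = -(n : ℤ) by ring, ih] at this
    linarith

theorem d_zpow (A : ι) (n : ℤ) (x y : F) :
    P.d A (P.el A ^ n * x) (P.el A ^ n * y) = P.d A x y := by
  simp [d, pr_zpow]

theorem same_act {k : F} {A B : ι} (h : P.same (P.act k A) (P.act k B)) : P.same A B := by
  unfold same at *
  rw [P.el_act, P.el_act] at h
  have key : ∀ a : F, Subgroup.zpowers (k * a * k⁻¹) =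
      (Subgroup.zpowers a).map (MulAut.conj k).toMonoidHom := by
    intro a; rw [MonoidHom.map_zpowers]; simp
  rw [key, key] at h
  exact Subgroup.map_injective (MulAut.conj k).injective h

/-- invariant of a stage -/
structure Inv (S : Set F) (K : Subgroup F) : Prop where
  one : (1 : F) ∈ S
  inv : ∀ k ∈ K, ∀ s ∈ S, k * s ∈ S
  small : ∀ A, P.el A ∉ K → ∀ s ∈ S, ∀ t ∈ S, 100 * P.d A s t < 5 * P.len A

def bad (S : Set F) (K : Subgroup F) : Set ι :=
  {C | P.el C ∉ K ∧ ∃ s ∈ S, ∃ t ∈ S, 2 * P.len C ≤ 100 * P.d C s t}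

def nextK (S : Set F) (K : Subgroup F) : Subgroup F :=
  Subgroup.closure (K ∪ P.el '' P.bad S K)

inductive Red (𝓒 : Set ι) (B : Set F) : Option ι → F → Prop
  | base (z : F) : z ∈ B → Red 𝓒 B none z
  | step (C : ι) (n : ℤ) (o : Option ι) (z : F) : C ∈ 𝓒 → n ≠ 0 → Red 𝓒 B o z →
      (∀ C', o = some C' → ¬ P.same C' C) → Red 𝓒 B (some C) (P.el C ^ n * z)

def near (S : Set F) (C : ι) (z : F) : Prop := ∃ s ∈ S, 100 * P.d C z s < P.len C

variable {P} {S : Set F} {K : Subgroup F}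

theorem bad_act (hI : P.Inv S K) {k : F} (hk : k ∈ K) {C : ι} (hC : C ∈ P.bad S K) :
    P.act k C ∈ P.bad S K := by
  obtain ⟨h1, s, hs, t, ht, h2⟩ := hC
  refine ⟨?_, k * s, hI.inv k hk s hs, k * t, hI.inv k hk t ht, ?_⟩
  · rw [P.el_act]
    intro h
    apply h1
    have := K.mul_mem (K.mul_mem (K.inv_mem hk) h) hk
    simpa [mul_assoc] using this
  · rw [P.d_act, P.len_act]; exact h2

theorem red_act (hI : P.Inv S K) {B : Set F} (hB : ∀ k ∈ K, ∀ b ∈ B, k * b ∈ B)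
    {k : F} (hk : k ∈ K) {o : Option ι} {z : F} (h : P.Red (P.bad S K) B o z) :
    P.Red (P.bad S K) B (o.map (P.act k)) (k * z) := by
  induction h with
  | base z hz => exact Red.base _ (hB k hk z hz)
  | step C n o z hC hn hz ho ih =>
    have : k * (P.el C ^ n * z) = P.el (P.act k C) ^ n * (k * z) := by
      rw [P.el_act, conj_zpow]; group
    rw [this]
    refine Red.step _ n _ _ (bad_act hI hk hC) hn ih ?_
    intro C' hC' hs
    cases o with
    | none => simp at hC'
    | some C'' =>
      simp at hC'
      subst hC'
      exact ho C'' rfl (P.same_act hs)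

theorem red_el {𝓒 : Set ι} {B : Set F} {C : ι} (hC : C ∈ 𝓒) (n : ℤ) {o : Option ι} {z : F}
    (h : P.Red 𝓒 B o z) : ∃ o', P.Red 𝓒 B o' (P.el C ^ n * z) := by
  by_cases hn : n = 0
  · subst hn; simpa using ⟨o, h⟩
  by_cases hs : ∃ C', o = some C' ∧ P.same C' C
  · obtain ⟨C', rfl, hs⟩ := hs
    have : P.el C ^ n ∈ Subgroup.zpowers (P.el C') := by
      rw [show Subgroup.zpowers (P.el C') = _ from hs]
      exact Subgroup.zpow_mem _ (Subgroup.mem_zpowers _) n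
    obtain ⟨q, hq⟩ := Subgroup.mem_zpowers_iff.1 this
    rw [← hq]
    cases h with
    | step _ m o z hC' hm hz ho =>
      rw [← mul_assoc, ← zpow_add]
      by_cases hqm : q + m = 0
      · rw [hqm]; simpa using ⟨o, hz⟩
      · exact ⟨_, Red.step C' _ o z hC' hqm hz ho⟩
  · push Not at hs
    exact ⟨_, Red.step C n o z hC hn h hs⟩

theorem red_next (hI : P.Inv S K) {B : Set F} (hB : ∀ k ∈ K, ∀ b ∈ B, k * b ∈ B)
    {k : F} (hk : k ∈ P.nextK S K) : ∀ z, (∃ o, P.Red (P.bad S K) B o z) →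
    ∃ o, P.Red (P.bad S K) B o (k * z) := by
  suffices h : (∀ z, (∃ o, P.Red (P.bad S K) B o z) → ∃ o, P.Red (P.bad S K) B o (k * z)) ∧
      (∀ z, (∃ o, P.Red (P.bad S K) B o z) → ∃ o, P.Red (P.bad S K) B o (k⁻¹ * z)) from h.1
  unfold nextK at hk
  induction hk using Subgroup.closure_induction with
  | mem x hx =>
    rcases hx with hx | ⟨C, hC, rfl⟩
    · exact ⟨fun z ⟨o, h⟩ => ⟨_, red_act hI hB hx h⟩,
        fun z ⟨o, h⟩ => ⟨_, red_act hI hB (K.inv_mem hx) h⟩⟩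
    · refine ⟨fun z ⟨o, h⟩ => ?_, fun z ⟨o, h⟩ => ?_⟩
      · simpa using red_el hC 1 h
      · simpa using red_el hC (-1) h
  | one => simp
  | mul x y _ _ hx hy =>
    refine ⟨fun z hz => ?_, fun z hz => ?_⟩
    · rw [mul_assoc]; exact hx.1 _ (hy.1 _ hz)
    · rw [mul_inv_rev, mul_assoc]; exact hy.2 _ (hx.2 _ hz)
  | inv x _ hx => exact ⟨hx.2, by simpa using hx.1⟩

theorem far_of_near (hI : P.Inv S K) {C : ι} (hC : C ∈ P.bad S K) {n : ℤ} (hn : n ≠ 0) {z : F}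
    (h : P.near S C z) : ∀ s ∈ S, 94 * P.len C < 100 * P.d C (P.el C ^ n * z) s := by
  intro s hs
  obtain ⟨t, ht, h⟩ := h
  have h1 := hI.small C hC.1 s hs t ht
  unfold d at *
  rw [pr_zpow]
  have h3 : P.len C ≤ |n * P.len C| := by
    rw [abs_mul, abs_of_pos (a := P.len C) (by linarith [P.len_gt C])]
    have := Int.one_le_abs hn
    nlinarith [P.len_gt C]
  have h4 : |n * P.len C| ≤ |P.pr C z + n * P.len C - P.pr C s| + |P.pr C s - P.pr C t|
      + |P.pr C z - P.pr C t| := by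
    have := abs_add_three (P.pr C z + n * P.len C - P.pr C s) (P.pr C s - P.pr C t)
      (-(P.pr C z - P.pr C t))
    rw [abs_neg] at this
    refine le_trans (le_of_eq ?_) this
    congr 1; ring
  linarith

/-- some point of a bad set avoids a small interval -/
theorem exists_avoid {C : ι} (hC : C ∈ P.bad S K) (n : ℤ) {I : Set ℤ}
    (hI : ∀ i ∈ I, ∀ i' ∈ I, 100 * |i - i'| < P.len C) :
    ∃ s ∈ S, P.pr C (P.el C ^ n * s) ∉ I := by
  obtain ⟨_, s, hs, t, ht, h⟩ := hC
  by_contra! hcon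
  have := hI _ (hcon s hs) _ (hcon t ht)
  have h2 := P.d_zpow C n s t
  unfold d at *
  rw [h2] at this
  linarith [P.len_gt C]

theorem near_of_far {C C' : ι} (hC : C ∈ P.bad S K) (hC' : C' ∈ P.bad S K)
    (hne : ¬ P.same C' C) {z : F} (h : ∀ s ∈ S, P.len C' ≤ 100 * P.d C' z s) :
    P.near S C z := by
  obtain ⟨I, J, hI, hJ, hy⟩ := P.behr C' C hne
  by_cases hz : P.pr C' z ∈ I
  · exfalso
    obtain ⟨s, hs, hsJ⟩ := exists_avoid hC 0 hJ
    rcases hy s with h1 | h1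
    · have := h s hs
      have := hI _ hz _ h1
      unfold d at *; linarith
    · simp at hsJ; exact hsJ h1
  · obtain ⟨s, hs, hsI⟩ := exists_avoid hC' 0 hI
    simp at hsI
    refine ⟨s, hs, hJ _ ((hy z).resolve_left hz) _ ((hy s).resolve_left hsI)⟩

theorem near_red (hI : P.Inv S K) {B : Set F} (hBS : B ⊆ S) {o : Option ι} {z : F}
    (h : P.Red (P.bad S K) B o z) : ∀ C ∈ P.bad S K, (∀ C', o = some C' → ¬ P.same C' C) →
    P.near S C z := by
  induction h with
  | base z hz =>
    intro C hC _
    exact ⟨z, hBS hz, by rw [d_self]; linarith [P.len_gt C]⟩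
  | step C n o z hC hn hz ho ih =>
    intro C' hC' hne
    apply near_of_far hC' hC (hne C rfl)
    intro s hs
    have := far_of_near hI hC hn (ih C hC ho) s hs
    linarith [P.len_gt C]

theorem claim1 (hI : P.Inv S K) {k : F} (hk : k ∈ P.nextK S K) :
    k ∈ K ∨ ∃ C, 94 * P.len C < 100 * P.d C 1 k := by
  obtain ⟨o, h⟩ := red_next hI (B := K) (fun k hk b hb => K.mul_mem hk hb) hk 1
    ⟨_, Red.base _ K.one_mem⟩
  rw [mul_one] at h
  have hBS : (K : Set F) ⊆ S := fun k hk => by simpa using hI.inv k hk 1 hI.one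
  cases h with
  | base _ h => exact Or.inl h
  | step C n o z hC hn hz ho =>
    refine Or.inr ⟨C, ?_⟩
    rw [d_comm]
    exact far_of_near hI hC hn (near_red hI hBS hz C hC ho) 1 hI.one

theorem claim2_aux (hI : P.Inv S K) {o : Option ι} {y : F} (h : P.Red (P.bad S K) S o y) :
    ∀ D x, P.el D ∉ P.nextK S K → (∀ C, o = some C → P.near S C x) → P.near S D x →
      100 * P.d D x y < 4 * P.len D := by
  have hD2 : ∀ D, P.el D ∉ P.nextK S K → ∀ s ∈ S, ∀ t ∈ S, 100 * P.d D s t < 2 * P.len D := by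
    intro D hD s hs t ht
    by_contra! hcon
    apply hD
    by_cases hK : P.el D ∈ K
    · exact Subgroup.subset_closure (Or.inl hK)
    · exact Subgroup.subset_closure (Or.inr ⟨D, ⟨hK, s, hs, t, ht, hcon⟩, rfl⟩)
  induction h with
  | base z hz =>
    intro D x hD _ ⟨s, hs, h⟩
    have := hD2 D hD s hs z hz
    have := P.d_tri D x s z
    linarith [P.len_gt D]
  | step C n o z hC hn hz ho ih =>
    intro D x hD hx hxD
    have hxC := hx C rfl
    have hCK : P.el C ∈ P.nextK S K := Subgroup.subset_closure (Or.inr ⟨C, hC, rfl⟩)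
    have hne : ¬ P.same C D := by
      intro hs
      apply hD
      have : P.el D ∈ Subgroup.zpowers (P.el C) := by
        rw [show Subgroup.zpowers (P.el C) = _ from hs]; exact Subgroup.mem_zpowers _
      exact (Subgroup.zpowers_le.2 hCK) this
    obtain ⟨I, J, hI1, hJ1, hy⟩ := P.behr C D hne
    have hfar := far_of_near hI hC hn (near_red hI subset_rfl hz C hC ho)
    by_cases h1 : P.pr C (P.el C ^ n * z) ∈ I
    · have h2 : P.pr C x ∉ I := by
        intro h2
        have h3 := hI1 _ h1 _ h2
        obtain ⟨s, hs, h4⟩ := hxC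
        have := hfar s hs
        have := P.d_tri C (P.el C ^ n * z) x s
        unfold d at *
        linarith [P.len_gt C]
      have h3 := (hy x).resolve_left h2
      obtain ⟨s, hs, hsI⟩ := exists_avoid hC n hI1
      have h4 := (hy _).resolve_left hsI
      have h5 := hJ1 _ h3 _ h4
      set g := P.el C ^ n with hg
      have hgK : g ∈ P.nextK S K := Subgroup.zpow_mem _ hCK n
      have key := ih (P.act g⁻¹ D) (g⁻¹ * x) ?_ ?_ ?_
      · have e := P.d_act g⁻¹ D x (g * z)
        rw [inv_mul_cancel_left] at e
        rw [e, P.len_act] at key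
        exact key
      · rw [P.el_act]
        intro h
        apply hD
        have := Subgroup.mul_mem _ (Subgroup.mul_mem _ hgK h) (Subgroup.inv_mem _ hgK)
        simpa [mul_assoc] using this
      · intro C' hC'
        subst hC'
        have hns : ¬ P.same C' C := ho C' rfl
        have hC'b : C' ∈ P.bad S K := by
          cases hz; assumption
        apply near_of_far hC'b hC (fun h => hns h.symm)
        intro s hs
        have := far_of_near hI hC (neg_ne_zero.2 hn) hxC s hs
        rw [zpow_neg, ← hg] at this
        linarith [P.len_gt C]
      · refine ⟨s, hs, ?_⟩
        have e := P.d_act g⁻¹ D x (g * s)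
        rw [inv_mul_cancel_left] at e
        rw [e, P.len_act]
        exact h5
    · have h3 := (hy _).resolve_left h1
      obtain ⟨s, hs, hsI⟩ := exists_avoid hC 0 hI1
      simp at hsI
      have h4 := (hy _).resolve_left hsI
      have h5 : 100 * P.d D s (P.el C ^ n * z) < P.len D := hJ1 _ h4 _ h3
      obtain ⟨t, ht, h6⟩ := hxD
      have := hD2 D hD t ht s hs
      have := P.d_tri D x t s
      have := P.d_tri D x s (P.el C ^ n * z)
      linarith

def nextS (P : ProjSys F ι) (S : Set F) (K : Subgroup F) : Set F :=
  {x | ∃ k ∈ P.nextK S K, ∃ s ∈ S, x = k * s ∨ ∃ a ∈ P.gens, x = k * s * a}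

theorem inv_next (hI : P.Inv S K) : P.Inv (P.nextS S K) (P.nextK S K) := by
  refine ⟨⟨1, Subgroup.one_mem _, 1, hI.one, by simp⟩, ?_, ?_⟩
  · rintro k hk _ ⟨k', hk', s, hs, h⟩
    refine ⟨k * k', Subgroup.mul_mem _ hk hk', s, hs, ?_⟩
    rcases h with rfl | ⟨a, ha, rfl⟩
    · left; group
    · right; exact ⟨a, ha, by group⟩
  · intro D hD x hx y hy
    have main : ∀ k ∈ P.nextK S K, ∀ s ∈ S, ∀ k' ∈ P.nextK S K, ∀ t ∈ S,
        100 * P.d D (k * s) (k' * t) < 4 * P.len D := by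
      intro k hk s hs k' hk' t ht
      have e := P.d_act k⁻¹ D (k * s) (k' * t)
      rw [inv_mul_cancel_left, ← mul_assoc] at e
      rw [← e, ← P.len_act k⁻¹ D]
      obtain ⟨o, h⟩ := red_next hI (B := S) hI.inv
        (Subgroup.mul_mem _ (Subgroup.inv_mem _ hk) hk') t ⟨_, Red.base _ ht⟩
      have hn : ∀ C, P.near S C s := fun C => ⟨s, hs, by rw [d_self]; linarith [P.len_gt C]⟩
      refine claim2_aux hI h _ s ?_ (fun C _ => hn C) (hn _)
      rw [P.el_act]
      intro h
      apply hD
      have := Subgroup.mul_mem _ (Subgroup.mul_mem _ hk h) (Subgroup.inv_mem _ hk)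
      simpa [mul_assoc] using this
    have nb : ∀ x ∈ P.nextS S K, ∃ k ∈ P.nextK S K, ∃ s ∈ S, P.d D x (k * s) ≤ 1 := by
      rintro x ⟨k, hk, s, hs, h⟩
      refine ⟨k, hk, s, hs, ?_⟩
      rcases h with rfl | ⟨a, ha, rfl⟩
      · rw [d_self]; norm_num
      · rw [d_comm]; exact P.pr_gen D _ a ha
    obtain ⟨k, hk, s, hs, h1⟩ := nb x hx
    obtain ⟨k', hk', t, ht, h2⟩ := nb y hy
    have := main k hk s hs k' hk' t ht
    have := P.d_tri D x (k * s) y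
    have := P.d_tri D (k * s) (k' * t) y
    rw [P.d_comm D (k' * t) y] at this
    linarith [P.len_gt D]

/-- stages -/
def stage (P : ProjSys F ι) : ℕ → Set F × Subgroup F
  | 0 => ({1}, ⊥)
  | n + 1 => (P.nextS (stage P n).1 (stage P n).2, P.nextK (stage P n).1 (stage P n).2)

theorem inv_stage (n : ℕ) : P.Inv (P.stage n).1 (P.stage n).2 := by
  induction n with
  | zero =>
    refine ⟨rfl, ?_, ?_⟩
    · intro k hk s hs
      have : k = 1 := hk
      subst this; simpa using hs
    · intro A _ s hs t ht
      have e1 : s = 1 := hs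
      have e2 : t = 1 := ht
      subst e1 e2
      rw [d_self]; linarith [P.len_gt A]
  | succ n ih => exact inv_next ih

theorem stage_S_mono : Monotone fun n => (P.stage n).1 := by
  apply monotone_nat_of_le_succ
  intro n x hx
  exact ⟨1, Subgroup.one_mem _, x, hx, by simp⟩

theorem stage_K_mono : Monotone fun n => (P.stage n).2 := by
  apply monotone_nat_of_le_succ
  intro n x hx
  exact Subgroup.subset_closure (Or.inl hx)

theorem stage_S_top (x : F) : ∃ n, x ∈ (P.stage n).1 := by
  have := P.gens_top x
  induction this using Submonoid.closure_induction_right with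
  | one => exact ⟨0, rfl⟩
  | mul_right x _ y hy ih =>
    obtain ⟨n, hn⟩ := ih
    exact ⟨n + 1, 1, Subgroup.one_mem _, x, hn, Or.inr ⟨y, hy, by simp⟩⟩

theorem el_mem_stage (A : ι) : ∃ n, P.el A ∈ (P.stage n).2 := by
  obtain ⟨n, hn⟩ := P.stage_S_top (P.el A)
  refine ⟨n, ?_⟩
  by_contra hcon
  have := (inv_stage n).small A hcon _ hn 1 (inv_stage n).one
  unfold d at this
  have h2 := P.pr_el A 1
  rw [mul_one] at h2
  rw [h2, add_sub_cancel_left, abs_of_pos (by linarith [P.len_gt A])] at this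
  linarith [P.len_gt A]

theorem mem_stage {w : F} (hw : w ∈ Subgroup.closure (Set.range P.el)) :
    ∃ n, w ∈ (P.stage n).2 := by
  induction hw using Subgroup.closure_induction with
  | mem x hx => obtain ⟨A, rfl⟩ := hx; exact el_mem_stage A
  | one => exact ⟨0, Subgroup.one_mem _⟩
  | mul x y _ _ hx hy =>
    obtain ⟨n, hn⟩ := hx
    obtain ⟨m, hm⟩ := hy
    exact ⟨max n m, Subgroup.mul_mem _ (stage_K_mono (le_max_left n m) hn)
      (stage_K_mono (le_max_right n m) hm)⟩
  | inv x _ hx => obtain ⟨n, hn⟩ := hx; exact ⟨n, Subgroup.inv_mem _ hn⟩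

theorem main (P : ProjSys F ι) {w : F} (hw : w ∈ Subgroup.closure (Set.range P.el)) (h1 : w ≠ 1) :
    ∃ C, 94 * P.len C < 100 * P.d C 1 w := by
  obtain ⟨n, hn⟩ := P.mem_stage hw
  induction n with
  | zero => exact absurd hn h1
  | succ n ih =>
    rcases claim1 (inv_stage n) hn with h | h
    · exact ih h
    · exact h

end ProjSys
namespace SCLine
open FreeGroup

variable {α : Type} [DecidableEq α]

theorem toWord_mul_of_norm {a b : FreeGroup α} (h : (a * b).norm = a.norm + b.norm) :
    (a * b).toWord = a.toWord ++ b.toWord := by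
  apply (toWord_mul_sublist a b).eq_of_length
  simpa [FreeGroup.norm] using h

theorem norm_mul_of_isReduced {a b : FreeGroup α} (h : IsReduced (a.toWord ++ b.toWord)) :
    (a * b).norm = a.norm + b.norm := by
  unfold FreeGroup.norm
  rw [toWord_mul, h.reduce_eq, List.length_append]

theorem norm_overlap {a b c : FreeGroup α} (h1 : (a * b).norm = a.norm + b.norm)
    (h2 : (b * c).norm = b.norm + c.norm) (hb : b ≠ 1) :
    (a * b * c).norm = a.norm + b.norm + c.norm := by
  have e1 := toWord_mul_of_norm h1
  have e2 := toWord_mul_of_norm h2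
  have r1 : IsReduced (a.toWord ++ b.toWord) := e1 ▸ isReduced_toWord
  have r2 : IsReduced (b.toWord ++ c.toWord) := e2 ▸ isReduced_toWord
  have r3 := r1.append_overlap r2 (by simpa using hb)
  rw [← e1] at r3
  rw [norm_mul_of_isReduced r3, h1]

theorem toWord_letter (x : α × Bool) : (mk [x]).toWord = [x] := by
  rw [toWord_mk, reduce_singleton]

theorem norm_letter (x : α × Bool) : (mk [x]).norm = 1 := by
  unfold FreeGroup.norm; rw [toWord_letter]; rfl

theorem norm_mul_letter (g : FreeGroup α) (x : α × Bool) :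
    (g * mk [x]).norm = g.norm + 1 ∨ g.norm = (g * mk [x]).norm + 1 := by
  rcases List.eq_nil_or_concat g.toWord with h | ⟨L, y, h⟩
  · rw [toWord_eq_nil_iff] at h
    subst h
    left; rw [one_mul, norm_letter]; rfl
  · rw [List.concat_eq_append] at h
    by_cases hxy : y.1 = x.1 → y.2 = x.2
    · left
      rw [norm_mul_of_isReduced, norm_letter]
      rw [toWord_letter, h]
      have h1 : IsReduced (L ++ [y]) := h ▸ isReduced_toWord
      exact h1.append_overlap (L₃ := [x]) (by simpa [isReduced_cons_cons] using hxy) (by simp)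
    · right
      push Not at hxy
      have h1 : IsReduced (L ++ [y]) := h ▸ isReduced_toWord
      have h2 : IsReduced L := h1.infix ⟨[], [y], by simp⟩
      have e : g * mk [x] = mk L := by
        rw [← mk_toWord (x := g), h, mul_mk]
        obtain ⟨y1, y2⟩ := y
        obtain ⟨x1, x2⟩ := x
        obtain ⟨rfl, h4⟩ := hxy
        have : x2 = !y2 := by
          simp at h4; revert h4; cases x2 <;> cases y2 <;> simp
        subst this
        apply Quot.sound
        have := Red.Step.not (L₁ := L) (L₂ := []) (x := y1) (b := y2)
        simpa using this
      rw [e]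
      unfold FreeGroup.norm
      rw [h, toWord_mk, h2.reduce_eq]; simp

structure Line (α : Type) where ofPts ::
  pt : ℤ → FreeGroup α
  e : ℤ → α × Bool
  step : ∀ i, pt (i + 1) = pt i * mk [e i]
  red : ∀ i, (e i).1 = (e (i + 1)).1 → (e i).2 = (e (i + 1)).2

namespace Line

variable (L : Line α)

def seg (i : ℤ) (n : ℕ) : List (α × Bool) := (List.range n).map fun k : ℕ => L.e (i + (k : ℤ))

theorem seg_length (i : ℤ) (n : ℕ) : (L.seg i n).length = n := by simp [seg]

theorem seg_add (i : ℤ) (n m : ℕ) : L.seg i (n + m) = L.seg i n ++ L.seg (i + n) m := by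
  simp [seg, List.range_add, add_assoc]

theorem pt_add (i : ℤ) (n : ℕ) : L.pt (i + n) = L.pt i * mk (L.seg i n) := by
  induction n with
  | zero => simp [seg, ← one_eq_mk]
  | succ n ih =>
    rw [seg_add, ← mul_mk, ← mul_assoc, ← ih]
    push_cast
    rw [← add_assoc, L.step]
    simp [seg]

theorem seg_isReduced (i : ℤ) (n : ℕ) : FreeGroup.IsReduced (L.seg i n) := by
  unfold FreeGroup.IsReduced
  rw [List.isChain_iff_getElem]
  intro k hk
  simp only [seg, List.getElem_map, List.getElem_range]
  have := L.red (i + k)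
  push_cast
  rw [← add_assoc]
  exact this

theorem toWord_seg (i : ℤ) (n : ℕ) : ((L.pt i)⁻¹ * L.pt (i + n)).toWord = L.seg i n := by
  rw [pt_add, inv_mul_cancel_left, toWord_mk, (L.seg_isReduced i n).reduce_eq]

theorem norm_pt (i j : ℤ) : (((L.pt i)⁻¹ * L.pt j).norm : ℤ) = |j - i| := by
  have key : ∀ (i : ℤ) (n : ℕ), (((L.pt i)⁻¹ * L.pt (i + n)).norm : ℤ) = n := by
    intro i n
    unfold FreeGroup.norm
    rw [toWord_seg, seg_length]
  rcases le_total i j with h | h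
  · obtain ⟨n, rfl⟩ := Int.le.dest h
    rw [key]; simp
  · obtain ⟨n, rfl⟩ := Int.le.dest h
    rw [← norm_inv_eq]
    simp only [mul_inv_rev, inv_inv]
    rw [key]; simp

/-- the reversed line -/
def rev : Line α where
  pt i := L.pt (-i)
  e i := ((L.e (-i - 1)).1, !(L.e (-i - 1)).2)
  step i := by
    have := L.step (-i - 1)
    rw [sub_add_cancel] at this
    rw [this, show -(i + 1) = -i - 1 by ring, mul_assoc]
    have h2 : mk [((L.e (-i - 1)).1, !(L.e (-i - 1)).2)] = (mk [L.e (-i - 1)])⁻¹ := by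
      rw [inv_mk]; rfl
    rw [h2, mul_inv_cancel, mul_one]
  red i := by
    intro h
    have := L.red (-i - 1 - 1)
    rw [sub_add_cancel] at this
    rw [show -(i + 1) - 1 = -i - 1 - 1 by ring] at h ⊢
    simp only at h ⊢
    rw [this h.symm]

theorem rev_pt (i : ℤ) : L.rev.pt i = L.pt (-i) := rfl

def f (x : FreeGroup α) (j : ℤ) : ℕ := (x⁻¹ * L.pt j).norm

theorem f_step (x : FreeGroup α) (j : ℤ) :
    L.f x (j + 1) = L.f x j + 1 ∨ L.f x j = L.f x (j + 1) + 1 := by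
  unfold f
  rw [L.step, ← mul_assoc]
  exact norm_mul_letter _ _

theorem f_peak (x : FreeGroup α) (j : ℤ) (h : L.f x (j + 1) = L.f x j + 1) :
    L.f x (j + 1 + 1) = L.f x (j + 1) + 1 := by
  unfold f at *
  rw [L.step (j + 1)]
  rw [L.step j, ← mul_assoc] at h ⊢
  rw [← mul_assoc, norm_overlap, norm_letter, norm_letter, h]
  · rw [h, norm_letter]
  · rw [norm_mul_of_isReduced]
    rw [toWord_letter, toWord_letter]
    simpa [isReduced_cons_cons] using L.red j
  · intro h
    have := norm_letter (L.e j)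
    rw [h] at this; simp at this

theorem f_up (x : FreeGroup α) (p : ℤ) (h : L.f x (p + 1) = L.f x p + 1) (n : ℕ) :
    L.f x (p + n) = L.f x p + n := by
  suffices h : L.f x (p + n) = L.f x p + n ∧ L.f x (p + n + 1) = L.f x (p + n) + 1 from h.1
  induction n with
  | zero => simpa using h
  | succ n ih =>
    push_cast
    rw [← add_assoc]
    exact ⟨by rw [ih.2, ih.1]; ring, L.f_peak x _ ih.2⟩

theorem exists_proj (x : FreeGroup α) :
    ∃ p : ℤ, ∀ j, (L.f x j : ℤ) = L.f x p + |j - p| := by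
  obtain ⟨p, hp⟩ : ∃ p, ∀ j, L.f x p ≤ L.f x j := by
    have h := wellFounded_lt.has_min (Set.range (L.f x)) ⟨_, 0, rfl⟩
    obtain ⟨_, ⟨p, rfl⟩, hp⟩ := h
    exact ⟨p, fun j => not_lt.1 (hp _ ⟨j, rfl⟩)⟩
  refine ⟨p, fun j => ?_⟩
  have h1 : L.f x (p + 1) = L.f x p + 1 := by
    rcases L.f_step x p with h | h
    · exact h
    · have := hp (p + 1); omega
  have h2 : L.rev.f x (-p + 1) = L.rev.f x (-p) + 1 := by
    rcases L.rev.f_step x (-p) with h | h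
    · exact h
    · have := hp (-(-p + 1))
      unfold f at *
      simp only [rev_pt, neg_neg] at *
      omega
  rcases le_total p j with h | h
  · obtain ⟨n, rfl⟩ := Int.le.dest h
    rw [L.f_up x p h1]; simp
  · obtain ⟨n, rfl⟩ := Int.le.dest h
    have := L.rev.f_up x _ h2 n
    unfold f at *
    simp only [rev_pt, neg_neg] at this
    rw [show -(-(j + (n : ℤ)) + n) = j by ring] at this
    rw [this]; simp

noncomputable def pr (x : FreeGroup α) : ℤ := (L.exists_proj x).choose

theorem pr_spec (x : FreeGroup α) (j : ℤ) :
    (L.f x j : ℤ) = L.f x (L.pr x) + |j - L.pr x| := (L.exists_proj x).choose_spec j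

theorem pr_unique (x : FreeGroup α) (p : ℤ) (h : ∀ j, L.f x p ≤ L.f x j) : L.pr x = p := by
  have h1 := h (L.pr x)
  have h2 := L.pr_spec x p
  have : |p - L.pr x| = 0 := le_antisymm (by omega) (abs_nonneg _)
  have := abs_eq_zero.1 this
  omega

theorem pr_step (x : FreeGroup α) (s : α × Bool) : |L.pr x - L.pr (x * mk [s])| ≤ 1 := by
  have h1 := L.pr_spec x (L.pr (x * mk [s]))
  have h2 := L.pr_spec (x * mk [s]) (L.pr x)
  have key : ∀ j, L.f x j ≤ L.f (x * mk [s]) j + 1 ∧ L.f (x * mk [s]) j ≤ L.f x j + 1 := by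
    intro j
    unfold f
    have e : (x * mk [s])⁻¹ * L.pt j = (mk [s])⁻¹ * (x⁻¹ * L.pt j) := by group
    have a1 := norm_mul_le (mk [s])⁻¹ (x⁻¹ * L.pt j)
    have a2 := norm_mul_le (mk [s]) ((x * mk [s])⁻¹ * L.pt j)
    rw [← e, norm_inv_eq, norm_letter] at a1
    rw [e, mul_inv_cancel_left, ← e, norm_letter] at a2
    omega
  have k1 := key (L.pr x)
  have k2 := key (L.pr (x * mk [s]))
  rw [abs_sub_comm] at h1
  omega

/-- the geodesic goes through the line if the projections differ -/
theorem through (x y : FreeGroup α) (h : L.pr x ≠ L.pr y) :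
    (x⁻¹ * y).norm = L.f x (L.pr x) + ((L.pt (L.pr x))⁻¹ * L.pt (L.pr y)).norm
      + ((L.pt (L.pr y))⁻¹ * y).norm := by
  have e : x⁻¹ * y = (x⁻¹ * L.pt (L.pr x)) * ((L.pt (L.pr x))⁻¹ * L.pt (L.pr y)) *
    ((L.pt (L.pr y))⁻¹ * y) := by group
  rw [e, norm_overlap]
  · rfl
  · have h1 := L.pr_spec x (L.pr y)
    have h2 := L.norm_pt (L.pr x) (L.pr y)
    unfold f at h1
    rw [show x⁻¹ * L.pt (L.pr x) * ((L.pt (L.pr x))⁻¹ * L.pt (L.pr y)) = x⁻¹ * L.pt (L.pr y) by group]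
    omega
  · have h1 := L.pr_spec y (L.pr x)
    have h2 := L.norm_pt (L.pr x) (L.pr y)
    unfold f at h1
    rw [show (L.pt (L.pr x))⁻¹ * L.pt (L.pr y) * ((L.pt (L.pr y))⁻¹ * y)
      = (y⁻¹ * L.pt (L.pr x))⁻¹ by group, norm_inv_eq]
    rw [← norm_inv_eq (x := (L.pt (L.pr y))⁻¹ * y), show ((L.pt (L.pr y))⁻¹ * y)⁻¹
      = y⁻¹ * L.pt (L.pr y) by group]
    rw [abs_sub_comm] at h1
    omega
  · intro h1
    have h2 := L.norm_pt (L.pr x) (L.pr y)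
    rw [h1] at h2
    simp at h2
    have := abs_eq_zero.1 h2.symm
    omega

theorem through_word (x y : FreeGroup α) (n : ℕ) (hn : 0 < n) (h : L.pr y = L.pr x + n) :
    (x⁻¹ * y).toWord = (x⁻¹ * L.pt (L.pr x)).toWord ++ L.seg (L.pr x) n
      ++ ((L.pt (L.pr y))⁻¹ * y).toWord := by
  have h1 := L.through x y (by omega)
  have e : x⁻¹ * y = (x⁻¹ * L.pt (L.pr x)) * ((L.pt (L.pr x))⁻¹ * L.pt (L.pr y)) *
    ((L.pt (L.pr y))⁻¹ * y) := by group
  have h2 := norm_mul_le (x⁻¹ * L.pt (L.pr x) * ((L.pt (L.pr x))⁻¹ * L.pt (L.pr y)))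
    ((L.pt (L.pr y))⁻¹ * y)
  have h3 := norm_mul_le (x⁻¹ * L.pt (L.pr x)) ((L.pt (L.pr x))⁻¹ * L.pt (L.pr y))
  rw [← e] at h2
  unfold f at h1
  conv_lhs => rw [e]
  rw [toWord_mul_of_norm, toWord_mul_of_norm]
  · have := L.toWord_seg (L.pr x) n
    rw [← h] at this
    rw [this]
  · omega
  · rw [← e]; omega

/-- Behrstock -/
theorem behr (A B : Line α) (y : FreeGroup α) :
    (∃ j, A.pr y = A.pr (B.pt j)) ∨ (∃ j, B.pr y = B.pr (A.pt j)) := by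
  by_cases h : A.pr y = A.pr (B.pt (B.pr y))
  · exact Or.inl ⟨_, h⟩
  · right
    refine ⟨A.pr y, ?_⟩
    symm
    apply B.pr_unique
    intro j
    have h1 := A.through y _ h
    have h2 := norm_mul_le ((A.pt (A.pr y))⁻¹ * A.pt (A.pr (B.pt (B.pr y))))
      ((A.pt (A.pr (B.pt (B.pr y))))⁻¹ * B.pt (B.pr y))
    rw [show (A.pt (A.pr y))⁻¹ * A.pt (A.pr (B.pt (B.pr y))) *
      ((A.pt (A.pr (B.pt (B.pr y))))⁻¹ * B.pt (B.pr y)) = (A.pt (A.pr y))⁻¹ * B.pt (B.pr y)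
      by group] at h2
    have h3 := norm_mul_le (y⁻¹ * A.pt (A.pr y)) ((A.pt (A.pr y))⁻¹ * B.pt j)
    rw [show y⁻¹ * A.pt (A.pr y) * ((A.pt (A.pr y))⁻¹ * B.pt j) = y⁻¹ * B.pt j by group] at h3
    have h4 := B.pr_spec y j
    have := abs_nonneg (j - B.pr y)
    unfold f at *
    omega

/-- overlap of two lines -/
theorem overlap (A B : Line α) (j j' : ℤ) (hj : j ≤ j') (n : ℕ) (hn : 0 < n)
    (h : A.pr (B.pt j') = A.pr (B.pt j) + n) :
    ∃ k, A.pt (A.pr (B.pt j)) = B.pt k ∧ A.seg (A.pr (B.pt j)) n = B.seg k n := by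
  obtain ⟨m, rfl⟩ := Int.le.dest hj
  have h1 := A.through_word _ _ n hn h
  rw [B.toWord_seg] at h1
  set X := ((B.pt j)⁻¹ * A.pt (A.pr (B.pt j))).toWord with hX
  set Z := ((A.pt (A.pr (B.pt (j + m))))⁻¹ * B.pt (j + m)).toWord
  have hl := congrArg List.length h1
  simp only [List.length_append, seg_length] at hl
  rw [show m = X.length + (n + Z.length) by omega, seg_add, seg_add, List.append_assoc] at h1
  have h2 := List.append_inj h1 (by simp [seg_length])
  have h3 := List.append_inj h2.2 (by simp [seg_length])
  refine ⟨j + X.length, ?_, h3.1.symm⟩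
  rw [B.pt_add, h2.1, hX, mk_toWord]; group

end Line
end SCLine
namespace SCLine
open FreeGroup

variable {α : Type} [DecidableEq α]

structure SC (R : Set (FreeGroup α)) : Prop where
  sym : Symmetrized R
  piece : ∀ r₁ ∈ R, ∀ r₂ ∈ R, r₁ ≠ r₂ → ∀ v, v <+: r₁.toWord → v <+: r₂.toWord →
    100 * v.length < r₁.toWord.length
  len : ∀ r ∈ R, 200 < r.toWord.length

theorem idx_lt (i : ℤ) {l : ℕ} (hl : 0 < l) : (i % l).toNat < l := by
  have := Int.emod_lt_of_pos i (b := l) (by omega)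
  omega

theorem idx_succ (i : ℤ) {l : ℕ} (hl : 0 < l) (h : (i % l).toNat + 1 < l) :
    (i + 1) / l = i / l ∧ ((i + 1) % l).toNat = (i % l).toNat + 1 := by
  have h0 := Int.emod_nonneg i (b := l) (by omega)
  have h1 := Int.mul_ediv_add_emod i l
  have h2 : (i + 1) / l = i / l ∧ (i + 1) % l = i % l + 1 := by
    rw [Int.ediv_emod_unique (by omega)]
    refine ⟨by linarith, by omega, by omega⟩
  exact ⟨h2.1, by omega⟩

theorem idx_last (i : ℤ) {l : ℕ} (hl : 0 < l) (h : ¬ (i % l).toNat + 1 < l) :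
    (i + 1) / l = i / l + 1 ∧ ((i + 1) % l).toNat = 0 ∧ (i % l).toNat + 1 = l := by
  have h0 := Int.emod_nonneg i (b := l) (by omega)
  have h4 := idx_lt i hl
  have h1 := Int.mul_ediv_add_emod i l
  have h2 : (i + 1) / l = i / l + 1 ∧ (i + 1) % l = 0 := by
    rw [Int.ediv_emod_unique (by omega)]
    refine ⟨?_, by omega, by omega⟩
    have : i % l = l - 1 := by omega
    rw [this] at h1
    linarith
  exact ⟨h2.1, by omega, by omega⟩

def rline (g r : FreeGroup α) (hl : 0 < r.toWord.length) (hc : CyclicallyReduced r) : Line α where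
  pt i := g * r ^ (i / (r.toWord.length : ℤ)) *
    FreeGroup.mk (r.toWord.take (i % (r.toWord.length : ℤ)).toNat)
  e i := r.toWord[(i % (r.toWord.length : ℤ)).toNat]'(idx_lt i hl)
  step i := by
    by_cases h : (i % (r.toWord.length : ℤ)).toNat + 1 < r.toWord.length
    · obtain ⟨h1, h2⟩ := idx_succ i hl h
      rw [h1, h2, mul_assoc _ (FreeGroup.mk _), mul_mk, List.take_concat_get']
    · obtain ⟨h1, h2, h3⟩ := idx_last i hl h
      rw [h1, h2, mul_assoc _ (FreeGroup.mk _), mul_mk, List.take_concat_get', h3, List.take_length,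
        mk_toWord, zpow_add_one, List.take_zero, ← one_eq_mk, mul_one, mul_assoc]
  red i := by
    by_cases h : (i % (r.toWord.length : ℤ)).toNat + 1 < r.toWord.length
    · obtain ⟨h1, h2⟩ := idx_succ i hl h
      simp only [h2]
      have := (isReduced_toWord (x := r))
      unfold FreeGroup.IsReduced at this
      rw [List.isChain_iff_getElem] at this
      exact this _ h
    · obtain ⟨h1, h2, h3⟩ := idx_last i hl h
      simp only [h2]
      intro h4
      by_contra h5
      refine hc r.toWord[0] (r.toWord[(i % (r.toWord.length : ℤ)).toNat]'(idx_lt i hl)) ?_ ?_ ?_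
      · rw [List.head?_eq_getElem?, List.getElem?_eq_getElem hl]
      · rw [List.getLast?_eq_getElem?, ← List.getElem?_eq_getElem]
        congr 1; omega
      · refine Prod.ext h4.symm ?_
        revert h5
        generalize (r.toWord[(i % (r.toWord.length : ℤ)).toNat]'(idx_lt i hl)).2 = a
        generalize (r.toWord[0]).2 = b
        cases a <;> cases b <;> simp

def IsRel (R : Set (FreeGroup α)) (L : Line α) (a : FreeGroup α) (l : ℕ) : Prop :=
  ∀ i, ∃ r ∈ R, L.seg i l = r.toWord ∧ L.pt i * r * (L.pt i)⁻¹ = a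

theorem seg_rline (g r : FreeGroup α) (hl : 0 < r.toWord.length) (hc : CyclicallyReduced r)
    (i : ℤ) : (rline g r hl hc).seg i r.toWord.length =
      r.toWord.rotate (i % (r.toWord.length : ℤ)).toNat := by
  apply List.ext_getElem
  · simp [Line.seg_length]
  · intro k h1 h2
    simp only [Line.seg, List.getElem_map, List.getElem_range, List.getElem_rotate, rline]
    congr 1
    have h0 := Int.emod_nonneg i (b := r.toWord.length) (by omega)
    zify
    rw [Int.toNat_of_nonneg (Int.emod_nonneg _ (by omega)), Int.toNat_of_nonneg h0]
    rw [add_comm, Int.add_emod_emod]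

theorem isRel_rline {R : Set (FreeGroup α)} (hR : Symmetrized R) (g r : FreeGroup α) (hr : r ∈ R)
    (hl : 0 < r.toWord.length) (hc : CyclicallyReduced r) :
    IsRel R (rline g r hl hc) (g * r * g⁻¹) r.toWord.length := by
  intro i
  refine ⟨FreeGroup.mk (r.toWord.rotate (i % (r.toWord.length : ℤ)).toNat), hR.2.1 r hr _, ?_, ?_⟩
  · have := (rline g r hl hc).seg_isReduced i r.toWord.length
    rw [seg_rline] at this ⊢
    rw [toWord_mk, this.reduce_eq]
  · rw [List.rotate_eq_drop_append_take (idx_lt i hl).le]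
    have e : r = FreeGroup.mk (r.toWord.take (i % (r.toWord.length : ℤ)).toNat) *
        FreeGroup.mk (r.toWord.drop (i % (r.toWord.length : ℤ)).toNat) := by
      rw [mul_mk, List.take_append_drop, mk_toWord]
    simp only [rline]
    rw [← mul_mk]
    set X := FreeGroup.mk (r.toWord.take (i % (r.toWord.length : ℤ)).toNat)
    set Y := FreeGroup.mk (r.toWord.drop (i % (r.toWord.length : ℤ)).toNat)
    set n := i / (r.toWord.length : ℤ)
    clear_value X Y n
    have e2 : g * r ^ n * X * (Y * X) * (g * r ^ n * X)⁻¹ = g * (r ^ n * (X * Y) * (r ^ n)⁻¹) * g⁻¹ := by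
      simp only [mul_inv_rev, mul_assoc, mul_inv_cancel_left]
    rw [e2, ← e]
    group

theorem seg_rev (L : Line α) (i : ℤ) (n : ℕ) : L.rev.seg i n = invRev (L.seg (-i - n) n) := by
  have h := L.rev.toWord_seg i n
  rw [← h]
  have h2 := L.toWord_seg (-i - n) n
  rw [sub_add_cancel] at h2
  rw [← h2, ← toWord_inv]
  simp only [Line.rev_pt, mul_inv_rev, inv_inv, neg_add']

theorem IsRel.rev {R : Set (FreeGroup α)} (hR : Symmetrized R) {L : Line α} {a : FreeGroup α}
    {l : ℕ} (h : IsRel R L a l) : IsRel R L.rev a⁻¹ l := by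
  intro i
  obtain ⟨r, hr, h1, h2⟩ := h (-i - l)
  refine ⟨r⁻¹, hR.2.2 r hr, ?_, ?_⟩
  · rw [seg_rev, h1, toWord_inv]
  · have := L.pt_add (-i - l) l
    rw [h1, mk_toWord, sub_add_cancel] at this
    rw [Line.rev_pt, this, ← h2]
    group

theorem seg_prefix (L : Line α) (i : ℤ) {m n : ℕ} (h : m ≤ n) : L.seg i m <+: L.seg i n := by
  obtain ⟨k, rfl⟩ := Nat.exists_eq_add_of_le h
  rw [Line.seg_add]
  exact List.prefix_append _ _

theorem small_overlap {R : Set (FreeGroup α)} (hR : SC R) {A B : Line α} {a b : FreeGroup α}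
    {la lb : ℕ} (hA : IsRel R A a la) (hB : IsRel R B b lb) (hab : a ≠ b) {i k : ℤ} {n : ℕ}
    (h1 : A.pt i = B.pt k) (h2 : A.seg i n = B.seg k n) : 100 * n < la := by
  obtain ⟨r, hr, hr1, hr2⟩ := hA i
  obtain ⟨s, hs, hs1, hs2⟩ := hB k
  have hne : r ≠ s := by
    rintro rfl
    apply hab
    rw [← hr2, ← hs2, h1]
  set m := min n (min la lb) with hm
  have e : A.seg i m = B.seg k m := by
    have e1 := seg_prefix A i (show m ≤ n by omega)
    have e2 := seg_prefix B k (show m ≤ n by omega)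
    rw [h2] at e1
    exact (List.prefix_of_prefix_length_le e1 e2 (by simp [Line.seg_length])).eq_of_length
      (by simp [Line.seg_length])
  have p1 : A.seg i m <+: r.toWord := by
    rw [← hr1]; exact seg_prefix A i (by omega)
  have p2 : A.seg i m <+: s.toWord := by
    rw [← hs1, e]; exact seg_prefix B k (by omega)
  have q1 := hR.piece r hr s hs hne _ p1 p2
  have q2 := hR.piece s hs r hr hne.symm _ p2 p1
  rw [← hr1, Line.seg_length, Line.seg_length] at q1
  rw [← hs1, Line.seg_length, Line.seg_length] at q2
  omega

theorem small_proj {R : Set (FreeGroup α)} (hR : SC R) {A B : Line α} {a b : FreeGroup α}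
    {la lb : ℕ} (hA : IsRel R A a la) (hB : IsRel R B b lb)
    (hab : Subgroup.zpowers a ≠ Subgroup.zpowers b) (j j' : ℤ) :
    100 * |A.pr (B.pt j) - A.pr (B.pt j')| < la := by
  have hpos : 0 < la := by
    obtain ⟨r, hr, h, _⟩ := hA 0
    have := hR.len r hr
    rw [← h, Line.seg_length] at this
    omega
  have h1 : a ≠ b := fun h => hab (by rw [h])
  have h2 : a ≠ b⁻¹ := fun h => hab (by rw [h, Subgroup.zpowers_inv])
  have main : ∀ j j', A.pr (B.pt j) < A.pr (B.pt j') →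
      100 * (A.pr (B.pt j') - A.pr (B.pt j)) < la := by
    intro j j' hlt
    obtain ⟨n, hn⟩ := Int.le.dest hlt.le
    rw [← hn]
    rcases le_total j j' with hj | hj
    · obtain ⟨k, e1, e2⟩ := A.overlap B j j' hj n (by omega) hn.symm
      have := small_overlap hR hA hB h1 e1 e2
      omega
    · have := A.overlap B.rev (-j) (-j') (by omega) n (by omega)
        (by simpa [Line.rev_pt] using hn.symm)
      simp only [Line.rev_pt, neg_neg] at this
      obtain ⟨k, e1, e2⟩ := this
      have := small_overlap hR hA (hB.rev hR.sym) h2 (k := k) e1 e2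
      omega
  rcases lt_trichotomy (A.pr (B.pt j)) (A.pr (B.pt j')) with h | h | h
  · have := main _ _ h
    rw [abs_sub_comm, abs_of_pos (by omega)]; exact this
  · rw [h]; simp; omega
  · have := main _ _ h
    rw [abs_of_pos (by omega)]; exact this

section sys
variable {R : Set (FreeGroup α)} (hR : SC R)

def rl (A : FreeGroup α × R) : Line α :=
  rline A.1 A.2.1 (by have := hR.len _ A.2.2; omega) (hR.sym.1 _ A.2.2)

theorem rl_isRel (A : FreeGroup α × R) :
    IsRel R (rl hR A) (A.1 * A.2.1 * A.1⁻¹) A.2.1.toWord.length :=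
  isRel_rline hR.sym _ _ A.2.2 _ _

theorem rl_act (h : FreeGroup α) (A : FreeGroup α × R) (i : ℤ) :
    (rl hR (h * A.1, A.2)).pt i = h * (rl hR A).pt i := by
  simp [rl, rline, mul_assoc]

theorem rl_el (A : FreeGroup α × R) (i : ℤ) :
    (rl hR A).pt (i + A.2.1.toWord.length) = A.1 * A.2.1 * A.1⁻¹ * (rl hR A).pt i := by
  have := hR.len _ A.2.2
  simp only [rl, rline]
  rw [Int.add_ediv_of_dvd_right (by simp), Int.ediv_self (by omega), Int.add_emod_right, add_comm,
    zpow_one_add]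
  group

noncomputable def sys : ProjSys (FreeGroup α) (FreeGroup α × R) where
  act h A := (h * A.1, A.2)
  el A := A.1 * A.2.1 * A.1⁻¹
  len A := A.2.1.toWord.length
  pr A := (rl hR A).pr
  gens := Set.range fun x : α × Bool => FreeGroup.mk [x]
  el_act h A := by group
  len_act h A := rfl
  pr_act h A x := by
    apply Line.pr_unique
    intro j
    have e : ∀ j, (rl hR (h * A.1, A.2)).f (h * x) j = (rl hR A).f x j := by
      intro j
      unfold Line.f
      rw [rl_act]
      congr 1; group
    rw [e, e]
    have := (rl hR A).pr_spec x j
    have := abs_nonneg (j - (rl hR A).pr x)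
    omega
  pr_el A x := by
    apply Line.pr_unique
    intro j
    have e : ∀ j, (rl hR A).f (A.1 * A.2.1 * A.1⁻¹ * x) (j + A.2.1.toWord.length)
        = (rl hR A).f x j := by
      intro j
      unfold Line.f
      rw [rl_el]
      congr 1; group
    have e2 := e (j - A.2.1.toWord.length)
    rw [sub_add_cancel] at e2
    rw [e, e2]
    have := (rl hR A).pr_spec x (j - A.2.1.toWord.length)
    have := abs_nonneg (j - A.2.1.toWord.length - (rl hR A).pr x)
    omega
  len_gt A := by exact_mod_cast hR.len _ A.2.2
  pr_gen A x s hs := by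
    obtain ⟨y, rfl⟩ := hs
    exact (rl hR A).pr_step x y
  gens_top x := by
    rw [← mk_toWord (x := x)]
    induction x.toWord with
    | nil => exact Submonoid.one_mem _
    | cons y l ih =>
      rw [show y :: l = [y] ++ l from rfl, ← mul_mk]
      exact Submonoid.mul_mem _ (Submonoid.subset_closure ⟨y, rfl⟩) ih
  behr A B hne := by
    refine ⟨Set.range fun j => (rl hR A).pr ((rl hR B).pt j),
      Set.range fun j => (rl hR B).pr ((rl hR A).pt j), ?_, ?_, ?_⟩
    · rintro _ ⟨j, rfl⟩ _ ⟨j', rfl⟩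
      exact small_proj hR (rl_isRel hR A) (rl_isRel hR B) hne j j'
    · rintro _ ⟨j, rfl⟩ _ ⟨j', rfl⟩
      exact small_proj hR (rl_isRel hR B) (rl_isRel hR A) hne.symm j j'
    · intro y
      rcases Line.behr (rl hR A) (rl hR B) y with ⟨j, h⟩ | ⟨j, h⟩
      · exact Or.inl ⟨j, h.symm⟩
      · exact Or.inr ⟨j, h.symm⟩

theorem rev_pr (L : Line α) (x : FreeGroup α) : L.rev.pr x = - L.pr x := by
  apply Line.pr_unique
  intro j
  have := L.pr_spec x (-j)
  have h2 := abs_nonneg (-j - L.pr x)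
  unfold Line.f at *
  rw [Line.rev_pt, Line.rev_pt, neg_neg]
  omega

theorem dehn_aux {L : Line α} {a : FreeGroup α} {l : ℕ} (hL : IsRel R L a l) (hl : 0 < l)
    {w : FreeGroup α} (h : 94 * (l : ℤ) < 100 * (L.pr w - L.pr 1)) :
    ∃ r ∈ R, ∃ u, u <+: r.toWord ∧ u <:+: w.toWord ∧ 9 * r.toWord.length ≤ 10 * u.length := by
  obtain ⟨n, hn⟩ := Int.le.dest (show L.pr 1 ≤ L.pr w by omega)
  have h1 := L.through_word 1 w n (by omega) hn.symm
  obtain ⟨r, hr, hr1, _⟩ := hL (L.pr 1)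
  refine ⟨r, hr, L.seg (L.pr 1) (min n l), ?_, ?_, ?_⟩
  · rw [← hr1]; exact seg_prefix _ _ (by omega)
  · refine (seg_prefix L (L.pr 1) (show min n l ≤ n by omega)).isInfix.trans ?_
    rw [inv_one, one_mul] at h1
    rw [h1]
    exact List.infix_append _ _ _
  · rw [← hr1, Line.seg_length, Line.seg_length]
    omega

theorem dehn (hR : SC R) {w : FreeGroup α} (hw : w ∈ Subgroup.normalClosure R) (h1 : w ≠ 1) :
    ∃ r ∈ R, ∃ u, u <+: r.toWord ∧ u <:+: w.toWord ∧ 9 * r.toWord.length ≤ 10 * u.length := by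
  have hw2 : w ∈ Subgroup.closure (Set.range (sys hR).el) := by
    refine Subgroup.closure_mono ?_ hw
    intro x hx
    obtain ⟨r, hr, hx⟩ := Group.mem_conjugatesOfSet_iff.1 hx
    obtain ⟨c, rfl⟩ := isConj_iff.1 hx
    exact ⟨(c, ⟨r, hr⟩), rfl⟩
  obtain ⟨A, hA⟩ := (sys hR).main hw2 h1
  have hlen := hR.len _ A.2.2
  have hA' : 94 * (A.2.1.toWord.length : ℤ) < 100 * |(rl hR A).pr 1 - (rl hR A).pr w| := hA
  rcases le_total ((rl hR A).pr 1) ((rl hR A).pr w) with h | h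
  · rw [abs_sub_comm, abs_of_nonneg (by omega)] at hA'
    exact dehn_aux (rl_isRel hR A) (by omega) hA'
  · rw [abs_of_nonneg (by omega)] at hA'
    refine dehn_aux ((rl_isRel hR A).rev hR.sym) (by omega) ?_
    rw [rev_pr, rev_pr]
    omega

end sys
end SCLine
namespace SCLine
open FreeGroup

variable {α : Type} [DecidableEq α] {R : Set (FreeGroup α)}

theorem invRev_infix {a b : List (α × Bool)} (h : a <:+: b) : invRev a <:+: invRev b := by
  obtain ⟨s, t, rfl⟩ := h
  refine ⟨invRev t, invRev s, ?_⟩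
  simp [invRev_append]

theorem toWord_rotate (hR : SC R) {r : FreeGroup α} (hr : r ∈ R) (n : ℕ) :
    (FreeGroup.mk (r.toWord.rotate n)).toWord = r.toWord.rotate n := by
  have hl : 0 < r.toWord.length := by have := hR.len r hr; omega
  have h := (rline 1 r hl (hR.sym.1 r hr)).seg_isReduced n r.toWord.length
  rw [seg_rline] at h
  have e : ((n : ℤ) % (r.toWord.length : ℤ)).toNat = n % r.toWord.length := by
    rw [← Int.natCast_mod, Int.toNat_natCast]
  rw [e, List.rotate_mod] at h
  rw [toWord_mk, h.reduce_eq]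

theorem mk_eq_one_of_invRev {L : List (α × Bool)} (h : L = invRev L) : FreeGroup.mk L = 1 := by
  have h2 : (FreeGroup.mk L)⁻¹ = FreeGroup.mk L := by rw [inv_mk, ← h]
  have h3 : (FreeGroup.mk L) ^ 2 = 1 := by
    rw [pow_two]
    nth_rewrite 1 [← h2]
    exact inv_mul_cancel _
  exact (pow_eq_one_iff_left (two_ne_zero)).1 h3

theorem not_rotated_inv {r : FreeGroup α} (h : r.toWord ~r invRev r.toWord) : r = 1 := by
  obtain ⟨n, hn, h⟩ := List.isRotated_iff_mod.1 h
  rw [List.rotate_eq_drop_append_take hn] at h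
  have e : invRev r.toWord = invRev (r.toWord.drop n) ++ invRev (r.toWord.take n) := by
    rw [← invRev_append, List.take_append_drop]
  rw [e] at h
  obtain ⟨h1, h2⟩ := List.append_inj h (by simp)
  rw [← mk_toWord (x := r), ← List.take_append_drop n r.toWord, ← mul_mk,
    mk_eq_one_of_invRev h1, mk_eq_one_of_invRev h2, one_mul]

theorem self_piece (hR : SC R) {r : FreeGroup α} (hr : r ∈ R) {z : List (α × Bool)}
    (h1 : z <:+: r.toWord) (h2 : invRev z <:+: r.toWord) : 100 * z.length < r.toWord.length := by
  have h3 := invRev_infix h2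
  rw [invRev_invRev] at h3
  obtain ⟨p, q, hp⟩ := h1
  obtain ⟨p', q', hp'⟩ := h3
  have hr' := hR.sym.2.2 r hr
  have w' := toWord_inv r
  have t1 := toWord_rotate hR hr p.length
  have t2 := toWord_rotate hR hr' p'.length
  have e1 : r.toWord.rotate p.length = z ++ (q ++ p) := by
    rw [← hp, List.append_assoc, List.rotate_append_length_eq, List.append_assoc]
  have e2 : r⁻¹.toWord.rotate p'.length = z ++ (q' ++ p') := by
    rw [w', ← hp', List.append_assoc, List.rotate_append_length_eq, List.append_assoc]
  have hne : FreeGroup.mk (r.toWord.rotate p.length) ≠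
      FreeGroup.mk (r⁻¹.toWord.rotate p'.length) := by
    intro h
    have h4 := congrArg FreeGroup.toWord h
    rw [t1, t2, w'] at h4
    have h5 : r.toWord ~r invRev r.toWord :=
      (List.IsRotated.forall r.toWord p.length).symm.trans
        (h4 ▸ List.IsRotated.forall (invRev r.toWord) p'.length)
    have := not_rotated_inv h5
    have h6 := hR.len r hr
    rw [this] at h6
    simp at h6
  have := hR.piece _ (hR.sym.2.1 r hr p.length) _ (hR.sym.2.1 _ hr' p'.length) hne z
    (by rw [t1, e1]; exact List.prefix_append _ _) (by rw [t2, e2]; exact List.prefix_append _ _)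
  rw [t1, List.length_rotate] at this
  exact this

theorem geod {g : FreeGroup α}
    (hmin : ∀ g', PresentedGroup.mk R g' = PresentedGroup.mk R g → g.norm ≤ g'.norm)
    {r : FreeGroup α} (hr : r ∈ R) {v : List (α × Bool)} (h1 : v <:+: g.toWord)
    (h2 : v <:+: r.toWord) : 2 * v.length ≤ r.toWord.length := by
  obtain ⟨s, t, hs⟩ := h1
  obtain ⟨p, q, hp⟩ := h2
  have eg : g = FreeGroup.mk s * FreeGroup.mk v * FreeGroup.mk t := by
    rw [mul_mk, mul_mk, hs, mk_toWord]
  have er : r = FreeGroup.mk p * FreeGroup.mk v * FreeGroup.mk q := by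
    rw [mul_mk, mul_mk, hp, mk_toWord]
  have hone : PresentedGroup.mk R r = 1 := PresentedGroup.one_of_mem hr
  rw [er, MonoidHom.map_mul, MonoidHom.map_mul] at hone
  have hv : PresentedGroup.mk R (FreeGroup.mk v) =
      (PresentedGroup.mk R (FreeGroup.mk p))⁻¹ * (PresentedGroup.mk R (FreeGroup.mk q))⁻¹ := by
    have := eq_inv_of_mul_eq_one_left hone
    rw [← this]; group
  have := hmin (FreeGroup.mk s * ((FreeGroup.mk p)⁻¹ * (FreeGroup.mk q)⁻¹) * FreeGroup.mk t) (by
    conv_rhs => rw [eg]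
    rw [MonoidHom.map_mul, MonoidHom.map_mul, MonoidHom.map_mul, MonoidHom.map_mul, MonoidHom.map_mul, MonoidHom.map_inv, MonoidHom.map_inv, hv])
  have n1 := norm_mul_le (FreeGroup.mk s * ((FreeGroup.mk p)⁻¹ * (FreeGroup.mk q)⁻¹))
    (FreeGroup.mk t)
  have n2 := norm_mul_le (FreeGroup.mk s) ((FreeGroup.mk p)⁻¹ * (FreeGroup.mk q)⁻¹)
  have n3 := norm_mul_le (FreeGroup.mk p)⁻¹ (FreeGroup.mk q)⁻¹
  rw [norm_inv_eq, norm_inv_eq] at n3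
  have m1 := norm_mk_le (L₁ := s)
  have m2 := norm_mk_le (L₁ := t)
  have m3 := norm_mk_le (L₁ := p)
  have m4 := norm_mk_le (L₁ := q)
  have l1 : g.norm = s.length + v.length + t.length := by
    unfold FreeGroup.norm; rw [← hs]; simp; omega
  have l2 : r.toWord.length = p.length + v.length + q.length := by
    rw [← hp]; simp; omega
  omega

theorem infix_snoc {u A : List (α × Bool)} {x : α × Bool} (h : u <:+: A ++ [x]) :
    ∃ u', u' <+: u ∧ u' <:+: A ∧ u.length ≤ u'.length + 1 := by
  rcases List.infix_concat_iff.1 h with h | h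
  · rcases List.suffix_concat_iff.1 h with rfl | ⟨t, rfl, ht⟩
    · exact ⟨[], List.prefix_rfl, List.nil_infix, by simp⟩
    · exact ⟨t, List.prefix_append _ _, ht.isInfix, by simp⟩
  · exact ⟨u, List.prefix_rfl, h, by omega⟩

theorem core (hR : SC R) {g : FreeGroup α}
    (hmin : ∀ g', PresentedGroup.mk R g' = PresentedGroup.mk R g → g.norm ≤ g'.norm)
    {r : FreeGroup α} (hr : r ∈ R) {u : List (α × Bool)} (hu : u <:+: r.toWord)
    {x y : α × Bool} (h : u <:+: (g.toWord ++ [x]) ++ invRev g.toWord ++ [y]) :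
    10 * u.length < 9 * r.toWord.length := by
  have hlen := hR.len r hr
  have geod' : ∀ v, v <:+: invRev g.toWord → v <:+: r.toWord → 2 * v.length ≤ r.toWord.length := by
    intro v h1 h2
    have h3 := invRev_infix h1
    have h4 := invRev_infix h2
    rw [invRev_invRev] at h3
    rw [← toWord_inv] at h4
    have := geod hmin (hR.sym.2.2 r hr) h3 h4
    simpa [toWord_inv] using this
  obtain ⟨u', hu', h', hl⟩ := infix_snoc h
  have hur : u' <:+: r.toWord := hu'.isInfix.trans hu
  rcases List.infix_append_iff.1 h' with h1 | h1 | ⟨l₁, l₂, rfl, h1, h2⟩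
  · obtain ⟨u'', hu'', h'', hl'⟩ := infix_snoc h1
    have := geod hmin hr h'' (hu''.isInfix.trans hur)
    omega
  · have := geod' u' h1 hur
    omega
  · have hr2 : l₂ <:+: r.toWord := (List.suffix_append _ _).isInfix.trans hur
    have hr1 : l₁ <:+: r.toWord := (List.prefix_append _ _).isInfix.trans hur
    have b2 := geod' l₂ h2.isInfix hr2
    rw [List.length_append] at hl
    rcases List.suffix_concat_iff.1 h1 with rfl | ⟨t, rfl, ht⟩
    · simp at hl; omega
    · have hrt : t <:+: r.toWord := (List.prefix_append _ _).isInfix.trans hr1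
      have b1 := geod hmin hr ht.isInfix hrt
      have hs2 : invRev l₂ <:+ g.toWord := by
        obtain ⟨c, hc⟩ := h2
        refine ⟨invRev c, ?_⟩
        rw [← invRev_append, hc, invRev_invRev]
      simp only [List.length_append, List.length_singleton] at hl
      rcases le_total t.length l₂.length with hle | hle
      · have hz : t <:+ invRev l₂ := List.suffix_of_suffix_length_le ht hs2 (by simpa using hle)
        have hz' := invRev_infix hz.isInfix
        rw [invRev_invRev] at hz'
        have := self_piece hR hr hrt (hz'.trans hr2)
        omega
      · have hz : invRev l₂ <:+ t := List.suffix_of_suffix_length_le hs2 ht (by simpa using hle)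
        have := self_piece hR hr (hz.isInfix.trans hrt) (by rwa [invRev_invRev])
        rw [invRev_length] at this
        omega

theorem letter_inv (x : α × Bool) : (FreeGroup.mk [x])⁻¹ = FreeGroup.mk [(x.1, !x.2)] := by
  rw [inv_mk]; rfl

theorem letters_not_conj (hR : SC R) {x y : α × Bool} (hxy : x ≠ y) :
    ¬ IsConj (PresentedGroup.mk R (FreeGroup.mk [x])) (PresentedGroup.mk R (FreeGroup.mk [y])) := by
  intro hconj
  obtain ⟨c, hc⟩ := isConj_iff.1 hconj
  obtain ⟨g0, rfl⟩ := PresentedGroup.mk_surjective R c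
  set φ := PresentedGroup.mk R with hφ
  set X := FreeGroup.mk [x] with hX
  set Y := FreeGroup.mk [y] with hY
  let P : ℕ → Prop := fun n => ∃ g : FreeGroup α, g.norm = n ∧ φ g * φ X * (φ g)⁻¹ = φ Y
  have hP : ∃ n, P n := ⟨_, g0, rfl, hc⟩
  classical
  obtain ⟨g, hgn, hg⟩ := Nat.find_spec hP
  have hm : ∀ g', φ g' * φ X * (φ g')⁻¹ = φ Y → g.norm ≤ g'.norm := by
    intro g' hg'
    rw [hgn]
    exact Nat.find_min' hP ⟨g', rfl, hg'⟩
  have hmin : ∀ g', φ g' = φ g → g.norm ≤ g'.norm := by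
    intro g' h
    exact hm g' (by rw [h, hg])
  have hw : g * X * g⁻¹ * Y⁻¹ ∈ Subgroup.normalClosure R := by
    rw [← PresentedGroup.mk_eq_one_iff, MonoidHom.map_mul, MonoidHom.map_mul, MonoidHom.map_mul, MonoidHom.map_inv, MonoidHom.map_inv, hg,
      mul_inv_cancel]
  by_cases h1 : g = 1
  · subst h1
    have hne : (1 : FreeGroup α) * X * 1⁻¹ * Y⁻¹ ≠ 1 := by
      intro h
      simp only [one_mul, inv_one, mul_one] at h
      have h2 := congrArg FreeGroup.toWord (mul_inv_eq_one.1 h)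
      rw [hX, hY, toWord_letter, toWord_letter] at h2
      exact hxy (by simpa using h2)
    obtain ⟨r, hr, u, _, hu, hb⟩ := dehn hR hw hne
    have hlen := hR.len r hr
    have n1 := hu.length_le
    have n2 : ((1 : FreeGroup α) * X * 1⁻¹ * Y⁻¹).norm ≤ 2 := by
      simp only [one_mul, inv_one, mul_one]
      have := norm_mul_le X Y⁻¹
      rw [norm_inv_eq, norm_letter, norm_letter] at this
      exact this
    unfold FreeGroup.norm at n2
    omega
  · have a1 : (g * X).norm = g.norm + X.norm := by
      rw [norm_letter]
      rcases norm_mul_letter g x with h | h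
      · exact h
      · rw [← hX] at h
        have := hm (g * X) (by rw [MonoidHom.map_mul, ← hg]; group)
        omega
    have a2 : (X * g⁻¹).norm = X.norm + (g⁻¹).norm := by
      have e : (X * g⁻¹) = (g * X⁻¹)⁻¹ := by group
      rw [norm_letter, norm_inv_eq, e, norm_inv_eq, letter_inv]
      rcases norm_mul_letter g (x.1, !x.2) with h | h
      · rw [h, add_comm]
      · have := hm (g * X⁻¹) (by rw [MonoidHom.map_mul, MonoidHom.map_inv, ← hg]; group)
        rw [letter_inv] at this
        omega
    have a3 : (g⁻¹ * Y⁻¹).norm = (g⁻¹).norm + (Y⁻¹).norm := by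
      rw [norm_inv_eq (x := Y), norm_letter, letter_inv]
      rcases norm_mul_letter g⁻¹ (y.1, !y.2) with h | h
      · exact h
      · have h2 := hm (Y * g) (by
          rw [MonoidHom.map_mul]
          calc φ Y * φ g * φ X * (φ Y * φ g)⁻¹ = φ Y * (φ g * φ X * (φ g)⁻¹) * (φ Y)⁻¹ := by group
            _ = φ Y := by rw [hg]; group)
        have e : (Y * g).norm = (g⁻¹ * FreeGroup.mk [(y.1, !y.2)]).norm := by
          rw [← letter_inv, ← norm_inv_eq, mul_inv_rev]
        rw [norm_inv_eq] at h
        omega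
    have hX1 : X ≠ 1 := by
      intro h
      have := norm_letter x
      rw [← hX, h, FreeGroup.norm_one] at this
      omega
    have b1 := norm_overlap a1 a2 hX1
    rw [← a1] at b1
    have b2 := norm_overlap b1 a3 (by simpa using h1)
    rw [← b1] at b2
    have hword : (g * X * g⁻¹ * Y⁻¹).toWord =
        (g.toWord ++ [x]) ++ invRev g.toWord ++ [(y.1, !y.2)] := by
      rw [toWord_mul_of_norm b2, toWord_mul_of_norm b1, toWord_mul_of_norm a1, toWord_inv,
        letter_inv, toWord_letter, toWord_letter]
    have hne : g * X * g⁻¹ * Y⁻¹ ≠ 1 := by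
      intro h
      rw [h] at hword
      simp at hword
    obtain ⟨r, hr, u, hu1, hu, hb⟩ := dehn hR hw hne
    rw [hword] at hu
    have := core hR hmin hr hu1.isInfix hu
    omega

theorem SC.of_cprime {lam : ℝ} (hlam0 : 0 < lam) (hlam : lam ≤ 1 / 100) (hR : CPrime lam R)
    (hlen : ∀ r ∈ R, 2 / lam + 1 ≤ (r.toWord.length : ℝ)) : SC R where
  sym := hR.1
  piece r₁ h1 r₂ h2 hne v p1 p2 := by
    have := hR.2 v ⟨r₁, h1, r₂, h2, hne, p1, p2⟩ r₁ h1 (by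
      obtain ⟨t, ht⟩ := p1
      exact ⟨[], t, by simp [ht]⟩)
    have h3 : (0 : ℝ) ≤ r₁.toWord.length := Nat.cast_nonneg _
    have h4 : (100 * v.length : ℝ) < r₁.toWord.length := by nlinarith
    exact_mod_cast h4
  len r hr := by
    have h := hlen r hr
    have h2 : 200 ≤ 2 / lam := by
      rw [le_div_iff₀ hlam0]; linarith
    have h4 : (200 : ℝ) < r.toWord.length := by linarith
    exact_mod_cast h4

theorem of_eq (i : α) : PresentedGroup.of (rels := R) i =
    PresentedGroup.mk R (FreeGroup.mk [(i, true)]) := rfl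

theorem of_inv_eq (i : α) : (PresentedGroup.of (rels := R) i)⁻¹ =
    PresentedGroup.mk R (FreeGroup.mk [(i, false)]) := by
  rw [of_eq, ← MonoidHom.map_inv, letter_inv]; rfl

end SCLine

theorem statement4 (k : ℕ) (lam : ℝ) (hlam0 : 0 < lam) (hlam : lam ≤ 1 / 100)
    (R : Set (FreeGroup (Fin k))) (hR : CPrime lam R)
    (hlen : ∀ r ∈ R, 2 / lam + 1 ≤ (r.toWord.length : ℝ)) :
    (∀ i j : Fin k, i ≠ j →
      ∀ x ∈ ({PresentedGroup.of i, (PresentedGroup.of i)⁻¹} : Set (PresentedGroup R)),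
        ∀ y ∈ ({PresentedGroup.of j, (PresentedGroup.of j)⁻¹} : Set (PresentedGroup R)),
          ¬ IsConj x y) ∧
    (∀ i : Fin k,
      ¬ IsConj (PresentedGroup.of (rels := R) i) (PresentedGroup.of (rels := R) i)⁻¹) := by
  have hS := SCLine.SC.of_cprime hlam0 hlam hR hlen
  constructor
  · intro i j hij x hx y hy
    have key : ∀ a b : Bool, ¬ IsConj (PresentedGroup.mk R (FreeGroup.mk [(i, a)]))
        (PresentedGroup.mk R (FreeGroup.mk [(j, b)])) := fun a b =>
      SCLine.letters_not_conj hS (fun h => hij (congrArg Prod.fst h))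
    rcases hx with rfl | rfl <;> rcases hy with rfl | rfl <;>
      simp only [SCLine.of_inv_eq, SCLine.of_eq] <;> exact key _ _
  · intro i
    rw [SCLine.of_inv_eq, SCLine.of_eq]
    exact SCLine.letters_not_conj hS (by simp)
end
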